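/- Let $G$ be a $4.5$-tough $(P_4 \cup P_1)$-free graph and let $S \subseteq V(G)$ be a minimal cutset of $G$. Then $G$ contains a path both of whose endvertices lie in $S$ and whose vertex set contains all of $V(G) \setminus S$. -/

import Mathlib

open SimpleGraph

/-- The number of connected components of `G - S`. -/
noncomputable def ncomps {V : Type*} (G : SimpleGraph V) (S : Set V) : ℕ :=
  Nat.card (G.induce Sᶜ).ConnectedComponent

/-- The graph `P₄ ∪ P₁`: a path on four vertices plus an isolated vertex. -/
def P4P1 : SimpleGraph (Fin 5) :=
  SimpleGraph.fromEdgeSet {s((0 : Fin 5), (1 : Fin 5)), s((1 : Fin 5), (2 : Fin 5)),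
    s((2 : Fin 5), (3 : Fin 5))}

/-- `G` has no induced subgraph isomorphic to `P₄ ∪ P₁`. -/
def P4P1Free {V : Type*} (G : SimpleGraph V) : Prop := IsEmpty (P4P1 ↪g G)

/-- `G` has no induced subgraph isomorphic to `P₄`. -/
def P4Free {V : Type*} (G : SimpleGraph V) : Prop := IsEmpty (SimpleGraph.pathGraph 4 ↪g G)

/-- `G` is `t`-tough. -/
def Tough {V : Type*} (t : ℝ) (G : SimpleGraph V) : Prop :=
  ∀ S : Set V, 2 ≤ ncomps G S → t * (ncomps G S : ℝ) ≤ (S.ncard : ℝ)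

/-- `S` is a cutset of `G`, i.e. `G - S` is disconnected. -/
def IsCutset {V : Type*} (G : SimpleGraph V) (S : Set V) : Prop :=
  2 ≤ ncomps G S

/-- `S` is a scattering set of `G`. -/
def IsScatSet {V : Type*} (G : SimpleGraph V) (S : Set V) : Prop :=
  2 ≤ ncomps G S ∧ ∀ T : Set V, 2 ≤ ncomps G T →
    (ncomps G T : ℤ) - (T.ncard : ℤ) ≤ (ncomps G S : ℤ) - (S.ncard : ℤ)

/-- `S` is a maximal scattering set of `G`. -/
def IsMaxScatSet {V : Type*} (G : SimpleGraph V) (S : Set V) : Prop :=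
  IsScatSet G S ∧ ∀ T : Set V, IsScatSet G T → S ⊆ T → S = T

/-- `G` is `t`-tough with respect to `S`. -/
def ToughWrt {V : Type*} (t : ℝ) (G : SimpleGraph V) (S : Set V) : Prop :=
  ∀ W : Set V, 2 ≤ ncomps G W →
    (∀ c : (G.induce Sᶜ).ConnectedComponent,
      ∃ v : ↥Sᶜ, (G.induce Sᶜ).connectedComponentMk v = c ∧ (v : V) ∉ W) →
    t * (ncomps G W : ℝ) ≤ (W.ncard : ℝ)

section Basics
open scoped Classical

/-- `G` has no induced `P₄ ∪ P₁`, in terms of adjacencies. -/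
def NoPathPoint {V : Type*} (G : SimpleGraph V) : Prop :=
  ∀ a b c d z : V, G.Adj a b → G.Adj b c → G.Adj c d → ¬ G.Adj a c → ¬ G.Adj b d → ¬ G.Adj a d →
    ¬ G.Adj z a → ¬ G.Adj z b → ¬ G.Adj z c → ¬ G.Adj z d → False

/-- Every family of at least two vertex sets separated by `T` has at most `2|T|/9` members. -/
def FamilyTough {V : Type*} (G : SimpleGraph V) : Prop :=
  ∀ (F : Finset (Finset V)) (T : Finset V),
    (∀ K ∈ F, K.Nonempty ∧ Disjoint K T ∧ ∀ x ∈ K, ∀ y, G.Adj x y → y ∈ K ∨ y ∈ T) →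
    (F : Set (Finset V)).PairwiseDisjoint id → 2 ≤ F.card → 9 * F.card ≤ 2 * T.card

/-- `D` lists the components of `G - S`, where `S` is a minimal cutset of a graph
satisfying the assumptions of the theorem. -/
structure CutSystem {V ι : Type*} (G : SimpleGraph V) (S : Finset V) (D : ι → Finset V) :
    Prop where
  noPathPoint : NoPathPoint G
  tough : FamilyTough G
  nonempty : ∀ i, (D i).Nonempty
  mem_unique : ∀ {i j x}, x ∈ D i → x ∈ D j → i = j
  notMem : ∀ {i x}, x ∈ D i → x ∉ S
  cover : ∀ {x}, x ∉ S → ∃ i, x ∈ D i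
  not_adj : ∀ {i j x y}, x ∈ D i → y ∈ D j → i ≠ j → ¬ G.Adj x y
  conn : ∀ i, ∀ A ⊆ D i, A.Nonempty → A ≠ D i → ∃ a ∈ A, ∃ b ∈ D i \ A, G.Adj a b
  nbr : ∀ s ∈ S, ∀ i, ∃ d ∈ D i, G.Adj s d
  two : ∀ i : ι, ∃ j, j ≠ i

variable {V : Type*} {G : SimpleGraph V}

theorem noPathPoint_of_P4P1Free (h : P4P1Free G) : NoPathPoint G := by
  intro a b c d z hab hbc hcd hac hbd had hza hzb hzc hzd
  have n1 : a ≠ c := by rintro rfl; exact had hcd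
  have n2 : b ≠ d := by rintro rfl; exact had hab
  have n3 : a ≠ d := by rintro rfl; exact hac hcd.symm
  have n4 : z ≠ a := by rintro rfl; exact hzb hab
  have n5 : z ≠ b := by rintro rfl; exact hza hab.symm
  have n6 : z ≠ c := by rintro rfl; exact hzd hcd
  have n7 : z ≠ d := by rintro rfl; exact hzc hcd.symm
  have n8 := hab.ne
  have n9 := hbc.ne
  have n10 := hcd.ne
  refine h.false ⟨⟨![a, b, c, d, z], ?_⟩, ?_⟩
  · intro i j hij
    fin_cases i <;> fin_cases j <;> simp_all
  · intro i j
    have e1 := mt SimpleGraph.Adj.symm hac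
    have e2 := mt SimpleGraph.Adj.symm hbd
    have e3 := mt SimpleGraph.Adj.symm had
    have e4 := mt SimpleGraph.Adj.symm hza
    have e5 := mt SimpleGraph.Adj.symm hzb
    have e6 := mt SimpleGraph.Adj.symm hzc
    have e7 := mt SimpleGraph.Adj.symm hzd
    have e8 := hab.symm
    have e9 := hbc.symm
    have e10 := hcd.symm
    change G.Adj (![a, b, c, d, z] i) (![a, b, c, d, z] j) ↔ P4P1.Adj i j
    fin_cases i <;> fin_cases j <;> simp_all [P4P1]

theorem mem_of_reachable_induce {T K : Finset V}
    (hK : ∀ x ∈ K, ∀ y, G.Adj x y → y ∈ K ∨ y ∈ T)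
    {u v : ↥((T : Set V)ᶜ)} (h : (G.induce (T : Set V)ᶜ).Reachable u v) (hu : (u : V) ∈ K) :
    (v : V) ∈ K := by
  obtain ⟨p⟩ := h
  induction p with
  | nil => exact hu
  | cons e p ih =>
    rename_i a b c
    apply ih
    rcases hK _ hu b (by simpa using e) with h | h
    · exact h
    · exact absurd h b.2

theorem familyTough_of_tough [Fintype V] (h : Tough 4.5 G) : FamilyTough G := by
  intro F T hF hd h2
  have hc : F.card ≤ ncomps G (T : Set V) := by
    choose r hr using fun K : F => (hF K.1 K.2).1
    have hrT : ∀ K : F, r K ∈ ((T : Set V)ᶜ) := fun K => by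
      have := Finset.disjoint_left.1 (hF K.1 K.2).2.1 (hr K)
      simpa using this
    let f : F → (G.induce (T : Set V)ᶜ).ConnectedComponent :=
      fun K => (G.induce (T : Set V)ᶜ).connectedComponentMk ⟨r K, hrT K⟩
    have hf : Function.Injective f := by
      intro K L hKL
      have hreach := ConnectedComponent.exact hKL
      have := mem_of_reachable_induce (hF K.1 K.2).2.2 hreach (hr K)
      by_contra hne
      have := Finset.disjoint_left.1 (hd K.2 L.2 (fun e => hne (Subtype.ext e))) this
      exact this (hr L)
    have := Nat.card_le_card_of_injective f hf
    simpa [ncomps] using this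
  have := h T (h2.trans hc)
  rw [Set.ncard_coe_finset] at this
  have h3 : (F.card : ℝ) ≤ ncomps G (T : Set V) := by exact_mod_cast hc
  have : (9 * F.card : ℝ) ≤ 2 * T.card := by linarith
  exact_mod_cast this

theorem exists_cutSystem [Fintype V] (htough : Tough 4.5 G) (hfree : P4P1Free G)
    {S : Set V} (hcut : IsCutset G S) (hmin : ∀ T : Set V, T ⊂ S → ¬ IsCutset G T) :
    ∃ D : (G.induce Sᶜ).ConnectedComponent → Finset V, CutSystem G S.toFinset D := by
  let H := G.induce Sᶜ
  let D : H.ConnectedComponent → Finset V :=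
    fun C => Finset.univ.filter fun v => ∃ h : v ∈ Sᶜ, H.connectedComponentMk ⟨v, h⟩ = C
  have memD : ∀ {C v}, v ∈ D C ↔ ∃ h : v ∈ Sᶜ, H.connectedComponentMk ⟨v, h⟩ = C := by
    intro C v; simp [D]
  have closed : ∀ {C x y}, x ∈ D C → G.Adj x y → y ∉ S → y ∈ D C := by
    intro C x y hx hxy hy
    obtain ⟨h, rfl⟩ := memD.1 hx
    refine memD.2 ⟨hy, ?_⟩
    apply ConnectedComponent.sound
    exact Adj.reachable (by simpa [H] using hxy.symm)
  have uniq : ∀ {i j x}, x ∈ D i → x ∈ D j → i = j := by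
    intro i j x hi hj
    obtain ⟨_, rfl⟩ := memD.1 hi
    obtain ⟨_, rfl⟩ := memD.1 hj
    rfl
  have hcut' : 2 ≤ Fintype.card H.ConnectedComponent := by
    have : 2 ≤ Nat.card H.ConnectedComponent := hcut
    simpa [Nat.card_eq_fintype_card] using this
  have nonempty : ∀ i, (D i).Nonempty := by
    intro i
    induction i using ConnectedComponent.ind with
    | h v => exact ⟨v, memD.2 ⟨v.2, rfl⟩⟩
  have two : ∀ i : H.ConnectedComponent, ∃ j, j ≠ i := by
    intro i
    have : Nontrivial H.ConnectedComponent := Fintype.one_lt_card_iff_nontrivial.1 hcut'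
    exact exists_ne i
  refine ⟨D, ⟨noPathPoint_of_P4P1Free hfree, familyTough_of_tough htough, nonempty, uniq, ?_, ?_,
    ?_, ?_, ?_, two⟩⟩
  · intro i x hx
    obtain ⟨h, _⟩ := memD.1 hx
    simpa using h
  · intro x hx
    exact ⟨_, memD.2 ⟨by simpa using hx, rfl⟩⟩
  · intro i j x y hx hy hij hxy
    obtain ⟨h, _⟩ := memD.1 hy
    exact hij (uniq (closed hx hxy h) hy)
  · intro i A hA hAne hAD
    by_contra hcon
    push Not at hcon
    obtain ⟨a, ha⟩ := hAne
    apply hAD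
    refine Finset.Subset.antisymm hA ?_
    intro b hb
    obtain ⟨hbS, hbi⟩ := memD.1 hb
    obtain ⟨haS, hai⟩ := memD.1 (hA ha)
    obtain ⟨p⟩ := ConnectedComponent.exact (hai.trans hbi.symm)
    have key : ∀ {u v : ↥(Sᶜ)} (p : H.Walk u v), (u : V) ∈ A → (v : V) ∈ A := by
      intro u v p
      induction p with
      | nil => exact id
      | cons e p ih =>
        rename_i u v w
        intro hu
        apply ih
        by_contra hv
        have e' : G.Adj u v := by simpa [H] using e
        exact hcon u hu v (Finset.mem_sdiff.2 ⟨closed (hA hu) e' v.2, hv⟩) e'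
    exact key p ha
  · intro s hs i
    by_contra hcon
    push Not at hcon
    have hsS : s ∈ S := by simpa using hs
    apply hmin (S \ {s}) ⟨Set.sdiff_subset, fun h => (h hsS).2 rfl⟩
    obtain ⟨j, hji⟩ := two i
    obtain ⟨x, hx⟩ := nonempty i
    obtain ⟨y, hy⟩ := nonempty j
    let T : Finset V := (S \ {s}).toFinset
    have hT : (T : Set V) = S \ {s} := by simp [T]
    have hcl : ∀ x ∈ D i, ∀ y, G.Adj x y → y ∈ D i ∨ y ∈ T := by
      intro x hx y hxy
      by_cases hy : y ∈ S
      · right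
        have : y ≠ s := by rintro rfl; exact hcon x hx hxy.symm
        simp [T, hy, this]
      · exact Or.inl (closed hx hxy hy)
    have hxT : x ∈ (T : Set V)ᶜ := by
      obtain ⟨h, _⟩ := memD.1 hx
      rw [hT]; exact fun h' => h h'.1
    have hyT : y ∈ (T : Set V)ᶜ := by
      obtain ⟨h, _⟩ := memD.1 hy
      rw [hT]; exact fun h' => h h'.1
    unfold IsCutset ncomps
    rw [← hT, Nat.card_eq_fintype_card]
    apply Fintype.one_lt_card_iff.2
    refine ⟨(G.induce (T : Set V)ᶜ).connectedComponentMk ⟨x, hxT⟩,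
      (G.induce (T : Set V)ᶜ).connectedComponentMk ⟨y, hyT⟩, fun h => ?_⟩
    have := mem_of_reachable_induce hcl (ConnectedComponent.exact h) hx
    exact hji (uniq hy this)

end Basics

section Merging
open scoped Classical

variable {V ι : Type*} {G : SimpleGraph V} {S : Finset V} {D : ι → Finset V}

/-- Adjacency in `G` with the edges inside `S` removed. -/
def OffAdj (G : SimpleGraph V) (S : Finset V) (x y : V) : Prop :=
  G.Adj x y ∧ (x ∉ S ∨ y ∉ S)

theorem OffAdj.symm {x y : V} (h : OffAdj G S x y) : OffAdj G S y x :=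
  ⟨h.1.symm, h.2.symm⟩

theorem isChain_offAdj_reverse {L : List V} (h : L.IsChain (OffAdj G S)) :
    L.reverse.IsChain (OffAdj G S) :=
  List.isChain_reverse.2 (h.imp fun _ _ => OffAdj.symm)

/-- A path of `G` with both ends in `S` and without edges inside `S`. -/
structure IsFragment (G : SimpleGraph V) (S : Finset V) (L : List V) : Prop where
  chain : L.IsChain (OffAdj G S)
  nodup : L.Nodup
  head : ∃ s ∈ S, L.head? = some s
  last : ∃ t ∈ S, L.getLast? = some t
  two_le : 2 ≤ L.length

theorem IsFragment.reverse {L : List V} (h : IsFragment G S L) : IsFragment G S L.reverse where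
  chain := isChain_offAdj_reverse h.chain
  nodup := List.nodup_reverse.2 h.nodup
  head := by simpa using h.last
  last := by simpa using h.head
  two_le := by simpa using h.two_le

theorem IsFragment.exists_cons {L : List V} (h : IsFragment G S L) :
    ∃ s x l, L = s :: x :: l ∧ s ∈ S ∧ x ∉ S ∧ G.Adj s x := by
  obtain ⟨s, hs, hhead⟩ := h.head
  have h2 := h.two_le
  match L, h, hhead, h2 with
  | a :: x :: l, h, hhead, _ =>
    have : OffAdj G S a x := (List.isChain_cons_cons.1 h.chain).1
    obtain rfl : a = s := by simpa using hhead
    exact ⟨a, x, l, rfl, hs, this.2.resolve_left (by simpa using hs), this.1⟩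

/-- The two pairs of an end and its neighbour can be linked. -/
def EndsMerge (G : SimpleGraph V) (s x t y : V) : Prop :=
  G.Adj s y ∨ G.Adj t x ∨ G.Adj x y

theorem EndsMerge.symm {s x t y : V} (h : EndsMerge G s x t y) : EndsMerge G t y s x := by
  rcases h with h | h | h
  · exact Or.inr (Or.inl h)
  · exact Or.inl h
  · exact Or.inr (Or.inr h.symm)

/-- Two paths can be linked at their heads. -/
def HeadsMerge (G : SimpleGraph V) (P Q : List V) : Prop :=
  ∃ s x p t y q, P = s :: x :: p ∧ Q = t :: y :: q ∧ EndsMerge G s x t y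

theorem IsFragment.append_of_offAdj {X Y : List V} {a b : V}
    (hX : X.IsChain (OffAdj G S)) (hY : Y.IsChain (OffAdj G S))
    (hXh : ∃ s ∈ S, X.head? = some s) (hYl : ∃ t ∈ S, Y.getLast? = some t)
    (ha : X.getLast? = some a) (hb : Y.head? = some b) (hab : OffAdj G S a b)
    (hn : ∀ v, (X ++ Y).count v ≤ 1) : IsFragment G S (X ++ Y) := by
  refine ⟨?_, List.nodup_iff_count_le_one.2 hn, ?_, ?_, ?_⟩
  · rw [List.isChain_append]
    refine ⟨hX, hY, ?_⟩
    intro x hx y hy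
    rw [ha] at hx; rw [hb] at hy
    obtain rfl : a = x := by simpa using hx
    obtain rfl : b = y := by simpa using hy
    exact hab
  · obtain ⟨s, hs, h⟩ := hXh
    exact ⟨s, hs, by simp [List.head?_append, h]⟩
  · obtain ⟨s, hs, h⟩ := hYl
    exact ⟨s, hs, by simp [List.getLast?_append, h]⟩
  · have h1 : 0 < X.length := by
      rcases X with _ | ⟨x, X⟩
      · simp at ha
      · simp
    have h2 : 0 < Y.length := by
      rcases Y with _ | ⟨x, X⟩
      · simp at hb
      · simp
    simp; omega

theorem HeadsMerge.exists_isFragment {P Q : List V} (hP : IsFragment G S P)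
    (hQ : IsFragment G S Q) (hd : ∀ v, P.count v + Q.count v ≤ 1) (h : HeadsMerge G P Q) :
    ∃ L, IsFragment G S L ∧ (∀ v, L.count v ≤ P.count v + Q.count v) ∧
      (∀ v ∉ S, v ∈ P ∨ v ∈ Q → v ∈ L) ∧ L.head? = P.getLast? ∧ L.getLast? = Q.getLast? := by
  obtain ⟨s', x', p', t', y', q', rfl, rfl, h⟩ := h
  obtain ⟨s, x, p, e, hs, hx, -⟩ := hP.exists_cons
  obtain ⟨rfl, rfl, rfl⟩ : s' = s ∧ x' = x ∧ p' = p := by simpa using e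
  obtain ⟨t, y, q, e, ht, hy, -⟩ := hQ.exists_cons
  obtain ⟨rfl, rfl, rfl⟩ : t' = t ∧ y' = y ∧ q' = q := by simpa using e
  have hPr := hP.reverse
  have c1 : (x' :: p').reverse.IsChain (OffAdj G S) :=
    isChain_offAdj_reverse hP.chain.tail
  have c2 : (y' :: q').IsChain (OffAdj G S) := hQ.chain.tail
  have h1 : ∃ s ∈ S, (x' :: p').reverse.head? = some s := by
    simpa using hPr.head
  have h2 : ∃ s ∈ S, (y' :: q').getLast? = some s := by
    simpa using hQ.last
  rcases h with h | h | h
  · refine ⟨(s' :: x' :: p').reverse ++ y' :: q', ?_, ?_, ?_, ?_, ?_⟩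
    · refine IsFragment.append_of_offAdj (a := s') (b := y') hPr.chain c2 hPr.head h2
        (by simp) (by simp) ⟨h, Or.inr hy⟩ ?_
      intro v
      have := hd v
      simp only [List.count_append, List.count_reverse]
      simp only [List.count_cons] at this ⊢
      omega
    · intro v
      simp only [List.count_append, List.count_reverse]
      simp only [List.count_cons]
      omega
    · intro v hv hvm
      have : v ≠ t' := by rintro rfl; exact hv ht
      simp at hvm ⊢; tauto
    · simp [List.head?_append, List.getLast?_cons]
    · simp [List.getLast?_append, List.getLast?_cons]
  · refine ⟨(x' :: p').reverse ++ t' :: y' :: q', ?_, ?_, ?_, ?_, ?_⟩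
    · refine IsFragment.append_of_offAdj (a := x') (b := t') c1 hQ.chain h1 hQ.last
        (by simp) (by simp) ⟨h.symm, Or.inl hx⟩ ?_
      intro v
      have := hd v
      simp only [List.count_append, List.count_reverse]
      simp only [List.count_cons] at this ⊢
      omega
    · intro v
      simp only [List.count_append, List.count_reverse]
      simp only [List.count_cons]
      omega
    · intro v hv hvm
      have : v ≠ s' := by rintro rfl; exact hv hs
      simp at hvm ⊢; tauto
    · simp [List.head?_append, List.getLast?_cons]
    · simp [List.getLast?_append, List.getLast?_cons]
  · refine ⟨(x' :: p').reverse ++ y' :: q', ?_, ?_, ?_, ?_, ?_⟩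
    · refine IsFragment.append_of_offAdj (a := x') (b := y') c1 c2 h1 h2
        (by simp) (by simp) ⟨h, Or.inl hx⟩ ?_
      intro v
      have := hd v
      simp only [List.count_append, List.count_reverse]
      simp only [List.count_cons] at this ⊢
      omega
    · intro v
      simp only [List.count_append, List.count_reverse]
      simp only [List.count_cons]
      omega
    · intro v hv hvm
      have : v ≠ s' := by rintro rfl; exact hv hs
      have : v ≠ t' := by rintro rfl; exact hv ht
      simp at hvm ⊢; tauto
    · simp [List.head?_append, List.getLast?_cons]
    · simp [List.getLast?_append, List.getLast?_cons]

/-- A vertex of `S` which is not complete to a component has a neighbour and a non-neighbour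
there that are adjacent. -/
theorem CutSystem.exists_adj_not_adj (C : CutSystem G S D) {s : V} (hs : s ∈ S) {e : ι} {z : V}
    (hz : z ∈ D e) (hsz : ¬ G.Adj s z) :
    ∃ c ∈ D e, ∃ g ∈ D e, G.Adj s c ∧ ¬ G.Adj s g ∧ G.Adj c g := by
  obtain ⟨d, hd, hsd⟩ := C.nbr s hs e
  obtain ⟨c, hc, g, hg, hcg⟩ := C.conn e ((D e).filter fun v => G.Adj s v)
    (Finset.filter_subset _ _) ⟨d, by simp [hd, hsd]⟩ (by
      intro h
      have : z ∈ (D e).filter fun v => G.Adj s v := by rw [h]; exact hz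
      exact hsz (Finset.mem_filter.1 this).2)
  simp only [Finset.mem_filter, Finset.mem_sdiff, not_and] at hc hg
  exact ⟨c, hc.1, g, hg.1, hc.2, hg.2 hg.1, hcg⟩

theorem CutSystem.not_adj_of_notMem (C : CutSystem G S D) {i : ι} {x y : V} (hx : x ∈ D i)
    (hy : y ∉ D i) (hyS : y ∉ S) : ¬ G.Adj x y := by
  obtain ⟨j, hj⟩ := C.cover hyS
  exact C.not_adj hx hj (by rintro rfl; exact hy hj)

theorem CutSystem.adj_of_not_endsMerge (C : CutSystem G S D) {s x t y : V} (hs : s ∈ S)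
    (hx : x ∉ S) (hy : y ∉ S) (hsx : G.Adj s x)
    (h : ¬ EndsMerge G s x t y) {e : ι} (hxe : x ∉ D e) (hye : y ∉ D e) {z : V} (hz : z ∈ D e) :
    G.Adj s z := by
  by_contra hsz
  obtain ⟨c, hc, g, hg, hsc, hsg, hcg⟩ := C.exists_adj_not_adj hs hz hsz
  unfold EndsMerge at h
  push Not at h
  refine C.noPathPoint x s c g y hsx.symm hsc hcg ?_ hsg ?_ (fun h' => h.2.2 h'.symm)
    (fun h' => h.1 h'.symm) ?_ ?_
  · exact fun h' => C.not_adj_of_notMem hc hxe hx h'.symm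
  · exact fun h' => C.not_adj_of_notMem hg hxe hx h'.symm
  · exact fun h' => C.not_adj_of_notMem hc hye hy h'.symm
  · exact fun h' => C.not_adj_of_notMem hg hye hy h'.symm

theorem CutSystem.endsMerge_of_mem_same (C : CutSystem G S D) {s₁ s₂ s₃ x₁ x₂ x₃ : V}
    (h₁ : s₁ ∈ S) (h₂ : s₂ ∈ S)
    (k₁ : x₁ ∉ S) (k₂ : x₂ ∉ S) (k₃ : x₃ ∉ S) (a₁ : G.Adj s₁ x₁) (a₂ : G.Adj s₂ x₂)
    {a : ι} (m₁ : x₁ ∈ D a) (m₂ : x₂ ∈ D a)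
    (n₁₂ : ¬ EndsMerge G s₁ x₁ s₂ x₂) (n₁₃ : ¬ EndsMerge G s₁ x₁ s₃ x₃)
    (n₂₃ : ¬ EndsMerge G s₂ x₂ s₃ x₃) : False := by
  have u₁₂ := n₁₂
  have u₁₃ := n₁₃
  have u₂₃ := n₂₃
  unfold EndsMerge at u₁₂ u₁₃ u₂₃
  push Not at u₁₂ u₁₃ u₂₃
  have nm : ∀ {e}, e ≠ a → x₁ ∉ D e ∧ x₂ ∉ D e := fun he =>
    ⟨fun h => he (C.mem_unique h m₁), fun h => he (C.mem_unique h m₂)⟩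
  by_cases m₃ : x₃ ∈ D a
  · obtain ⟨b, hb⟩ := C.two a
    obtain ⟨c, hc⟩ := C.nonempty b
    have b₁ := C.adj_of_not_endsMerge h₁ k₁ k₂ a₁ n₁₂ (nm hb).1 (nm hb).2 hc
    have b₂ := C.adj_of_not_endsMerge h₂ k₂ k₁ a₂ (fun h => n₁₂ h.symm) (nm hb).2 (nm hb).1 hc
    by_cases h : G.Adj s₁ s₂
    · exact C.noPathPoint x₁ s₁ s₂ x₂ x₃ a₁.symm h a₂ (fun h' => u₁₂.2.1 h'.symm) u₁₂.1 u₁₂.2.2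
        (fun h' => u₁₃.2.2 h'.symm) (fun h' => u₁₃.1 h'.symm) (fun h' => u₂₃.1 h'.symm)
        (fun h' => u₂₃.2.2 h'.symm)
    · exact C.noPathPoint x₁ s₁ c s₂ x₃ a₁.symm b₁ b₂.symm
        (C.not_adj m₁ hc hb.symm) h (fun h' => u₁₂.2.1 h'.symm)
        (fun h' => u₁₃.2.2 h'.symm) (fun h' => u₁₃.1 h'.symm)
        (C.not_adj m₃ hc hb.symm) (fun h' => u₂₃.1 h'.symm)
  · obtain ⟨b, hb⟩ := C.cover k₃
    have hba : b ≠ a := by rintro rfl; exact m₃ hb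
    exact u₁₃.1 (C.adj_of_not_endsMerge h₁ k₁ k₂ a₁ n₁₂ (nm hba).1 (nm hba).2 hb)

theorem CutSystem.endsMerge_of_three (C : CutSystem G S D) {s₁ s₂ s₃ x₁ x₂ x₃ : V}
    (h₁ : s₁ ∈ S) (h₂ : s₂ ∈ S) (h₃ : s₃ ∈ S)
    (k₁ : x₁ ∉ S) (k₂ : x₂ ∉ S) (k₃ : x₃ ∉ S)
    (a₁ : G.Adj s₁ x₁) (a₂ : G.Adj s₂ x₂) (a₃ : G.Adj s₃ x₃) :
    EndsMerge G s₁ x₁ s₂ x₂ ∨ EndsMerge G s₁ x₁ s₃ x₃ ∨ EndsMerge G s₂ x₂ s₃ x₃ := by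
  by_contra hcon
  push Not at hcon
  obtain ⟨n₁₂, n₁₃, n₂₃⟩ := hcon
  obtain ⟨a, ha⟩ := C.cover k₁
  obtain ⟨b, hb⟩ := C.cover k₂
  obtain ⟨c, hc⟩ := C.cover k₃
  by_cases hab : b = a
  · subst hab
    exact C.endsMerge_of_mem_same h₁ h₂ k₁ k₂ k₃ a₁ a₂ ha hb n₁₂ n₁₃ n₂₃
  by_cases hac : c = a
  · subst hac
    exact C.endsMerge_of_mem_same h₁ h₃ k₁ k₃ k₂ a₁ a₃ ha hc n₁₃ n₁₂ (fun h => n₂₃ h.symm)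
  by_cases hbc : c = b
  · subst hbc
    exact C.endsMerge_of_mem_same h₂ h₃ k₂ k₃ k₁ a₂ a₃ hb hc n₂₃
      (fun h => n₁₂ h.symm) (fun h => n₁₃ h.symm)
  exact n₁₂ (Or.inl (C.adj_of_not_endsMerge h₁ k₁ k₃ a₁ n₁₃
    (fun h => hab (C.mem_unique h ha)) (fun h => hbc (C.mem_unique hc h)) hb))

theorem CutSystem.headsMerge_of_three (C : CutSystem G S D) {P Q R : List V}
    (hP : IsFragment G S P) (hQ : IsFragment G S Q) (hR : IsFragment G S R) :
    HeadsMerge G P Q ∨ HeadsMerge G P R ∨ HeadsMerge G Q R := by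
  obtain ⟨s₁, x₁, p, rfl, h₁, k₁, a₁⟩ := hP.exists_cons
  obtain ⟨s₂, x₂, q, rfl, h₂, k₂, a₂⟩ := hQ.exists_cons
  obtain ⟨s₃, x₃, r, rfl, h₃, k₃, a₃⟩ := hR.exists_cons
  rcases C.endsMerge_of_three h₁ h₂ h₃ k₁ k₂ k₃ a₁ a₂ a₃ with h | h | h
  · exact Or.inl ⟨_, _, _, _, _, _, rfl, rfl, h⟩
  · exact Or.inr (Or.inl ⟨_, _, _, _, _, _, rfl, rfl, h⟩)
  · exact Or.inr (Or.inr ⟨_, _, _, _, _, _, rfl, rfl, h⟩)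

theorem exists_run {p : V → Prop} {L : List V} {v : V} (hv : v ∈ L) (hp : p v) :
    ∃ A R B, L = A ++ R ++ B ∧ R ≠ [] ∧ (∀ x ∈ R, p x) ∧ (∀ x ∈ A, ¬ p x) ∧
      ∀ x ∈ B.head?, ¬ p x := by
  let A := L.takeWhile fun x => ¬ p x
  let L' := L.dropWhile fun x => ¬ p x
  refine ⟨A, L'.takeWhile fun x => p x, L'.dropWhile fun x => p x, ?_, ?_, ?_, ?_, ?_⟩
  · rw [List.append_assoc, List.takeWhile_append_dropWhile]
    exact (List.takeWhile_append_dropWhile ..).symm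
  · have hne : L' ≠ [] := by
      intro h
      have := List.dropWhile_eq_nil_iff.1 h v hv
      simp [hp] at this
    obtain ⟨a, l, hal⟩ := List.exists_cons_of_ne_nil hne
    have : ¬ (decide ¬ p a) = true := by
      have := List.head_dropWhile_not (fun x => decide ¬ p x) (l := L) hne
      simp only [L'] at hal
      simp only [hal, List.head_cons] at this
      simp [this]
    have : p a := by simpa using this
    rw [hal]
    simp [this]
  · intro x hx
    simpa using List.mem_takeWhile_imp hx
  · intro x hx
    simpa using List.mem_takeWhile_imp hx
  · intro x hx
    rcases e : L'.dropWhile fun x => p x with _ | ⟨b, B⟩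
    · rw [e] at hx; simp at hx
    · rw [e] at hx
      obtain rfl : b = x := by simpa using hx
      have := List.head_dropWhile_not (fun x => decide (p x)) (l := L') (by simp [e])
      simpa [e] using this

end Merging

section MergingTwo
open scoped Classical

variable {V ι : Type*} {G : SimpleGraph V} {S : Finset V} {D : ι → Finset V}

/-- Gluing two chains along a run outside `S`. -/
theorem IsFragment.glue {X R Y : List V} {a b c c' : V}
    (hX : X.IsChain (OffAdj G S)) (hR : R.IsChain (OffAdj G S)) (hY : Y.IsChain (OffAdj G S))
    (hXh : ∃ s ∈ S, X.head? = some s) (hYl : ∃ t ∈ S, Y.getLast? = some t)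
    (hRS : ∀ x ∈ R, x ∉ S)
    (ha : X.getLast? = some a) (hc : R.head? = some c) (hc' : R.getLast? = some c')
    (hb : Y.head? = some b) (hac : G.Adj a c) (hcb : G.Adj c' b)
    (hn : ∀ v, X.count v + R.count v + Y.count v ≤ 1) : IsFragment G S (X ++ (R ++ Y)) := by
  have hcS : c ∉ S := hRS c (List.mem_of_mem_head? (by simp [hc]))
  have hcS' : c' ∉ S := hRS c' (List.mem_of_mem_getLast? (by simp [hc']))
  refine IsFragment.append_of_offAdj (a := a) (b := c) hX ?_ hXh ?_ ha ?_ ⟨hac, Or.inr hcS⟩ ?_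
  · rw [List.isChain_append]
    refine ⟨hR, hY, ?_⟩
    intro x hx y hy
    rw [hc'] at hx; rw [hb] at hy
    obtain rfl : c' = x := by simpa using hx
    obtain rfl : b = y := by simpa using hy
    exact ⟨hcb, Or.inl hcS'⟩
  · obtain ⟨t, ht, h⟩ := hYl
    exact ⟨t, ht, by simp [List.getLast?_append, h]⟩
  · simp [List.head?_append, hc]
  · intro v
    have := hn v
    simp only [List.count_append]
    omega

/-- Decomposition of a fragment along a maximal run inside a component. -/
theorem CutSystem.exists_run_of_isFragment (C : CutSystem G S D) {P : List V} {s x : V}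
    {p : List V} (hP : IsFragment G S P) (hPe : P = s :: x :: p) {e : ι} (hx : x ∉ D e)
    {v : V} (hv : v ∈ P) (hve : v ∈ D e) :
    ∃ A R B d d' c c', P = A ++ R ++ B ∧ (∀ y ∈ R, y ∈ D e) ∧ (∃ a, A = s :: x :: a) ∧
      A.getLast? = some d' ∧ d' ∈ S ∧ R.head? = some c ∧ R.getLast? = some c' ∧
      B.head? = some d ∧ d ∈ S ∧ G.Adj d' c ∧ G.Adj c' d ∧ c ∈ D e ∧ c' ∈ D e := by
  obtain ⟨A, R, B, hdec, hR, hRe, hA, hB⟩ := exists_run (p := fun v => v ∈ D e) hv hve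
  obtain ⟨s', x', p', hPe', hs', hx', -⟩ := hP.exists_cons
  obtain ⟨rfl, rfl, rfl⟩ : s = s' ∧ x = x' ∧ p = p' := by
    simpa using hPe.symm.trans hPe'
  obtain ⟨c, R₁, hRc⟩ := List.exists_cons_of_ne_nil hR
  have hcR : c ∈ R := by simp [hRc]
  have hhead : R.head? = some c := by simp [hRc]
  obtain ⟨c', hlast⟩ : ∃ c', R.getLast? = some c' := ⟨_, List.getLast?_eq_getLast_of_ne_nil hR⟩
  have hcR' : c' ∈ R := List.mem_of_mem_getLast? (by simp [hlast])
  have hA2 : ∃ a, A = s :: x :: a := by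
    have h := hPe.symm.trans hdec
    rcases A with _ | ⟨a, A⟩
    · rw [hRc] at h
      obtain ⟨rfl, -⟩ : s = c ∧ _ := by simpa using h
      exact absurd hs' (C.notMem (hRe _ hcR))
    · rcases A with _ | ⟨a', A⟩
      · rw [hRc] at h
        obtain ⟨-, rfl, -⟩ : s = a ∧ x = c ∧ _ := by simpa using h
        exact absurd (hRe _ hcR) hx
      · obtain ⟨rfl, rfl, -⟩ : s = a ∧ x = a' ∧ _ := by simpa using h
        exact ⟨A, rfl⟩
  have hAne : A ≠ [] := by
    obtain ⟨a, rfl⟩ := hA2; simp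
  have hBne : B ≠ [] := by
    rintro rfl
    obtain ⟨t, ht, hl⟩ := hP.last
    rw [hdec, List.append_nil, List.getLast?_append, hlast] at hl
    obtain rfl : c' = t := by simpa using hl
    exact C.notMem (hRe _ hcR') ht
  obtain ⟨d', hd'⟩ : ∃ d', A.getLast? = some d' := ⟨_, List.getLast?_eq_getLast_of_ne_nil hAne⟩
  obtain ⟨d, B', hBd⟩ := List.exists_cons_of_ne_nil hBne
  have hd : B.head? = some d := by simp [hBd]
  have hch := hP.chain
  rw [hdec, List.isChain_append, List.isChain_append] at hch
  obtain ⟨⟨-, -, h1⟩, -, h2⟩ := hch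
  have h1 := h1 d' (by simp [hd']) c (by simp [hhead])
  have h2 := h2 c' (by simp [List.getLast?_append, hlast]) d (by simp [hd])
  refine ⟨A, R, B, d, d', c, c', hdec, hRe, hA2, hd', ?_, hhead, hlast, hd, ?_, h1.1, h2.1,
    hRe _ hcR, hRe _ hcR'⟩
  · by_contra hS
    exact C.not_adj_of_notMem (hRe _ hcR) (hA _ (List.mem_of_mem_getLast? (by simp [hd']))) hS
      h1.1.symm
  · by_contra hS
    exact C.not_adj_of_notMem (hRe _ hcR') (hB d (by simp [hd])) hS h2.1

theorem CutSystem.merge_of_common_of_mem (C : CutSystem G S D) {P Q p q : List V} {s x t y : V}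
    (hP : IsFragment G S P) (hQ : IsFragment G S Q) (hd : ∀ v, P.count v + Q.count v ≤ 1)
    (hPe : P = s :: x :: p) (hQe : Q = t :: y :: q) {e : ι} (hx : x ∉ D e)
    (hse : ∀ z ∈ D e, G.Adj s z) (hte : ∀ z ∈ D e, G.Adj t z) {v : V} (hv : v ∈ P)
    (hve : v ∈ D e) :
    ∃ L, IsFragment G S L ∧ ∀ v ∉ S, v ∈ P ∨ v ∈ Q → v ∈ L := by
  obtain ⟨A, R, B, d, d', c, c', hdec, hRe, ⟨a, hAe⟩, hAl, hd'S, hRh, hRl, hBh, hdS, hd'c, hc'd,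
    hce, hce'⟩ := C.exists_run_of_isFragment hP hPe hx hv hve
  have hcnt : ∀ v, A.count v + R.count v + B.count v + Q.count v ≤ 1 := by
    intro v
    have := hd v
    rw [hdec] at this
    simpa [List.count_append, add_assoc] using this
  have hch := hP.chain
  rw [hdec, List.isChain_append, List.isChain_append] at hch
  obtain ⟨⟨hAc, hRc, -⟩, hBc, -⟩ := hch
  have hRS : ∀ y ∈ R, y ∉ S := fun y hy => C.notMem (hRe y hy)
  have hRS' : ∀ y ∈ R.reverse, y ∉ S := fun y hy => hRS y (by simpa using hy)
  have hs : s ∈ S := by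
    obtain ⟨s', hs', h⟩ := hP.head
    obtain rfl : s = s' := by simpa [hPe] using h
    exact hs'
  have ht : t ∈ S := by
    obtain ⟨s', hs', h⟩ := hQ.head
    obtain rfl : t = s' := by simpa [hQe] using h
    exact hs'
  have hAF : IsFragment G S A := by
    refine ⟨hAc, ?_, ⟨s, hs, by simp [hAe]⟩, ⟨d', hd'S, hAl⟩, by simp [hAe]⟩
    rw [List.nodup_iff_count_le_one]
    intro v
    have := hcnt v
    omega
  have hBlast : ∃ t ∈ S, B.getLast? = some t := by
    obtain ⟨t, ht, hl⟩ := hP.last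
    rw [hdec, List.getLast?_append] at hl
    obtain ⟨b, B', rfl⟩ : ∃ b B', B = b :: B' := by
      rcases B with _ | ⟨b, B'⟩
      · simp at hBh
      · exact ⟨b, B', rfl⟩
    rw [List.getLast?_eq_getLast_of_ne_nil (by simp)] at hl ⊢
    exact ⟨t, ht, by simpa using hl⟩
  have hQr := hQ.reverse
  have hQrl : Q.reverse.getLast? = some t := by simp [hQe]
  by_cases hBl : B.length ≤ 1
  · have hB1 : B = [d] := by
      rcases B with _ | ⟨b, _ | ⟨b', B⟩⟩
      · simp at hBh
      · simpa using hBh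
      · simp at hBl
    refine ⟨Q.reverse ++ (R ++ A), ?_, ?_⟩
    · refine IsFragment.glue hQr.chain hRc hAc hQr.head hAF.last hRS hQrl hRh hRl
        (b := s) (by simp [hAe]) (hte c hce) (hse c' hce').symm ?_
      intro v
      have := hcnt v
      simp only [List.count_reverse]
      omega
    · intro v hvS hm
      have : v ≠ d := by rintro rfl; exact hvS hdS
      rw [hdec, hB1] at hm
      simp at hm ⊢; tauto
  · have hBF : IsFragment G S B := by
      refine ⟨hBc, ?_, ⟨d, hdS, hBh⟩, hBlast, by omega⟩
      rw [List.nodup_iff_count_le_one]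
      intro v
      have := hcnt v
      omega
    have hcov : ∀ {v}, v ∈ P ∨ v ∈ Q ↔ v ∈ A ∨ v ∈ R ∨ v ∈ B ∨ v ∈ Q := by
      intro v; rw [hdec]; simp [or_assoc]
    rcases C.headsMerge_of_three hAF.reverse hBF.reverse hQr with h | h | h
    · obtain ⟨M, hM, hMc, hMv, hMh, hMl⟩ := h.exists_isFragment hAF.reverse hBF.reverse (by
        intro v; have := hcnt v; simp only [List.count_reverse]; omega)
      refine ⟨Q.reverse ++ (R ++ M), ?_, ?_⟩
      · refine IsFragment.glue hQr.chain hRc hM.chain hQr.head hM.last hRS hQrl hRh hRl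
          (b := s) (by simp [hMh, hAe]) (hte c hce) (hse c' hce').symm ?_
        intro v
        have := hcnt v
        have := hMc v
        simp only [List.count_reverse] at this ⊢
        omega
      · intro v hvS hm
        have := hMv v hvS
        rw [hcov] at hm
        simp at this ⊢; tauto
    · obtain ⟨M, hM, hMc, hMv, hMh, hMl⟩ := h.exists_isFragment hAF.reverse hQr (by
        intro v; have := hcnt v; simp only [List.count_reverse]; omega)
      refine ⟨B.reverse ++ (R.reverse ++ M), ?_, ?_⟩
      · refine IsFragment.glue hBF.reverse.chain (isChain_offAdj_reverse hRc) hM.chain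
          hBF.reverse.head hM.last hRS' (a := d) (by simpa using hBh) (c := c')
          (by simpa using hRl) (c' := c) (by simpa using hRh)
          (b := s) (by simp [hMh, hAe]) hc'd.symm (hse c hce).symm ?_
        intro v
        have := hcnt v
        have := hMc v
        simp only [List.count_reverse] at this ⊢
        omega
      · intro v hvS hm
        have := hMv v hvS
        rw [hcov] at hm
        simp at this ⊢; tauto
    · obtain ⟨M, hM, hMc, hMv, hMh, hMl⟩ := h.exists_isFragment hBF.reverse hQr (by
        intro v; have := hcnt v; simp only [List.count_reverse]; omega)
      refine ⟨M ++ (R ++ A), ?_, ?_⟩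
      · refine IsFragment.glue hM.chain hRc hAc hM.head hAF.last hRS (a := t)
          (by simp [hMl, hQe]) hRh hRl (b := s) (by simp [hAe]) (hte c hce) (hse c' hce').symm ?_
        intro v
        have := hcnt v
        have := hMc v
        simp only [List.count_reverse] at this ⊢
        omega
      · intro v hvS hm
        have := hMv v hvS
        rw [hcov] at hm
        simp at this ⊢; tauto

theorem CutSystem.merge_of_common (C : CutSystem G S D) {P Q p q : List V} {s x t y : V}
    (hP : IsFragment G S P) (hQ : IsFragment G S Q) (hd : ∀ v, P.count v + Q.count v ≤ 1)
    (hcov : ∀ v ∉ S, v ∈ P ∨ v ∈ Q)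
    (hPe : P = s :: x :: p) (hQe : Q = t :: y :: q) {e : ι} (hx : x ∉ D e) (hy : y ∉ D e) :
    ∃ L, IsFragment G S L ∧ ∀ v ∉ S, v ∈ P ∨ v ∈ Q → v ∈ L := by
  by_cases hm : EndsMerge G s x t y
  · obtain ⟨L, hL, -, hLv, -⟩ := HeadsMerge.exists_isFragment hP hQ hd ⟨_, _, _, _, _, _, hPe, hQe, hm⟩
    exact ⟨L, hL, hLv⟩
  obtain ⟨s', x', p', hPe', hs', hx', hsx⟩ := hP.exists_cons
  obtain ⟨rfl, rfl, rfl⟩ : s = s' ∧ x = x' ∧ p = p' := by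
    simpa using hPe.symm.trans hPe'
  obtain ⟨t', y', q', hQe', ht', hy', hty⟩ := hQ.exists_cons
  obtain ⟨rfl, rfl, rfl⟩ : t = t' ∧ y = y' ∧ q = q' := by
    simpa using hQe.symm.trans hQe'
  have hse : ∀ z ∈ D e, G.Adj s z := fun z hz =>
    C.adj_of_not_endsMerge hs' hx' hy' hsx hm hx hy hz
  have hte : ∀ z ∈ D e, G.Adj t z := fun z hz =>
    C.adj_of_not_endsMerge ht' hy' hx' hty (fun h => hm h.symm) hy hx hz
  obtain ⟨z, hz⟩ := C.nonempty e
  rcases hcov z (C.notMem hz) with h | h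
  · exact C.merge_of_common_of_mem hP hQ hd hPe hQe hx hse hte h hz
  · obtain ⟨L, hL, hLv⟩ := C.merge_of_common_of_mem hQ hP (fun v => by rw [add_comm]; exact hd v)
      hQe hPe hy hte hse h hz
    exact ⟨L, hL, fun v hv hm => hLv v hv hm.symm⟩

/-- A list meeting two different components. -/
def IsCrossing (D : ι → Finset V) (L : List V) : Prop :=
  ∃ i j, i ≠ j ∧ (∃ x ∈ L, x ∈ D i) ∧ ∃ y ∈ L, y ∈ D j

theorem CutSystem.merge_two (C : CutSystem G S D) {P Q : List V}
    (hP : IsFragment G S P) (hQ : IsFragment G S Q) (hd : ∀ v, P.count v + Q.count v ≤ 1)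
    (hcov : ∀ v ∉ S, v ∈ P ∨ v ∈ Q) (hcr : IsCrossing D P) :
    ∃ L, IsFragment G S L ∧ ∀ v ∉ S, v ∈ P ∨ v ∈ Q → v ∈ L := by
  by_contra hcon
  obtain ⟨s, x, p, hPe, hs, hx, hsx⟩ := hP.exists_cons
  obtain ⟨t, y, q, hQe, ht, hy, hty⟩ := hQ.exists_cons
  obtain ⟨s', x', p', hPe', hs', hx', hsx'⟩ := hP.reverse.exists_cons
  have hno : ¬ EndsMerge G s x t y := fun hm => by
    obtain ⟨L, hL, -, hLv, -⟩ :=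
      HeadsMerge.exists_isFragment hP hQ hd ⟨_, _, _, _, _, _, hPe, hQe, hm⟩
    exact hcon ⟨L, hL, hLv⟩
  unfold EndsMerge at hno
  push Not at hno
  have key₁ : ∀ e, x ∈ D e ∨ y ∈ D e := fun e => by
    by_contra h
    push Not at h
    exact hcon (C.merge_of_common hP hQ hd hcov hPe hQe h.1 h.2)
  have key₂ : ∀ e, x' ∈ D e ∨ y ∈ D e := fun e => by
    by_contra h
    push Not at h
    obtain ⟨L, hL, hLv⟩ := C.merge_of_common hP.reverse hQ (by simpa using hd) (by simpa using hcov)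
      hPe' hQe h.1 h.2
    exact hcon ⟨L, hL, by simpa using hLv⟩
  obtain ⟨a, ha⟩ := C.cover hx
  obtain ⟨b, hb⟩ := C.cover hy
  have hab : a ≠ b := by
    rintro rfl
    obtain ⟨e, he⟩ := C.two a
    rcases key₁ e with h | h
    · exact he (C.mem_unique h ha)
    · exact he (C.mem_unique h hb)
  have honly : ∀ e, e = a ∨ e = b := fun e => by
    rcases key₁ e with h | h
    · exact Or.inl (C.mem_unique h ha)
    · exact Or.inr (C.mem_unique h hb)
  have hxb : x ∉ D b := fun h => hab (C.mem_unique ha h)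
  have hxa' : x' ∈ D a := (key₂ a).resolve_right fun h => hab (C.mem_unique h hb)
  have hxb' : x' ∉ D b := fun h => hab (C.mem_unique hxa' h)
  obtain ⟨v, hv, hvb⟩ : ∃ v ∈ P, v ∈ D b := by
    obtain ⟨i, j, hij, ⟨u, hu, hui⟩, w, hw, hwj⟩ := hcr
    rcases honly i with rfl | rfl
    · rcases honly j with rfl | rfl
      · exact absurd rfl hij
      · exact ⟨w, hw, hwj⟩
    · exact ⟨u, hu, hui⟩
  obtain ⟨A, R, B, d, d', c, c', hdec, hRe, ⟨a₁, hAe⟩, hAl, hd'S, hRh, hRl, hBh, hdS, hd'c, hc'd,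
    hce, hce'⟩ := C.exists_run_of_isFragment hP hPe hxb hv hvb
  have hcnt : ∀ v, A.count v + R.count v + B.count v + Q.count v ≤ 1 := by
    intro v
    have := hd v
    rw [hdec] at this
    simpa [List.count_append, add_assoc] using this
  have hch := hP.chain
  rw [hdec, List.isChain_append, List.isChain_append] at hch
  obtain ⟨⟨hAc, hRc, -⟩, hBc, -⟩ := hch
  have hRS' : ∀ y ∈ R.reverse, y ∉ S := fun y hy => C.notMem (hRe y (by simpa using hy))
  have hAF : IsFragment G S A := by
    refine ⟨hAc, ?_, ⟨s, hs, by simp [hAe]⟩, ⟨d', hd'S, hAl⟩, by simp [hAe]⟩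
    rw [List.nodup_iff_count_le_one]
    intro v
    have := hcnt v
    omega
  have hBe : ∃ b₁, B.reverse = s' :: x' :: b₁ := by
    have h := hPe'.symm.trans (congrArg List.reverse hdec)
    simp only [List.reverse_append] at h
    have hcR' : c' ∈ R := List.mem_of_mem_getLast? (by simp [hRl])
    have hRr : ∃ r, R.reverse = c' :: r := by
      have : R.reverse.head? = some c' := by simpa using hRl
      rcases e : R.reverse with _ | ⟨r, r'⟩
      · rw [e] at this; simp at this
      · rw [e] at this
        obtain rfl : r = c' := by simpa using this
        exact ⟨r', rfl⟩
    obtain ⟨r, hr⟩ := hRr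
    rw [hr] at h
    rcases e : B.reverse with _ | ⟨b₀, _ | ⟨b₁, B'⟩⟩
    · rw [e] at h
      obtain ⟨rfl, -⟩ : s' = c' ∧ _ := by simpa using h
      exact absurd hs' (C.notMem hce')
    · rw [e] at h
      obtain ⟨-, rfl, -⟩ : s' = b₀ ∧ x' = c' ∧ _ := by simpa using h
      exact absurd hce' hxb'
    · rw [e] at h
      obtain ⟨rfl, rfl, -⟩ : s' = b₀ ∧ x' = b₁ ∧ _ := by simpa using h
      exact ⟨B', rfl⟩
  obtain ⟨b₁, hBe⟩ := hBe
  have hBF : IsFragment G S B.reverse := by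
    refine ⟨isChain_offAdj_reverse hBc, ?_, ⟨s', hs', by simp [hBe]⟩, ⟨d, hdS, by simpa using hBh⟩,
      by simp [hBe]⟩
    rw [List.nodup_iff_count_le_one]
    intro v
    have := hcnt v
    simp only [List.count_reverse]
    omega
  have hm : EndsMerge G s x s' x' := by
    by_contra hm
    exact hno.1 (C.adj_of_not_endsMerge hs hx hx' hsx hm hxb hxb' hb)
  obtain ⟨M, hM, hMc, hMv, hMh, hMl⟩ := HeadsMerge.exists_isFragment hAF hBF (by
    intro v; have := hcnt v; simp only [List.count_reverse]; omega)
    ⟨_, _, _, _, _, _, hAe, hBe, hm⟩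
  have hfin : ∃ (Q' : List V) (a' : V), Q'.IsChain (OffAdj G S) ∧ (∃ s ∈ S, Q'.head? = some s) ∧
      Q'.getLast? = some a' ∧ G.Adj a' c' ∧ (∀ v, Q'.count v ≤ Q.count v) ∧
      ∀ v ∉ S, v ∈ Q → v ∈ Q' := by
    by_cases htc : G.Adj t c'
    · exact ⟨Q.reverse, t, hQ.reverse.chain, hQ.reverse.head, by simp [hQe], htc, by simp, by simp⟩
    · have hyc : G.Adj y c' := by
        by_contra hyc
        obtain ⟨g, hg, g', hg', htg, htg', hgg⟩ := C.exists_adj_not_adj ht ha hno.2.1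
        exact C.noPathPoint y t g g' c' hty.symm htg hgg (C.not_adj hb hg hab.symm) htg'
          (C.not_adj hb hg' hab.symm) (fun h => hyc h.symm) (fun h => htc h.symm)
          (C.not_adj hce' hg hab.symm) (C.not_adj hce' hg' hab.symm)
      refine ⟨(y :: q).reverse, y, ?_, ?_, by simp, hyc, ?_, ?_⟩
      · have := hQ.chain
        rw [hQe] at this
        exact isChain_offAdj_reverse this.tail
      · have := hQ.reverse.head
        rw [hQe] at this
        simpa using this
      · intro v
        rw [hQe]
        simp only [List.count_reverse, List.count_cons]
        omega
      · intro v hv hvm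
        have : v ≠ t := by rintro rfl; exact hv ht
        rw [hQe] at hvm
        simp at hvm ⊢; tauto
  obtain ⟨Q', a', hQc, hQh, hQl, hac, hQcnt, hQv⟩ := hfin
  refine hcon ⟨Q' ++ (R.reverse ++ M), ?_, ?_⟩
  · refine IsFragment.glue hQc (isChain_offAdj_reverse hRc) hM.chain hQh hM.last hRS' hQl
      (c := c') (by simpa using hRl) (c' := c) (by simpa using hRh) (b := d') (by rw [hMh, hAl])
      hac hd'c.symm ?_
    intro v
    have := hcnt v
    have := hMc v
    have := hQcnt v
    simp only [List.count_reverse] at *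
    omega
  · intro v hvS hvm
    have h1 := hMv v hvS
    have h2 := hQv v hvS
    rw [hdec] at hvm
    simp at hvm h1 ⊢; tauto

theorem CutSystem.exists_isFragment_of_family (C : CutSystem G S D) :
    ∀ (n : ℕ) (F : List (List V)), F.length = n → F ≠ [] → (∀ L ∈ F, IsFragment G S L) →
      (∀ v, (F.flatten).count v ≤ 1) → (∀ v ∉ S, v ∈ F.flatten) → (∃ L ∈ F, IsCrossing D L) →
      ∃ L, IsFragment G S L ∧ ∀ v ∉ S, v ∈ L := by
  intro n
  induction n using Nat.strong_induction_on with
  | _ n ih =>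
  intro F hn hne hF hcnt hcov hcr
  have step : ∀ (P Q : List V) (F' : List (List V)), (P :: Q :: F').Perm F →
      HeadsMerge G P Q → ∃ L, IsFragment G S L ∧ ∀ v ∉ S, v ∈ L := by
    intro P Q F' hperm hm
    have hcnt' : ∀ v, P.count v + (Q.count v + F'.flatten.count v) ≤ 1 := by
      intro v
      have h1 := hcnt v
      rw [← hperm.flatten.count_eq v] at h1
      simpa [List.count_append] using h1
    obtain ⟨L, hL, hLc, hLv, -, -⟩ := hm.exists_isFragment (hF P (hperm.subset (by simp)))
      (hF Q (hperm.subset (by simp))) (fun v => by have := hcnt' v; omega)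
    refine ih (F'.length + 1) ?_ (L :: F') (by simp) (by simp) ?_ ?_ ?_ ?_
    · have := hperm.length_eq
      simp at this; omega
    · intro K hK
      rcases List.mem_cons.1 hK with rfl | hK
      · exact hL
      · exact hF K (hperm.subset (by simp [hK]))
    · intro v
      have h1 := hcnt' v
      have h2 := hLc v
      simp only [List.flatten_cons, List.count_append]
      omega
    · intro v hv
      have h1 := hcov v hv
      rw [← hperm.flatten.mem_iff] at h1
      have h2 := hLv v hv
      simp only [List.flatten_cons, List.mem_append] at h1 ⊢
      tauto
    · obtain ⟨K, hK, i, j, hij, ⟨u, hu, hui⟩, w, hw, hwj⟩ := hcr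
      rw [← hperm.mem_iff] at hK
      by_cases hK' : K ∈ F'
      · exact ⟨K, by simp [hK'], i, j, hij, ⟨u, hu, hui⟩, w, hw, hwj⟩
      · have hKPQ : K = P ∨ K = Q := by
          simp only [List.mem_cons] at hK; tauto
        refine ⟨L, by simp, i, j, hij, ⟨u, hLv u (C.notMem hui) ?_, hui⟩, w,
          hLv w (C.notMem hwj) ?_, hwj⟩
        · rcases hKPQ with rfl | rfl <;> tauto
        · rcases hKPQ with rfl | rfl <;> tauto
  match F, hn, hne, hF, hcnt, hcov, hcr, step with
  | [P], _, _, hF, _, hcov, _, _ => exact ⟨P, hF P (by simp), by simpa using hcov⟩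
  | [P, Q], _, _, hF, hcnt, hcov, hcr, _ =>
    have hd : ∀ v, P.count v + Q.count v ≤ 1 := by simpa [List.count_append] using hcnt
    have hcov' : ∀ v ∉ S, v ∈ P ∨ v ∈ Q := by simpa using hcov
    obtain ⟨K, hK, hKc⟩ := hcr
    have hKPQ : K = P ∨ K = Q := by simpa using hK
    rcases hKPQ with rfl | rfl
    · obtain ⟨L, hL, h⟩ := C.merge_two (hF K (by simp)) (hF Q (by simp)) hd hcov' hKc
      exact ⟨L, hL, fun v hv => h v hv (hcov' v hv)⟩
    · obtain ⟨L, hL, h⟩ := C.merge_two (hF K (by simp)) (hF P (by simp))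
        (fun v => by rw [add_comm]; exact hd v) (fun v hv => (hcov' v hv).symm) hKc
      exact ⟨L, hL, fun v hv => h v hv (hcov' v hv).symm⟩
  | P :: Q :: R :: F', _, _, hF, _, _, _, step =>
    rcases C.headsMerge_of_three (hF P (by simp)) (hF Q (by simp)) (hF R (by simp)) with h | h | h
    · exact step _ _ _ (List.Perm.refl _) h
    · exact step _ _ (Q :: F') ((List.Perm.swap _ _ _).cons _) h
    · exact step _ _ (P :: F') (((List.Perm.swap _ _ _).cons _).trans (List.Perm.swap _ _ _)) h

/-- A family of disjoint fragments covering `V ∖ S`, one of which is crossing, gives the path. -/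
theorem CutSystem.exists_walk_of_family (C : CutSystem G S D)
    {F : List (List V)} (hF : ∀ L ∈ F, IsFragment G S L)
    (hcnt : ∀ v, (F.flatten).count v ≤ 1) (hcov : ∀ v ∉ S, v ∈ F.flatten)
    (hcr : ∃ L ∈ F, IsCrossing D L) :
    ∃ (u v : V) (p : G.Walk u v), u ∈ S ∧ v ∈ S ∧ u ≠ v ∧ p.IsPath ∧ ∀ x ∉ S, x ∈ p.support := by
  have hne : F ≠ [] := by
    rintro rfl
    obtain ⟨L, hL, -⟩ := hcr
    simp at hL
  obtain ⟨L, hL, hLv⟩ := C.exists_isFragment_of_family _ F rfl hne hF hcnt hcov hcr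
  have hLne : L ≠ [] := by
    rintro rfl
    have := hL.two_le
    simp at this
  have hsup := Walk.support_ofSupport hLne (hL.chain.imp fun _ _ h => h.1)
  refine ⟨_, _, Walk.ofSupport L hLne (hL.chain.imp fun _ _ h => h.1), ?_, ?_, ?_, ?_, ?_⟩
  · obtain ⟨s, hs, h⟩ := hL.head
    rw [List.head?_eq_some_head hLne] at h
    obtain rfl : _ = s := by simpa using h
    exact hs
  · obtain ⟨s, hs, h⟩ := hL.last
    rw [List.getLast?_eq_getLast_of_ne_nil hLne] at h
    obtain rfl : _ = s := by simpa using h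
    exact hs
  · obtain ⟨s, x, l, rfl, hs, hx, -⟩ := hL.exists_cons
    have hn := hL.nodup
    intro h
    simp only [List.head_cons] at h
    rw [List.getLast_cons (by simp)] at h
    exact (List.nodup_cons.1 hn).1 (h ▸ List.getLast_mem _)
  · rw [Walk.isPath_def, hsup]
    exact hL.nodup
  · rw [hsup]
    exact hLv

end MergingTwo

section PathCovers
open scoped Classical

variable {V : Type*} {G : SimpleGraph V}

theorem Finset.val_eq_add_of_disjoint {A B C : Finset V} (h : Disjoint A B) (hC : A ∪ B = C) :
    C.val = A.val + B.val := by
  rw [← hC, ← Finset.disjUnion_eq_union A B h]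
  rfl

theorem Finset.mem_iff_of_val_eq_add {A B C : Finset V} (h : C.val = A.val + B.val) {v : V} :
    v ∈ C ↔ v ∈ A ∨ v ∈ B := by
  rw [← Finset.mem_val, h, Multiset.mem_add, Finset.mem_val, Finset.mem_val]

theorem Finset.card_of_val_eq_add {A B C : Finset V} (h : C.val = A.val + B.val) :
    C.card = A.card + B.card := by
  rw [← Finset.card_val, h, Multiset.card_add, Finset.card_val, Finset.card_val]

theorem Finset.disjoint_of_val_eq_add {A B C : Finset V} (h : C.val = A.val + B.val) :
    Disjoint A B := by
  have := C.nodup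
  rw [h, Multiset.nodup_add] at this
  exact Finset.disjoint_val.1 this.2.2

/-- `C` contains no induced path on four vertices. -/
def NoPathOn (G : SimpleGraph V) (C : Finset V) : Prop :=
  ∀ a ∈ C, ∀ b ∈ C, ∀ c ∈ C, ∀ d ∈ C, G.Adj a b → G.Adj b c → G.Adj c d →
    ¬ G.Adj a c → ¬ G.Adj b d → ¬ G.Adj a d → False

/-- All edges between `A` and `B` are present. -/
def JoinedTo (G : SimpleGraph V) (A B : Finset V) : Prop := ∀ a ∈ A, ∀ b ∈ B, G.Adj a b

/-- No edges between `A` and `B` are present. -/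
def Apart (G : SimpleGraph V) (A B : Finset V) : Prop := ∀ a ∈ A, ∀ b ∈ B, ¬ G.Adj a b

theorem JoinedTo.symm {A B : Finset V} (h : JoinedTo G A B) : JoinedTo G B A :=
  fun b hb a ha => (h a ha b hb).symm

theorem Apart.symm {A B : Finset V} (h : Apart G A B) : Apart G B A :=
  fun b hb a ha hab => h a ha b hb hab.symm

theorem NoPathOn.mono {A B : Finset V} (h : NoPathOn G B) (hAB : A ⊆ B) : NoPathOn G A :=
  fun a ha b hb c hc d hd => h a (hAB ha) b (hAB hb) c (hAB hc) d (hAB hd)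

theorem NoPathOn.compl {C : Finset V} (h : NoPathOn G C) : NoPathOn Gᶜ C := by
  intro a ha b hb c hc d hd hab hbc hcd hac hbd had
  have n1 : a ≠ c := by rintro rfl; exact had hcd
  have n2 : b ≠ d := by rintro rfl; exact had hab
  have n3 : a ≠ d := by rintro rfl; exact hac hcd.symm
  simp only [SimpleGraph.compl_adj, not_and, not_not] at *
  exact h b hb d hd a ha c hc (hbd n2) (had n3).symm (hac n1) (fun h => hab.2 h.symm)
    (fun h => hcd.2 h.symm) hbc.2

theorem NoPathOn.split_insert_of_apart {X Y : Finset V} {v : V}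
    (hN : NoPathOn G (insert v (X ∪ Y))) (hv : v ∉ X ∪ Y) (hXY : Disjoint X Y) (hX : X.Nonempty)
    (hY : Y.Nonempty) (ha : Apart G X Y) :
    ∃ X' Y' : Finset V, (insert v (X ∪ Y)).val = X'.val + Y'.val ∧ X'.Nonempty ∧ Y'.Nonempty ∧
      (JoinedTo G X' Y' ∨ Apart G X' Y') := by
  have key : ∀ {X Y : Finset V}, NoPathOn G (insert v (X ∪ Y)) → v ∉ X ∪ Y → Disjoint X Y →
      X.Nonempty → Y.Nonempty → Apart G X Y → (∃ y ∈ Y, G.Adj v y) → (∃ z ∈ X, ¬ G.Adj v z) →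
      ∃ X' Y' : Finset V, (insert v (X ∪ Y)).val = X'.val + Y'.val ∧ X'.Nonempty ∧ Y'.Nonempty ∧
      (JoinedTo G X' Y' ∨ Apart G X' Y') := by
    intro X Y hN hv hXY hX hY ha ⟨y, hy, hvy⟩ ⟨z, hz, hvz⟩
    let X₁ := X.filter fun x => ¬ G.Adj v x
    have hX₁ : ∀ {x}, x ∈ X₁ ↔ x ∈ X ∧ ¬ G.Adj v x := by simp [X₁]
    refine ⟨X₁, insert v (X ∪ Y) \ X₁, ?_, ⟨z, hX₁.2 ⟨hz, hvz⟩⟩, ⟨v, ?_⟩, Or.inr ?_⟩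
    · refine Finset.val_eq_add_of_disjoint Finset.disjoint_sdiff (Finset.union_sdiff_of_subset ?_)
      intro x hx
      simp [(hX₁.1 hx).1]
    · simp only [Finset.mem_sdiff, Finset.mem_insert, true_or, true_and, hX₁]
      rintro ⟨h, -⟩
      exact hv (Finset.mem_union_left _ h)
    · intro x hx w hw hxw
      rw [hX₁] at hx
      simp only [Finset.mem_sdiff, Finset.mem_insert, Finset.mem_union, hX₁, not_and, not_not] at hw
      obtain ⟨rfl | hwX | hwY, hw2⟩ := hw
      · exact hx.2 hxw.symm
      · refine hN x (by simp [hx.1]) w (by simp [hwX]) v (by simp) y (by simp [hy]) hxw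
          (hw2 hwX).symm hvy (fun h => hx.2 h.symm) (ha w hwX y hy) (ha x hx.1 y hy)
      · exact ha x hx.1 w hwY hxw
  have hYX : insert v (X ∪ Y) = insert v (Y ∪ X) := by rw [Finset.union_comm]
  by_cases h1 : ∃ y ∈ Y, G.Adj v y
  · by_cases h2 : ∃ x ∈ X, G.Adj v x
    · by_cases h3 : ∃ z ∈ X, ¬ G.Adj v z
      · exact key hN hv hXY hX hY ha h1 h3
      · by_cases h4 : ∃ z ∈ Y, ¬ G.Adj v z
        · rw [hYX] at hN ⊢
          rw [Finset.union_comm] at hv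
          exact key hN hv hXY.symm hY hX ha.symm h2 h4
        · push Not at h3 h4
          refine ⟨{v}, X ∪ Y, ?_, by simp, hX.mono Finset.subset_union_left, Or.inl ?_⟩
          · exact Finset.val_eq_add_of_disjoint (by simpa using hv) rfl
          · intro a ha b hb
            obtain rfl : a = v := by simpa using ha
            rcases Finset.mem_union.1 hb with h | h
            · exact h3 b h
            · exact h4 b h
    · push Not at h2
      refine ⟨X, insert v Y, ?_, hX, by simp, Or.inr ?_⟩
      · refine Finset.val_eq_add_of_disjoint ?_ (by ext; simp)
        rw [Finset.disjoint_insert_right]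
        exact ⟨fun h => hv (by simp [h]), hXY⟩
      · intro x hx y hy hxy
        rcases Finset.mem_insert.1 hy with rfl | h
        · exact h2 x hx hxy.symm
        · exact ha x hx y h hxy
  · push Not at h1
    refine ⟨insert v X, Y, ?_, by simp, hY, Or.inr ?_⟩
    · refine Finset.val_eq_add_of_disjoint ?_ (by ext; simp)
      rw [Finset.disjoint_insert_left]
      exact ⟨fun h => hv (by simp [h]), hXY⟩
    · intro x hx y hy hxy
      rcases Finset.mem_insert.1 hx with rfl | h
      · exact h1 y hy hxy
      · exact ha x h y hy hxy

/-- A `P₄`-free graph on at least two vertices is a disjoint union or a join. -/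
theorem NoPathOn.split {C : Finset V} (hN : NoPathOn G C) (h2 : 2 ≤ C.card) :
    ∃ X Y : Finset V, C.val = X.val + Y.val ∧ X.Nonempty ∧ Y.Nonempty ∧
      (JoinedTo G X Y ∨ Apart G X Y) := by
  induction C using Finset.induction_on with
  | empty => simp at h2
  | insert v C hv ih =>
    by_cases hC : 2 ≤ C.card
    · obtain ⟨X, Y, hXY, hX, hY, h⟩ := ih (hN.mono (Finset.subset_insert _ _)) hC
      have hU : C = X ∪ Y := by
        ext u; simp [Finset.mem_iff_of_val_eq_add hXY]
      have hd := Finset.disjoint_of_val_eq_add hXY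
      subst hU
      rcases h with h | h
      · obtain ⟨X', Y', h1, h2, h3, h4⟩ :=
          NoPathOn.split_insert_of_apart (G := Gᶜ) hN.compl hv hd hX hY
            (fun a ha b hb hab => (SimpleGraph.compl_adj _ _ _).1 hab |>.2 (h a ha b hb))
        refine ⟨X', Y', h1, h2, h3, ?_⟩
        have hd' := Finset.disjoint_of_val_eq_add h1
        rcases h4 with h4 | h4
        · exact Or.inr fun a ha b hb hab => ((SimpleGraph.compl_adj _ _ _).1 (h4 a ha b hb)).2 hab
        · refine Or.inl fun a ha b hb => ?_
          have := h4 a ha b hb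
          rw [SimpleGraph.compl_adj, not_and, not_not] at this
          exact this (by rintro rfl; exact Finset.disjoint_left.1 hd' ha hb)
      · exact NoPathOn.split_insert_of_apart hN hv hd hX hY h
    · have h1 : C.card = 1 := by
        rw [Finset.card_insert_of_notMem hv] at h2; omega
      obtain ⟨u, rfl⟩ := Finset.card_eq_one.1 h1
      refine ⟨{v}, {u}, Finset.val_eq_add_of_disjoint (by simpa using hv) rfl, by simp, by simp, ?_⟩
      by_cases huv : G.Adj v u
      · left; intro a ha b hb; simp at ha hb; subst ha hb; exact huv
      · right; intro a ha b hb; simp at ha hb; subst ha hb; exact huv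

/-- `F` is the concatenation of at most `r` paths of `G`. -/
def PathsLE (G : SimpleGraph V) (r : ℕ) (F : List V) : Prop :=
  ∃ Ls : List (List V), Ls.length ≤ r ∧ (∀ L ∈ Ls, L.IsChain G.Adj) ∧ Ls.flatten = F

/-- `F` is the concatenation of exactly `r` nonempty paths of `G`. -/
def PathsEq (G : SimpleGraph V) (r : ℕ) (F : List V) : Prop :=
  ∃ Ls : List (List V), Ls.length = r ∧ (∀ L ∈ Ls, L ≠ [] ∧ L.IsChain G.Adj) ∧ Ls.flatten = F

theorem pathsEq_refine : ∀ (n : ℕ) (Ls : List (List V)) (r : ℕ),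
    Ls.flatten.length = n → (∀ L ∈ Ls, L ≠ [] ∧ L.IsChain G.Adj) → Ls.length ≤ r →
    r ≤ Ls.flatten.length → PathsEq G r Ls.flatten := by
  intro n
  induction n with
  | zero =>
    intro Ls r hn h h1 h2
    rw [hn] at h2
    exact ⟨Ls, by omega, h, rfl⟩
  | succ n ih =>
    intro Ls r hn h h1 h2
    match Ls, hn, h, h1, h2 with
    | [], hn, _, _, _ => simp at hn
    | [] :: Ls, _, h, _, _ => exact absurd rfl (h [] (by simp)).1
    | [a] :: Ls, hn, h, h1, h2 =>
      have hn' : Ls.flatten.length = n := by simpa using hn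
      simp only [List.length_cons, List.flatten_cons, List.length_append, List.length_nil] at h1 h2
      obtain ⟨Ls', hl, hc, hf⟩ := ih Ls (r - 1) hn' (fun L hL => h L (by simp [hL]))
        (by omega) (by omega)
      refine ⟨[a] :: Ls', by simp; omega, ?_, by simp [hf]⟩
      intro L hL
      rcases List.mem_cons.1 hL with rfl | hL
      · simp
      · exact hc L hL
    | (a :: b :: L) :: Ls, hn, h, h1, h2 =>
      by_cases hr : ((a :: b :: L) :: Ls).length = r
      · exact ⟨_, hr, h, rfl⟩
      have hn' : ((b :: L) :: Ls).flatten.length = n := by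
        simp only [List.length_cons, List.flatten_cons, List.length_append] at hn ⊢
        omega
      simp only [List.length_cons, List.flatten_cons, List.length_append] at h1 h2 hr hn'
      have hab := (h (a :: b :: L) (by simp)).2
      obtain ⟨Ls', hl, hc, hf⟩ := ih ((b :: L) :: Ls) (r - 1) (by simp only [List.length_cons, List.flatten_cons, List.length_append]; omega)
        (by
          intro K hK
          rcases List.mem_cons.1 hK with rfl | hK
          · exact ⟨by simp, (List.isChain_cons_cons.1 hab).2⟩
          · exact h K (by simp [hK]))
        (by simp only [List.length_cons] at h1 hr ⊢; omega)
        (by simp only [List.length_cons, List.flatten_cons, List.length_append]; omega)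
      refine ⟨[a] :: Ls', by simp; omega, ?_, by simp [hf]⟩
      intro K hK
      rcases List.mem_cons.1 hK with rfl | hK
      · simp
      · exact hc K hK

theorem PathsLE.pathsEq {r r' : ℕ} {F : List V} (h : PathsLE G r F) (h1 : r ≤ r')
    (h2 : r' ≤ F.length) : PathsEq G r' F := by
  obtain ⟨Ls, hl, hc, rfl⟩ := h
  have hf : (Ls.filter fun l => !l.isEmpty).flatten = Ls.flatten := List.flatten_filter_not_isEmpty
  rw [← hf]
  refine pathsEq_refine _ _ _ rfl ?_ ((List.length_filter_le _ _).trans (hl.trans h1)) (by rwa [hf])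
  intro L hL
  rw [List.mem_filter] at hL
  refine ⟨?_, hc L hL.1⟩
  rintro rfl
  simp at hL

theorem pathsLE_length (F : List V) : PathsLE G F.length F := by
  refine ⟨F.map fun v => [v], by simp, by simp, ?_⟩
  induction F with
  | nil => rfl
  | cons a F ih => simp [ih]

theorem PathsLE.mono {r r' : ℕ} {F : List V} (h : PathsLE G r F) (hr : r ≤ r') : PathsLE G r' F := by
  obtain ⟨Ls, hl, h⟩ := h
  exact ⟨Ls, hl.trans hr, h⟩

theorem exists_mem_flatten_split {Ls : List (List V)} {x : V} (h : x ∈ Ls.flatten) :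
    ∃ Ls₁ L₁ L₂ Ls₂, Ls = Ls₁ ++ (L₁ ++ x :: L₂) :: Ls₂ := by
  obtain ⟨L, hL, hx⟩ := List.mem_flatten.1 h
  obtain ⟨Ls₁, Ls₂, rfl⟩ := List.append_of_mem hL
  obtain ⟨L₁, L₂, rfl⟩ := List.append_of_mem hx
  exact ⟨Ls₁, L₁, L₂, Ls₂, rfl⟩

theorem PathsLE.exists_head {r : ℕ} {F : List V} (h : PathsLE G r F) {x : V} (hx : x ∈ F) :
    ∃ F', F.Perm (x :: F') ∧ PathsLE G (r + 1) (x :: F') := by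
  obtain ⟨Ls, hl, hc, rfl⟩ := h
  obtain ⟨Ls₁, L₁, L₂, Ls₂, rfl⟩ := exists_mem_flatten_split hx
  refine ⟨L₂ ++ (L₁ ++ (Ls₁ ++ Ls₂).flatten), ?_, (x :: L₂) :: L₁ :: (Ls₁ ++ Ls₂), ?_, ?_, by simp⟩
  · rw [List.perm_iff_count]
    intro v
    simp only [List.flatten_append, List.flatten_cons, List.count_append, List.count_cons]
    omega
  · simp at hl ⊢; omega
  · have h1 := hc (L₁ ++ x :: L₂) (by simp)
    intro L hL
    simp only [List.mem_cons, List.mem_append] at hL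
    rcases hL with rfl | rfl | hL | hL
    · exact h1.right_of_append
    · exact h1.left_of_append
    · exact hc L (by simp [hL])
    · exact hc L (by simp [hL])

theorem PathsLE.exists_last {r : ℕ} {F : List V} {x : V} (h : PathsLE G r (x :: F)) {y : V}
    (hy : y ∈ F) (hxy : x ≠ y) :
    ∃ F', F.Perm (F' ++ [y]) ∧ PathsLE G (r + 1) (x :: (F' ++ [y])) := by
  obtain ⟨Ls, hl, hc, hF⟩ := h
  obtain ⟨Ls₁, L₁, L₂, Ls₂, rfl⟩ := exists_mem_flatten_split (x := y) (Ls := Ls) (by simp [hF, hy])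
  obtain ⟨K, hK⟩ : ∃ K, Ls₁.flatten ++ L₁ = x :: K := by
    rcases e : Ls₁.flatten ++ L₁ with _ | ⟨z, K⟩
    · simp only [List.append_eq_nil_iff] at e
      rw [List.flatten_append, e.1, List.flatten_cons, e.2] at hF
      exact absurd (by simpa using congrArg List.head? hF.symm) hxy
    · refine ⟨K, ?_⟩
      rw [List.flatten_append, List.flatten_cons, List.append_assoc, ← List.append_assoc, e] at hF
      obtain ⟨rfl, -⟩ : z = x ∧ _ := by simpa using hF
      rfl
  have hF' : F = K ++ (y :: L₂ ++ Ls₂.flatten) := by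
    have : x :: F = x :: (K ++ (y :: L₂ ++ Ls₂.flatten)) := by
      rw [← hF, ← List.cons_append, ← hK]; simp
    simpa using this
  refine ⟨K ++ (Ls₂.flatten ++ L₂.reverse), ?_, Ls₁ ++ L₁ :: (Ls₂ ++ [(y :: L₂).reverse]), ?_, ?_, ?_⟩
  · rw [hF', List.perm_iff_count]
    intro v
    simp only [List.count_append, List.count_cons, List.count_reverse, List.count_nil]
    omega
  · simp at hl ⊢; omega
  · have h1 := hc (L₁ ++ y :: L₂) (by simp)
    intro L hL
    simp only [List.mem_cons, List.mem_append, List.not_mem_nil, or_false] at hL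
    rcases hL with hL | rfl | hL | rfl
    · exact hc L (by simp [hL])
    · exact h1.left_of_append
    · exact hc L (by simp [hL])
    · exact List.isChain_reverse.2 (h1.right_of_append.imp fun _ _ h => h.symm)
  · have := congrArg (· ++ (Ls₂.flatten ++ (L₂.reverse ++ [y]))) hK
    simpa using this

theorem exists_weave_eq : ∀ (n : ℕ) {E F : List V}, PathsEq G (n + 1) E → PathsEq G (n + 1) F →
    (∀ a ∈ E, ∀ b ∈ F, G.Adj a b) →
    ∃ L : List V, L.IsChain G.Adj ∧ L.Perm (E ++ F) ∧ L.head? = E.head? ∧ L.getLast? = F.getLast? := by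
  intro n
  induction n with
  | zero =>
    rintro _ _ ⟨Ls, hl, hc, rfl⟩ ⟨Ms, hl', hc', rfl⟩ hj
    obtain ⟨L, rfl⟩ := List.length_eq_one_iff.1 hl
    obtain ⟨M, rfl⟩ := List.length_eq_one_iff.1 hl'
    refine ⟨L ++ M, ?_, by simp, ?_, ?_⟩
    · rw [List.isChain_append]
      refine ⟨(hc L (by simp)).2, (hc' M (by simp)).2, fun x hx y hy => hj x ?_ y ?_⟩
      · simpa using List.mem_of_mem_getLast? hx
      · simpa using List.mem_of_mem_head? hy
    · obtain ⟨a, L', rfl⟩ := List.exists_cons_of_ne_nil (hc L (by simp)).1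
      simp
    · have := (hc' M (by simp)).1
      simp [List.getLast?_append, List.getLast?_eq_getLast_of_ne_nil this]
  | succ n ih =>
    rintro _ _ ⟨Ls, hl, hc, rfl⟩ ⟨Ms, hl', hc', rfl⟩ hj
    obtain ⟨L, Ls, rfl⟩ := List.exists_cons_of_length_eq_add_one hl
    obtain ⟨M, Ms, rfl⟩ := List.exists_cons_of_length_eq_add_one hl'
    obtain ⟨W, hW, hWp, hWh, hWl⟩ := ih (E := Ls.flatten) (F := Ms.flatten)
      ⟨Ls, by simpa using hl, fun K hK => hc K (by simp [hK]), rfl⟩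
      ⟨Ms, by simpa using hl', fun K hK => hc' K (by simp [hK]), rfl⟩
      (fun a ha b hb => hj a (by simp at ha ⊢; tauto) b (by simp at hb ⊢; tauto))
    have hL := hc L (by simp)
    have hM := hc' M (by simp)
    refine ⟨L ++ (M ++ W), ?_, ?_, ?_, ?_⟩
    · rw [List.isChain_append, List.isChain_append]
      refine ⟨hL.2, ⟨hM.2, hW, fun x hx y hy => (hj y ?_ x ?_).symm⟩, fun x hx y hy => hj x ?_ y ?_⟩
      · rw [hWh] at hy
        simpa using Or.inr (List.mem_flatten.1 (List.mem_of_mem_head? hy))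
      · simpa using Or.inl (List.mem_of_mem_getLast? hx)
      · simpa using Or.inl (List.mem_of_mem_getLast? hx)
      · have : y ∈ M := by
          obtain ⟨a, M', rfl⟩ := List.exists_cons_of_ne_nil hM.1
          obtain rfl : a = y := by simpa using hy
          simp
        simpa using Or.inl this
    · rw [List.perm_iff_count] at hWp ⊢
      intro v
      have := hWp v
      simp only [List.flatten_cons, List.count_append] at this ⊢
      omega
    · obtain ⟨a, L', rfl⟩ := List.exists_cons_of_ne_nil hL.1
      simp
    · have hne : Ms.flatten ≠ [] := by
        obtain ⟨K, Ms', rfl⟩ := List.exists_cons_of_length_eq_add_one (by simpa using hl')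
        have := (hc' K (by simp)).1
        simp [this]
      have := List.getLast?_eq_getLast_of_ne_nil hne
      rw [List.getLast?_append, List.getLast?_append, hWl, List.flatten_cons, List.getLast?_append,
        this]
      simp

theorem exists_weave_succ {n : ℕ} {E F : List V} (hE : PathsEq G (n + 2) E)
    (hF : PathsEq G (n + 1) F) (hj : ∀ a ∈ E, ∀ b ∈ F, G.Adj a b) :
    ∃ L : List V, L.IsChain G.Adj ∧ L.Perm (E ++ F) ∧ L.head? = E.head? ∧ L.getLast? = E.getLast? := by
  obtain ⟨Ls, hl, hc, rfl⟩ := hE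
  obtain ⟨L, Ls, rfl⟩ := List.exists_cons_of_length_eq_add_one hl
  obtain ⟨W, hW, hWp, hWh, hWl⟩ := exists_weave_eq n (E := F) (F := Ls.flatten) hF
    ⟨Ls, by simpa using hl, fun K hK => hc K (by simp [hK]), rfl⟩
    (fun a ha b hb => (hj b (by simp at hb ⊢; tauto) a ha).symm)
  have hL := hc L (by simp)
  refine ⟨L ++ W, ?_, ?_, ?_, ?_⟩
  · rw [List.isChain_append]
    refine ⟨hL.2, hW, fun x hx y hy => hj x ?_ y ?_⟩
    · simpa using Or.inl (List.mem_of_mem_getLast? hx)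
    · rw [hWh] at hy
      exact List.mem_of_mem_head? hy
  · rw [List.perm_iff_count] at hWp ⊢
    intro v
    have := hWp v
    simp only [List.flatten_cons, List.count_append] at this ⊢
    omega
  · obtain ⟨a, L', rfl⟩ := List.exists_cons_of_ne_nil hL.1
    simp
  · have hne : Ls.flatten ≠ [] := by
      obtain ⟨K, Ms', rfl⟩ := List.exists_cons_of_length_eq_add_one (by simpa using hl)
      have := (hc K (by simp)).1
      simp [this]
    have := List.getLast?_eq_getLast_of_ne_nil hne
    rw [List.getLast?_append, hWl, List.flatten_cons, List.getLast?_append, this]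

end PathCovers

section HamiltonPaths
open scoped Classical

variable {V : Type*} {G : SimpleGraph V}

/-- `C` is spanned by a path of `G` from `x` to `y`. -/
def HamPath (G : SimpleGraph V) (C : Finset V) (x y : V) : Prop :=
  ∃ L : List V, (L : Multiset V) = C.val ∧ L.IsChain G.Adj ∧ L.head? = some x ∧ L.getLast? = some y

/-- `C` is spanned by a path of `G` starting at `x`. -/
def HamFrom (G : SimpleGraph V) (C : Finset V) (x : V) : Prop :=
  ∃ L : List V, (L : Multiset V) = C.val ∧ L.IsChain G.Adj ∧ L.head? = some x

/-- `B` can be partitioned into at most `r` paths of `G`. -/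
def HasCover (G : SimpleGraph V) (r : ℕ) (B : Finset V) : Prop :=
  ∃ F : List V, (F : Multiset V) = B.val ∧ PathsLE G r F

theorem HamPath.symm {C : Finset V} {x y : V} (h : HamPath G C x y) : HamPath G C y x := by
  obtain ⟨L, h1, h2, h3, h4⟩ := h
  refine ⟨L.reverse, by rw [← h1]; simp, ?_, by simpa, by simpa⟩
  exact List.isChain_reverse.2 (h2.imp fun _ _ h => h.symm)

theorem HamPath.hamFrom {C : Finset V} {x y : V} (h : HamPath G C x y) : HamFrom G C x := by
  obtain ⟨L, h1, h2, h3, h4⟩ := h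
  exact ⟨L, h1, h2, h3⟩

theorem length_of_coe_eq_val {C : Finset V} {L : List V} (h : (L : Multiset V) = C.val) :
    L.length = C.card := by
  rw [← Finset.card_val, ← h, Multiset.coe_card]

theorem mem_of_coe_eq_val {C : Finset V} {L : List V} (h : (L : Multiset V) = C.val) {v : V} :
    v ∈ L ↔ v ∈ C := by
  rw [← Finset.mem_val, ← h, Multiset.mem_coe]

theorem HasCover.mono {r r' : ℕ} {B : Finset V} (h : HasCover G r B) (hr : r ≤ r') :
    HasCover G r' B := by
  obtain ⟨F, h1, h2⟩ := h
  exact ⟨F, h1, h2.mono hr⟩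

theorem hasCover_card (B : Finset V) : HasCover G B.card B := by
  refine ⟨B.toList, by simp, ?_⟩
  simpa using pathsLE_length (G := G) B.toList

theorem HamFrom.hasCover {C : Finset V} {x : V} (h : HamFrom G C x) : HasCover G 1 C := by
  obtain ⟨L, h1, h2, -⟩ := h
  exact ⟨L, h1, [L], by simp, by simpa using h2, by simp⟩

theorem HasCover.pathsEq {r n : ℕ} {B : Finset V} (h : HasCover G r B) (h1 : r ≤ n)
    (h2 : n ≤ B.card) : ∃ F : List V, (F : Multiset V) = B.val ∧ PathsEq G n F := by
  obtain ⟨F, hF, hP⟩ := h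
  exact ⟨F, hF, hP.pathsEq h1 (by rwa [length_of_coe_eq_val hF])⟩

theorem HasCover.pathsEq_head {r n : ℕ} {B : Finset V} (h : HasCover G r B) (h1 : r + 1 ≤ n)
    (h2 : n ≤ B.card) {x : V} (hx : x ∈ B) :
    ∃ F : List V, (F : Multiset V) = B.val ∧ PathsEq G n F ∧ F.head? = some x := by
  obtain ⟨F, hF, hP⟩ := h
  obtain ⟨F', hp, hP'⟩ := hP.exists_head ((mem_of_coe_eq_val hF).2 hx)
  have hF' : ((x :: F' : List V) : Multiset V) = B.val := by rw [← hF]; exact Multiset.coe_eq_coe.2 hp.symm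
  exact ⟨_, hF', hP'.pathsEq h1 (by rwa [length_of_coe_eq_val hF']), rfl⟩

theorem HasCover.pathsEq_head_last {r n : ℕ} {B : Finset V} (h : HasCover G r B) (h1 : r + 2 ≤ n)
    (h2 : n ≤ B.card) {x y : V} (hx : x ∈ B) (hy : y ∈ B) (hxy : x ≠ y) :
    ∃ F : List V, (F : Multiset V) = B.val ∧ PathsEq G n F ∧ F.head? = some x ∧
      F.getLast? = some y := by
  obtain ⟨F, hF, hP⟩ := h
  obtain ⟨F', hp, hP'⟩ := hP.exists_head ((mem_of_coe_eq_val hF).2 hx)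
  have hy' : y ∈ F' := by
    have := hp.mem_iff.1 ((mem_of_coe_eq_val hF).2 hy)
    simpa [hxy.symm] using this
  obtain ⟨F'', hp', hP''⟩ := hP'.exists_last hy' hxy
  have hF'' : ((x :: (F'' ++ [y]) : List V) : Multiset V) = B.val := by
    rw [← hF]; exact Multiset.coe_eq_coe.2 (hp.trans (hp'.cons x)).symm
  exact ⟨_, hF'', hP''.pathsEq h1 (by rwa [length_of_coe_eq_val hF'']), rfl,
    by rw [← List.cons_append, List.getLast?_concat]⟩

theorem exists_pathsEq_card_head {A : Finset V} {x : V} (hx : x ∈ A) :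
    ∃ F : List V, (F : Multiset V) = A.val ∧ PathsEq G A.card F ∧ F.head? = some x := by
  have hF : ((x :: (A.erase x).toList : List V) : Multiset V) = A.val := by
    rw [← Multiset.cons_coe, Finset.coe_toList, Finset.erase_val, Multiset.cons_erase hx]
  exact ⟨_, hF, (pathsLE_length _).pathsEq (length_of_coe_eq_val hF).le
    (length_of_coe_eq_val hF).ge, rfl⟩

theorem exists_pathsEq_card_head_last {A : Finset V} {x y : V} (hx : x ∈ A) (hy : y ∈ A)
    (hxy : x ≠ y) :
    ∃ F : List V, (F : Multiset V) = A.val ∧ PathsEq G A.card F ∧ F.head? = some x ∧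
      F.getLast? = some y := by
  have hy' : y ∈ A.val.erase x := (Multiset.mem_erase_of_ne hxy.symm).2 hy
  have hF : ((x :: (((A.erase x).erase y).toList ++ [y]) : List V) : Multiset V) = A.val := by
    rw [← Multiset.cons_coe, ← Multiset.coe_add, Finset.coe_toList, Finset.erase_val,
      Finset.erase_val, Multiset.coe_singleton, add_comm, Multiset.singleton_add,
      Multiset.cons_erase hy', Multiset.cons_erase hx]
  exact ⟨_, hF, (pathsLE_length _).pathsEq (length_of_coe_eq_val hF).le
    (length_of_coe_eq_val hF).ge, rfl,
    by rw [← List.cons_append, List.getLast?_concat]⟩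

theorem hamPath_of_weave_eq {A B C : Finset V} {n : ℕ} {E F : List V} {x y : V}
    (hC : C.val = A.val + B.val) (hj : JoinedTo G A B) (hE : (E : Multiset V) = A.val)
    (hF : (F : Multiset V) = B.val) (hn : n ≠ 0) (h1 : PathsEq G n E) (h2 : PathsEq G n F)
    (hx : E.head? = some x) (hy : F.getLast? = some y) : HamPath G C x y := by
  obtain ⟨n, rfl⟩ := Nat.exists_eq_succ_of_ne_zero hn
  obtain ⟨L, hL, hp, hh, hl⟩ := exists_weave_eq n h1 h2 fun a ha b hb =>
    hj a ((mem_of_coe_eq_val hE).1 ha) b ((mem_of_coe_eq_val hF).1 hb)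
  refine ⟨L, ?_, hL, hh.trans hx, hl.trans hy⟩
  rw [hC, ← hE, ← hF, Multiset.coe_add]
  exact Multiset.coe_eq_coe.2 hp

theorem hamFrom_of_weave_eq {A B C : Finset V} {n : ℕ} {E F : List V} {x : V}
    (hC : C.val = A.val + B.val) (hj : JoinedTo G A B) (hE : (E : Multiset V) = A.val)
    (hF : (F : Multiset V) = B.val) (hn : n ≠ 0) (h1 : PathsEq G n E) (h2 : PathsEq G n F)
    (hx : E.head? = some x) : HamFrom G C x := by
  have hne : F ≠ [] := by
    rintro rfl
    obtain ⟨Ls, hl, hc, hf⟩ := h2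
    rcases Ls with _ | ⟨L, Ls⟩
    · exact hn hl.symm
    · have := (hc L (by simp)).1
      simp at hf
      exact this hf.1
  exact (hamPath_of_weave_eq hC hj hE hF hn h1 h2 hx (List.getLast?_eq_getLast_of_ne_nil hne)).hamFrom

theorem hamPath_of_weave_succ {A B C : Finset V} {n : ℕ} {E F : List V} {x y : V}
    (hC : C.val = A.val + B.val) (hj : JoinedTo G A B) (hE : (E : Multiset V) = A.val)
    (hF : (F : Multiset V) = B.val) (hn : n ≠ 0) (h1 : PathsEq G (n + 1) E) (h2 : PathsEq G n F)
    (hx : E.head? = some x) (hy : E.getLast? = some y) : HamPath G C x y := by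
  obtain ⟨n, rfl⟩ := Nat.exists_eq_succ_of_ne_zero hn
  obtain ⟨L, hL, hp, hh, hl⟩ := exists_weave_succ h1 h2 fun a ha b hb =>
    hj a ((mem_of_coe_eq_val hE).1 ha) b ((mem_of_coe_eq_val hF).1 hb)
  refine ⟨L, ?_, hL, hh.trans hx, hl.trans hy⟩
  rw [hC, ← hE, ← hF, Multiset.coe_add]
  exact Multiset.coe_eq_coe.2 hp

theorem val_eq_add_comm {A B C : Finset V} (h : C.val = A.val + B.val) : C.val = B.val + A.val := by
  rw [h, add_comm]

theorem pathsEq_ne_nil {n : ℕ} {F : List V} (h : PathsEq G n F) (hn : n ≠ 0) : F ≠ [] := by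
  rintro rfl
  obtain ⟨Ls, hl, hc, hf⟩ := h
  rcases Ls with _ | ⟨L, Ls⟩
  · exact hn hl.symm
  · have := (hc L (by simp)).1
    simp at hf
    exact this hf.1

/-- Both ends on the side whose vertices are used as singletons. -/
theorem hamPath_of_mem_left {A B C : Finset V} {r : ℕ} {x y : V} (hC : C.val = A.val + B.val)
    (hj : JoinedTo G A B) (hB : HasCover G r B) (hr : r + 1 ≤ A.card) (hle : A.card ≤ B.card + 1)
    (hx : x ∈ A) (hy : y ∈ A) (hxy : x ≠ y) : HamPath G C x y := by
  obtain ⟨E, hE, hEp, hEh, hEl⟩ := exists_pathsEq_card_head_last (G := G) hx hy hxy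
  have h2 : 1 < A.card := Finset.one_lt_card.2 ⟨x, hx, y, hy, hxy⟩
  obtain ⟨F, hF, hFp⟩ := hB.pathsEq (n := A.card - 1) (by omega) (by omega)
  refine hamPath_of_weave_succ hC hj hE hF (n := A.card - 1) (by omega) ?_ hFp hEh hEl
  rwa [Nat.sub_add_cancel (by omega)]

theorem hamPath_of_mem_left_right {A B C : Finset V} (hC : C.val = A.val + B.val)
    (hj : JoinedTo G A B) {r : ℕ} {x y : V} (hB : HasCover G r B) (hr : r + 1 ≤ A.card)
    (hle : A.card ≤ B.card) (hx : x ∈ A) (hy : y ∈ B) : HamPath G C x y := by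
  obtain ⟨E, hE, hEp, hEh⟩ := hB.pathsEq_head hr hle hy
  obtain ⟨F, hF, hFp, hFh⟩ := exists_pathsEq_card_head (G := G) hx
  have hF' : ((F.reverse : List V) : Multiset V) = A.val := by rw [← hF]; simp
  refine (hamPath_of_weave_eq (val_eq_add_comm hC) hj.symm hE hF' (by omega) hEp ?_ hEh
    (by simpa using hFh)).symm
  have hl := length_of_coe_eq_val hF'
  exact (pathsLE_length _).pathsEq hl.le hl.ge

theorem hamPath_of_join {A B C : Finset V} {r : ℕ} (hC : C.val = A.val + B.val)
    (hj : JoinedTo G A B) (hB : HasCover G r B) (hr : r + 1 ≤ A.card) (hlt : A.card < B.card)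
    {x y : V} (hx : x ∈ C) (hy : y ∈ C) (hxy : x ≠ y) : HamPath G C x y := by
  rcases (Finset.mem_iff_of_val_eq_add hC).1 hx with hx | hx <;>
    rcases (Finset.mem_iff_of_val_eq_add hC).1 hy with hy | hy
  · exact hamPath_of_mem_left hC hj hB hr (by omega) hx hy hxy
  · exact hamPath_of_mem_left_right hC hj hB hr (by omega) hx hy
  · exact (hamPath_of_mem_left_right hC hj hB hr (by omega) hy hx).symm
  · obtain ⟨E, hE, hEp, hEh, hEl⟩ := hB.pathsEq_head_last (n := A.card + 1) (by omega) hlt hx hy hxy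
    obtain ⟨F, hF, hFp⟩ := (hasCover_card (G := G) A).pathsEq le_rfl le_rfl
    exact hamPath_of_weave_succ (val_eq_add_comm hC) hj.symm hE hF (by omega) hEp hFp hEh hEl

theorem hamFrom_of_join {A B C : Finset V} {r : ℕ} (hC : C.val = A.val + B.val)
    (hj : JoinedTo G A B) (hB : HasCover G r B) (hr : r ≤ A.card) (hA : A.Nonempty)
    (hle : A.card ≤ B.card) {x : V} (hx : x ∈ C) : HamFrom G C x := by
  have hA0 : A.card ≠ 0 := hA.card_pos.ne'
  rcases (Finset.mem_iff_of_val_eq_add hC).1 hx with hx | hx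
  · obtain ⟨E, hE, hEp, hEh⟩ := exists_pathsEq_card_head (G := G) hx
    obtain ⟨F, hF, hFp⟩ := hB.pathsEq (n := A.card) hr hle
    exact hamFrom_of_weave_eq hC hj hE hF hA0 hEp hFp hEh
  · obtain ⟨F, hF, hFp⟩ := (hasCover_card (G := G) A).pathsEq le_rfl le_rfl
    rcases hle.eq_or_lt with h | h
    · obtain ⟨E, hE, hEp, hEh⟩ := exists_pathsEq_card_head (G := G) hx
      exact hamFrom_of_weave_eq (val_eq_add_comm hC) hj.symm hE hF hA0 (h ▸ hEp) hFp hEh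
    · obtain ⟨E, hE, hEp, hEh⟩ := hB.pathsEq_head (n := A.card + 1) (by omega) h hx
      exact (hamPath_of_weave_succ (val_eq_add_comm hC) hj.symm hE hF hA0 hEp hFp hEh
        (List.getLast?_eq_getLast_of_ne_nil (pathsEq_ne_nil hEp (by omega)))).hamFrom

/-- Opposite ends in a balanced join. -/
theorem hamPath_of_balanced {A B C : Finset V} (hC : C.val = A.val + B.val) (hj : JoinedTo G A B)
    (hAB : A.card = B.card) {x y : V} (hx : x ∈ A) (hy : y ∈ B) : HamPath G C x y := by
  obtain ⟨E, hE, hEp, hEh⟩ := exists_pathsEq_card_head (G := G) hx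
  obtain ⟨F, hF, hFp, hFh⟩ := exists_pathsEq_card_head (G := G) hy
  have hF' : ((F.reverse : List V) : Multiset V) = B.val := by rw [← hF]; simp
  have hl := length_of_coe_eq_val hF'
  exact hamPath_of_weave_eq hC hj hE hF' (Finset.card_ne_zero_of_mem hx) hEp
    ((pathsLE_length _).pathsEq (by omega) (by omega)) hEh (by simpa using hFh)

theorem hasCover_of_adj {B : Finset V} {u v : V} (hu : u ∈ B) (hv : v ∈ B) (huv : G.Adj u v) :
    HasCover G (B.card - 1) B := by
  have hu' : u ∈ B.val.erase v := (Multiset.mem_erase_of_ne huv.ne).2 hu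
  have hF : ((v :: u :: ((B.erase v).erase u).toList : List V) : Multiset V) = B.val := by
    rw [← Multiset.cons_coe, ← Multiset.cons_coe, Finset.coe_toList, Finset.erase_val,
      Finset.erase_val, Multiset.cons_erase hu', Multiset.cons_erase hv]
  obtain ⟨Ls, hl, hc, hf⟩ := pathsLE_length (G := G) ((B.erase v).erase u).toList
  refine ⟨_, hF, [v, u] :: Ls, ?_, ?_, by simp [hf]⟩
  · have h2 : 1 < B.card := Finset.one_lt_card.2 ⟨u, hu, v, hv, huv.ne⟩
    have := length_of_coe_eq_val hF
    simp only [List.length_cons] at this ⊢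
    omega
  · intro L hL
    rcases List.mem_cons.1 hL with rfl | hL
    · simpa using huv.symm
    · exact hc L hL

end HamiltonPaths

section PortedPaths
open scoped Classical

variable {V : Type*} {G : SimpleGraph V}

/-- A list of vertices together with optional vertices (ports) to be attached at its two ends. -/
structure PortedPath (V : Type*) where
  left : Option V
  core : List V
  right : Option V

namespace PortedPath

/-- The two ports. -/
def ports (P : PortedPath V) : Multiset (Option V) := {P.left, P.right}

/-- The same path traversed backwards. -/
def flip (P : PortedPath V) : PortedPath V := ⟨P.right, P.core.reverse, P.left⟩

/-- The core is a nonempty path with ends in `E`, and the ports are adjacent to the ends. -/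
structure Good (G : SimpleGraph V) (E : V → Prop) (P : PortedPath V) : Prop where
  ne_nil : P.core ≠ []
  chain : P.core.IsChain G.Adj
  head : ∀ x, P.core.head? = some x → E x ∧ ∀ s, P.left = some s → G.Adj s x
  last : ∀ x, P.core.getLast? = some x → E x ∧ ∀ s, P.right = some s → G.Adj s x

theorem mem_ports {P : PortedPath V} {o : Option V} : o ∈ P.ports ↔ o = P.left ∨ o = P.right := by
  simp [ports]

theorem ports_flip (P : PortedPath V) : P.flip.ports = P.ports := Multiset.pair_comm _ _

theorem Good.flip {E : V → Prop} {P : PortedPath V} (h : P.Good G E) : P.flip.Good G E where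
  ne_nil := by simpa [PortedPath.flip] using h.ne_nil
  chain := List.isChain_reverse.2 (h.chain.imp fun _ _ h => h.symm)
  head := by simpa [PortedPath.flip] using h.last
  last := by simpa [PortedPath.flip] using h.head

theorem Good.mono {E E' : V → Prop} {P : PortedPath V} (h : P.Good G E) (hE : ∀ x, E x → E' x) :
    P.Good G E' where
  ne_nil := h.ne_nil
  chain := h.chain
  head := fun x hx => ⟨hE x (h.head x hx).1, (h.head x hx).2⟩
  last := fun x hx => ⟨hE x (h.last x hx).1, (h.last x hx).2⟩

theorem Good.exists_adj {E : V → Prop} {P : PortedPath V} (h : P.Good G E) {s : V}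
    (hs : some s ∈ P.ports) : ∃ x, E x ∧ G.Adj s x := by
  rcases mem_ports.1 hs with hs | hs
  · have := h.head _ (List.head?_eq_some_head h.ne_nil)
    exact ⟨_, this.1, this.2 s hs.symm⟩
  · have := h.last _ (List.getLast?_eq_getLast_of_ne_nil h.ne_nil)
    exact ⟨_, this.1, this.2 s hs.symm⟩

theorem Good.exists_left {E : V → Prop} {P : PortedPath V} (h : P.Good G E) (o : Option V) :
    ∃ Q : PortedPath V, Q.Good G E ∧ (Q.core : Multiset V) = P.core ∧ Q.ports = P.ports ∧
      (o ∈ P.ports → Q.left = o) := by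
  by_cases ho : P.left = o
  · exact ⟨P, h, rfl, rfl, fun _ => ho⟩
  · refine ⟨P.flip, h.flip, by simp [PortedPath.flip], P.ports_flip, fun h => ?_⟩
    rcases mem_ports.1 h with h | h
    · exact absurd h.symm ho
    · exact h.symm

theorem Good.exists_right {E : V → Prop} {P : PortedPath V} (h : P.Good G E) (o : Option V) :
    ∃ Q : PortedPath V, Q.Good G E ∧ (Q.core : Multiset V) = P.core ∧ Q.ports = P.ports ∧
      (o ∈ P.ports → Q.right = o) := by
  obtain ⟨Q, h1, h2, h3, h4⟩ := h.exists_left o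
  exact ⟨Q.flip, h1.flip, by simpa [PortedPath.flip] using h2, Q.ports_flip.trans h3, h4⟩

/-- Two paths joined through a vertex. -/
def link (a : V) (P Q : PortedPath V) : PortedPath V := ⟨P.left, P.core ++ a :: Q.core, Q.right⟩

theorem Good.link {E : V → Prop} {P Q : PortedPath V} (hP : P.Good G E) (hQ : Q.Good G E) {a : V}
    (hPa : ∀ x, P.core.getLast? = some x → G.Adj x a)
    (hQa : ∀ x, Q.core.head? = some x → G.Adj a x) : (link a P Q).Good G E where
  ne_nil := by simp [PortedPath.link]
  chain := by
    simp only [PortedPath.link]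
    rw [List.isChain_append, List.isChain_cons]
    refine ⟨hP.chain, ⟨fun y hy => hQa y hy, hQ.chain⟩, fun x hx y hy => ?_⟩
    obtain rfl : a = y := by simpa using hy
    exact hPa x hx
  head := by
    intro x hx
    refine hP.head x ?_
    obtain ⟨y, L, e⟩ := List.exists_cons_of_ne_nil hP.ne_nil
    simpa [PortedPath.link, e] using hx
  last := by
    intro x hx
    refine hQ.last x ?_
    have := List.getLast?_eq_getLast_of_ne_nil hQ.ne_nil
    simpa [PortedPath.link, List.getLast?_append, List.getLast?_cons, this] using hx

end PortedPath

open PortedPath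

/-- The multiset of vertices covered by a system of ported paths. -/
def systemVerts (M : Multiset (PortedPath V)) : Multiset V := M.bind fun P => (P.core : Multiset V)

/-- The multiset of ports of a system of ported paths. -/
def systemPorts (M : Multiset (PortedPath V)) : Multiset (Option V) := M.bind PortedPath.ports

@[simp] theorem systemVerts_cons (P : PortedPath V) (M : Multiset (PortedPath V)) :
    systemVerts (P ::ₘ M) = (P.core : Multiset V) + systemVerts M := Multiset.cons_bind _ _ _

@[simp] theorem systemPorts_cons (P : PortedPath V) (M : Multiset (PortedPath V)) :
    systemPorts (P ::ₘ M) = P.ports + systemPorts M := Multiset.cons_bind _ _ _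

@[simp] theorem systemVerts_add (M N : Multiset (PortedPath V)) :
    systemVerts (M + N) = systemVerts M + systemVerts N := Multiset.add_bind _ _ _

@[simp] theorem systemPorts_add (M N : Multiset (PortedPath V)) :
    systemPorts (M + N) = systemPorts M + systemPorts N := Multiset.add_bind _ _ _

theorem mem_systemPorts {M : Multiset (PortedPath V)} {o : Option V} :
    o ∈ systemPorts M ↔ ∃ P ∈ M, o ∈ P.ports := Multiset.mem_bind

theorem card_systemPorts (M : Multiset (PortedPath V)) : (systemPorts M).card = 2 * M.card := by
  induction M using Multiset.induction_on with
  | empty => rfl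
  | cons P M ih => simp [ih, PortedPath.ports]; omega

theorem exists_link_one {E : V → Prop} {M : Multiset (PortedPath V)} (h2 : 2 ≤ M.card)
    (hM : ∀ P ∈ M, P.Good G E) {a : V} (ha : ∀ x, E x → G.Adj a x) (bad : Option V → Prop)
    {p : Option V} (hp : ¬ bad p) :
    ∃ M' : Multiset (PortedPath V), M'.card + 1 = M.card ∧ (∀ P ∈ M', P.Good G E) ∧
      systemVerts M' = a ::ₘ systemVerts M ∧ systemPorts M' ≤ systemPorts M ∧
      (systemPorts M').countP bad ≤ (systemPorts M).countP bad - 1 ∧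
      (p ∈ systemPorts M → p ∈ systemPorts M') := by
  have key : ∀ (P Q : PortedPath V) (N : Multiset (PortedPath V)) (P₁ : PortedPath V),
      M = P ::ₘ Q ::ₘ N → P₁.Good G E → (P₁.core : Multiset V) = P.core → P₁.ports = P.ports →
      (p ∈ P.ports → P₁.left = p) → (bad P₁.right ∨ (systemPorts M).countP bad = 0) →
      ∃ M' : Multiset (PortedPath V), M'.card + 1 = M.card ∧ (∀ P ∈ M', P.Good G E) ∧
      systemVerts M' = a ::ₘ systemVerts M ∧ systemPorts M' ≤ systemPorts M ∧
      (systemPorts M').countP bad ≤ (systemPorts M).countP bad - 1 ∧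
      (p ∈ systemPorts M → p ∈ systemPorts M') := by
    intro P Q N P₁ hMe hP₁ hc hpo hpl hb
    obtain ⟨Q₁, hQ₁, hQc, hQp, hQr⟩ := (hM Q (by simp [hMe])).exists_right p
    have hpM : systemPorts M = P₁.ports + (Q₁.ports + systemPorts N) := by
      rw [hMe]; simp [hpo, hQp]
    have hle : systemPorts (PortedPath.link a P₁ Q₁ ::ₘ N) + {P₁.right, Q₁.left} = systemPorts M := by
      rw [hpM, systemPorts_cons]
      simp only [PortedPath.ports, PortedPath.link, ← Multiset.singleton_add, Multiset.insert_eq_cons]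
      abel
    refine ⟨PortedPath.link a P₁ Q₁ ::ₘ N, by simp [hMe], ?_, ?_, ?_, ?_, ?_⟩
    · intro R hR
      rcases Multiset.mem_cons.1 hR with rfl | hR
      · exact hP₁.link hQ₁ (fun x hx => (ha x (hP₁.last x hx).1).symm)
          (fun x hx => ha x (hQ₁.head x hx).1)
      · exact hM R (by simp [hMe, hR])
    · have : ((PortedPath.link a P₁ Q₁).core : Multiset V) =
          a ::ₘ ((P.core : Multiset V) + Q.core) := by
        rw [← hc, ← hQc]
        simp only [PortedPath.link, ← Multiset.coe_add, ← Multiset.cons_coe, Multiset.add_cons]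
      rw [systemVerts_cons, this, hMe]
      simp only [systemVerts_cons, Multiset.cons_add, add_assoc]
    · rw [← hle]; exact Multiset.le_add_right _ _
    · have hcnt := congrArg (Multiset.countP bad) hle
      rw [Multiset.countP_add] at hcnt
      rcases hb with hb | hb
      · have : 1 ≤ Multiset.countP bad {P₁.right, Q₁.left} :=
          Multiset.countP_pos.2 ⟨P₁.right, by simp, hb⟩
        omega
      · omega
    · intro h
      rw [hpM] at h
      simp only [systemPorts_cons, Multiset.mem_add] at h ⊢
      rcases h with h | h | h
      · exact Or.inl (PortedPath.mem_ports.2 (Or.inl (hpl (hpo ▸ h)).symm))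
      · exact Or.inl (PortedPath.mem_ports.2 (Or.inr (hQr (hQp ▸ h)).symm))
      · exact Or.inr h
  by_cases hb : ∃ P ∈ M, ∃ o ∈ P.ports, bad o
  · obtain ⟨P, hP, o, ho, hbo⟩ := hb
    obtain ⟨N, rfl⟩ := Multiset.exists_cons_of_mem hP
    have hN : 0 < N.card := by simp at h2; omega
    obtain ⟨Q, hQ⟩ := Multiset.card_pos_iff_exists_mem.1 hN
    obtain ⟨N, rfl⟩ := Multiset.exists_cons_of_mem hQ
    obtain ⟨P₁, h1, h2, h3, h4⟩ := (hM P hP).exists_right o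
    refine key P Q N P₁ rfl h1 h2 h3 (fun h => ?_) (Or.inl (by rwa [h4 ho]))
    rw [← h3] at h
    rcases PortedPath.mem_ports.1 h with h | h
    · exact h.symm
    · rw [h, h4 ho] at hp
      exact absurd hbo hp
  · have h0 : (systemPorts M).countP bad = 0 := by
      rw [Multiset.countP_eq_zero]
      intro o ho hbo
      obtain ⟨P, hP, h⟩ := mem_systemPorts.1 ho
      exact hb ⟨P, hP, o, h, hbo⟩
    obtain ⟨P, hP⟩ := Multiset.card_pos_iff_exists_mem.1 (by omega : 0 < M.card)
    obtain ⟨N, rfl⟩ := Multiset.exists_cons_of_mem hP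
    have hN : 0 < N.card := by simp at h2; omega
    obtain ⟨Q, hQ⟩ := Multiset.card_pos_iff_exists_mem.1 hN
    obtain ⟨N, rfl⟩ := Multiset.exists_cons_of_mem hQ
    obtain ⟨P₁, h1, h2, h3, h4⟩ := (hM P hP).exists_left p
    exact key P Q N P₁ rfl h1 h2 h3 h4 (Or.inr h0)

theorem exists_link {E : V → Prop} (bad : Option V → Prop) {p : Option V} (hp : ¬ bad p) (k : ℕ)
    (A : Finset V) : ∀ {M : Multiset (PortedPath V)}, A.card + 1 ≤ M.card →
    (∀ P ∈ M, P.Good G E) → (∀ a ∈ A, ∀ x, E x → G.Adj a x) →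
    (systemPorts M).countP bad ≤ A.card + k →
    ∃ M' : Multiset (PortedPath V), M'.card + A.card = M.card ∧ (∀ P ∈ M', P.Good G E) ∧
      systemVerts M' = A.val + systemVerts M ∧ systemPorts M' ≤ systemPorts M ∧
      (systemPorts M').countP bad ≤ k ∧ (p ∈ systemPorts M → p ∈ systemPorts M') := by
  induction A using Finset.induction_on with
  | empty =>
    intro M h1 hM ha hc
    exact ⟨M, by simp, hM, by simp, le_rfl, by simpa using hc, id⟩
  | insert a A haA ih =>
    intro M h1 hM ha hc
    rw [Finset.card_insert_of_notMem haA] at h1 hc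
    obtain ⟨M₁, hc₁, hg₁, hv₁, hp₁, hb₁, hk₁⟩ := exists_link_one (by omega) hM
      (ha a (Finset.mem_insert_self _ _)) bad hp
    obtain ⟨M₂, hc₂, hg₂, hv₂, hp₂, hb₂, hk₂⟩ := ih (M := M₁) (by omega) hg₁
      (fun b hb => ha b (Finset.mem_insert_of_mem hb)) (by omega)
    refine ⟨M₂, ?_, hg₂, ?_, hp₂.trans hp₁, hb₂, hk₂ ∘ hk₁⟩
    · rw [Finset.card_insert_of_notMem haA]; omega
    · rw [hv₂, hv₁, Finset.insert_val_of_notMem haA]; simp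

/-- The port `o` is a vertex of `A`. -/
def IsPortIn (A : Finset V) (o : Option V) : Prop := ∃ a ∈ A, o = some a

theorem countP_isPortIn_le_card {A : Finset V} {m : Multiset (Option V)}
    (h : ∀ a ∈ A, m.count (some a) ≤ 1) : m.countP (IsPortIn A) ≤ A.card := by
  have hle : m.filter (IsPortIn A) ≤ (A.image some).val := by
    rw [Multiset.le_iff_count]
    intro o
    rw [Multiset.count_filter]
    split_ifs with ho
    · obtain ⟨a, ha, rfl⟩ := ho
      exact (h a ha).trans (Multiset.one_le_count_iff_mem.2 (by simpa using ha))
    · exact Nat.zero_le _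
  rw [Multiset.countP_eq_card_filter]
  exact (Multiset.card_le_card hle).trans Finset.card_image_le

end PortedPaths

section Layouts
open scoped Classical

variable {V : Type*} {G : SimpleGraph V}

open PortedPath

/-- A decomposition of `C` into a separating set `W` and pairwise nonadjacent pieces `𝒦` such that
any paths spanning the pieces can be linked through `W` without using ports in `W`. -/
structure Layout (G : SimpleGraph V) (C W : Finset V) (𝒦 : Finset (Finset V)) : Prop where
  nonempty : ∀ K ∈ 𝒦, K.Nonempty
  val : C.val = W.val + 𝒦.val.bind Finset.val
  apart : ∀ K ∈ 𝒦, ∀ K' ∈ 𝒦, K ≠ K' → Apart G K K'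
  mixed : ∀ w ∈ W, ∀ K ∈ 𝒦, (∀ x ∈ K, G.Adj w x) ∨ ∀ x ∈ K, ¬ G.Adj w x
  attach : ∀ w ∈ W, ∃ K ∈ 𝒦, ∀ x ∈ K, G.Adj w x
  card : W.card + 1 ≤ 𝒦.card
  ham : ∀ K ∈ 𝒦, ∀ x ∈ K, HamFrom G K x
  realize : ∀ f : Finset V → PortedPath V,
    (∀ K ∈ 𝒦, (f K).Good G (· ∈ K) ∧ ((f K).core : Multiset V) = K.val) →
    (∀ v, (systemPorts (𝒦.val.map f)).count (some v) ≤ 1) →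
    ∀ p : Option V, (∀ w ∈ W, p ≠ some w) →
    ∃ M : Multiset (PortedPath V), M.card + W.card = 𝒦.card ∧ (∀ P ∈ M, P.Good G (· ∈ C)) ∧
      systemVerts M = C.val ∧ systemPorts M ≤ systemPorts (𝒦.val.map f) ∧
      (∀ w ∈ W, some w ∉ systemPorts M) ∧
      (p ∈ systemPorts (𝒦.val.map f) → p ∈ systemPorts M)

theorem Layout.single {C : Finset V} (hC : C.Nonempty) (h : ∀ x ∈ C, HamFrom G C x) :
    Layout G C ∅ {C} where
  nonempty := by simpa using hC
  val := by simp
  apart := by simp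
  mixed := by simp
  attach := by simp
  card := by simp
  ham := by simpa using h
  realize := by
    intro f hf hcount p hp
    obtain ⟨h1, h2⟩ := hf C (by simp)
    exact ⟨{f C}, by simp, by simpa using h1, by simp [systemVerts, h2], by simp, by simp, by simp⟩

theorem Layout.mem_iff {C W : Finset V} {𝒦 : Finset (Finset V)} (h : Layout G C W 𝒦) {v : V} :
    v ∈ C ↔ v ∈ W ∨ ∃ K ∈ 𝒦, v ∈ K := by
  rw [← Finset.mem_val, h.val, Multiset.mem_add, Multiset.mem_bind]
  rfl

theorem Layout.subset {C W : Finset V} {𝒦 : Finset (Finset V)} (h : Layout G C W 𝒦) : W ⊆ C :=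
  fun _ hv => h.mem_iff.2 (Or.inl hv)

theorem Layout.piece_subset {C W : Finset V} {𝒦 : Finset (Finset V)} (h : Layout G C W 𝒦)
    {K : Finset V} (hK : K ∈ 𝒦) : K ⊆ C :=
  fun _ hv => h.mem_iff.2 (Or.inr ⟨K, hK, hv⟩)

theorem Layout.union {C X Y W W' : Finset V} {𝒦 𝒦' : Finset (Finset V)}
    (hC : C.val = X.val + Y.val) (ha : Apart G X Y) (hX : Layout G X W 𝒦) (hY : Layout G Y W' 𝒦') :
    Layout G C (W ∪ W') (𝒦 ∪ 𝒦') := by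
  have hd := Finset.disjoint_of_val_eq_add hC
  have hW : Disjoint W W' := Finset.disjoint_of_subset_left hX.subset
    (Finset.disjoint_of_subset_right hY.subset hd)
  have hK : Disjoint 𝒦 𝒦' := by
    rw [Finset.disjoint_left]
    intro K hK hK'
    obtain ⟨x, hx⟩ := hX.nonempty K hK
    exact Finset.disjoint_left.1 hd (hX.piece_subset hK hx) (hY.piece_subset hK' hx)
  have hWv : (W ∪ W').val = W.val + W'.val := Finset.val_eq_add_of_disjoint hW rfl
  have hKv : (𝒦 ∪ 𝒦').val = 𝒦.val + 𝒦'.val := by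
    rw [← Finset.disjUnion_eq_union _ _ hK]
    rfl
  refine ⟨?_, ?_, ?_, ?_, ?_, ?_, ?_, ?_⟩
  · intro K h
    rcases Finset.mem_union.1 h with h | h
    · exact hX.nonempty K h
    · exact hY.nonempty K h
  · rw [hC, hWv, hKv, hX.val, hY.val, Multiset.add_bind]
    abel
  · intro K h K' h' hne
    rcases Finset.mem_union.1 h with h | h <;> rcases Finset.mem_union.1 h' with h' | h'
    · exact hX.apart K h K' h' hne
    · exact fun a h1 b h2 => ha a (hX.piece_subset h h1) b (hY.piece_subset h' h2)
    · exact fun a h1 b h2 => ha.symm a (hY.piece_subset h h1) b (hX.piece_subset h' h2)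
    · exact hY.apart K h K' h' hne
  · intro w hw K h
    rcases Finset.mem_union.1 hw with hw | hw <;> rcases Finset.mem_union.1 h with h | h
    · exact hX.mixed w hw K h
    · exact Or.inr fun x hx => ha w (hX.subset hw) x (hY.piece_subset h hx)
    · exact Or.inr fun x hx => ha.symm w (hY.subset hw) x (hX.piece_subset h hx)
    · exact hY.mixed w hw K h
  · intro w hw
    rcases Finset.mem_union.1 hw with hw | hw
    · obtain ⟨K, h, hK⟩ := hX.attach w hw
      exact ⟨K, Finset.mem_union_left _ h, hK⟩
    · obtain ⟨K, h, hK⟩ := hY.attach w hw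
      exact ⟨K, Finset.mem_union_right _ h, hK⟩
  · rw [Finset.card_union_of_disjoint hW, Finset.card_union_of_disjoint hK]
    have := hX.card
    have := hY.card
    omega
  · intro K h
    rcases Finset.mem_union.1 h with h | h
    · exact hX.ham K h
    · exact hY.ham K h
  · intro f hf hcount p hp
    rw [hKv, Multiset.map_add, systemPorts_add] at hcount ⊢
    simp only [Multiset.count_add] at hcount
    obtain ⟨M, h1, h2, h3, h4, h5, h6⟩ := hX.realize f
      (fun K hK => hf K (Finset.mem_union_left _ hK)) (fun v => by have := hcount v; omega) p
      (fun w hw => hp w (Finset.mem_union_left _ hw))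
    obtain ⟨N, k1, k2, k3, k4, k5, k6⟩ := hY.realize f
      (fun K hK => hf K (Finset.mem_union_right _ hK)) (fun v => by have := hcount v; omega) p
      (fun w hw => hp w (Finset.mem_union_right _ hw))
    refine ⟨M + N, ?_, ?_, ?_, ?_, ?_, ?_⟩
    · rw [Finset.card_union_of_disjoint hW, Finset.card_union_of_disjoint hK, Multiset.card_add]
      omega
    · intro P hP
      rcases Multiset.mem_add.1 hP with hP | hP
      · exact (h2 P hP).mono fun x hx => (Finset.mem_iff_of_val_eq_add hC).2 (Or.inl hx)
      · exact (k2 P hP).mono fun x hx => (Finset.mem_iff_of_val_eq_add hC).2 (Or.inr hx)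
    · rw [systemVerts_add, h3, k3, hC]
    · rw [systemPorts_add]; exact add_le_add h4 k4
    · intro w hw hwp
      rw [systemPorts_add, Multiset.mem_add] at hwp
      rcases Finset.mem_union.1 hw with hw | hw <;> rcases hwp with hwp | hwp
      · exact h5 w hw hwp
      · obtain ⟨P, hP, hPw⟩ := mem_systemPorts.1 hwp
        obtain ⟨x, hx, hwx⟩ := (k2 P hP).exists_adj hPw
        exact ha w (hX.subset hw) x hx hwx
      · obtain ⟨P, hP, hPw⟩ := mem_systemPorts.1 hwp
        obtain ⟨x, hx, hwx⟩ := (h2 P hP).exists_adj hPw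
        exact ha x hx w (hY.subset hw) hwx.symm
      · exact k5 w hw hwp
    · intro h
      rw [systemPorts_add]
      rcases Multiset.mem_add.1 h with h | h
      · exact Multiset.mem_add.2 (Or.inl (h6 h))
      · exact Multiset.mem_add.2 (Or.inr (k6 h))

theorem Layout.hasCover {C W : Finset V} {𝒦 : Finset (Finset V)} (h : Layout G C W 𝒦) :
    ∃ M : Multiset (PortedPath V), M.card + W.card = 𝒦.card ∧ (∀ P ∈ M, P.Good G (· ∈ C)) ∧
      systemVerts M = C.val := by
  have hL : ∀ K, ∃ L : List V, K ∈ 𝒦 → (L : Multiset V) = K.val ∧ L.IsChain G.Adj ∧ L ≠ [] := by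
    intro K
    by_cases hK : K ∈ 𝒦
    · obtain ⟨x, hx⟩ := h.nonempty K hK
      obtain ⟨L, h1, h2, h3⟩ := h.ham K hK x hx
      exact ⟨L, fun _ => ⟨h1, h2, by rintro rfl; simp at h3⟩⟩
    · exact ⟨[], fun h => absurd h hK⟩
  choose L hL using hL
  have hr := h.realize (fun K => ⟨none, L K, none⟩) ?_ ?_ none (by simp)
  · obtain ⟨M, h1, h2, h3, -⟩ := hr
    exact ⟨M, h1, h2, h3⟩
  · intro K hK
    obtain ⟨k1, k2, k3⟩ := hL K hK
    refine ⟨⟨k3, k2, ?_, ?_⟩, k1⟩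
    · intro x hx
      exact ⟨(mem_of_coe_eq_val k1).1 (List.mem_of_mem_head? hx), by simp⟩
    · intro x hx
      exact ⟨(mem_of_coe_eq_val k1).1 (List.mem_of_mem_getLast? hx), by simp⟩
  · intro v
    rw [Multiset.count_eq_zero_of_notMem]
    · omega
    · intro hv
      obtain ⟨P, hP, hvP⟩ := mem_systemPorts.1 hv
      obtain ⟨K, -, rfl⟩ := Multiset.mem_map.1 hP
      simp [PortedPath.ports] at hvP

theorem hasCover_of_system {C : Finset V} {M : Multiset (PortedPath V)} {E : V → Prop}
    (hM : ∀ P ∈ M, P.Good G E) (hv : systemVerts M = C.val) : HasCover G M.card C := by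
  induction M using Quotient.inductionOn with | _ l =>
  refine ⟨(l.map PortedPath.core).flatten, ?_, l.map PortedPath.core, by simp, ?_, rfl⟩
  · rw [← hv]
    exact (List.flatMap_def ▸ Multiset.coe_bind l PortedPath.core).symm
  · intro L hL
    obtain ⟨P, hP, rfl⟩ := List.mem_map.1 hL
    exact (hM P hP).chain

theorem Layout.hasCover_card {C W : Finset V} {𝒦 : Finset (Finset V)} (h : Layout G C W 𝒦) :
    HasCover G (𝒦.card - W.card) C := by
  obtain ⟨M, h1, h2, h3⟩ := h.hasCover
  have := hasCover_of_system h2 h3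
  rwa [show M.card = 𝒦.card - W.card by omega] at this

theorem Layout.join {A B C W : Finset V} {𝒦 : Finset (Finset V)} (hC : C.val = A.val + B.val)
    (hj : JoinedTo G A B) (h : Layout G B W 𝒦) (hr : W.card + A.card + 1 ≤ 𝒦.card) :
    Layout G C (W ∪ A) 𝒦 := by
  have hd := Finset.disjoint_of_val_eq_add hC
  have hWA : Disjoint W A := (Finset.disjoint_of_subset_right h.subset hd).symm
  have hWv : (W ∪ A).val = W.val + A.val := Finset.val_eq_add_of_disjoint hWA rfl
  have hcard : (W ∪ A).card = W.card + A.card := Finset.card_union_of_disjoint hWA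
  refine ⟨h.nonempty, ?_, h.apart, ?_, ?_, by omega, h.ham, ?_⟩
  · rw [hC, hWv, h.val]; abel
  · intro w hw K hK
    rcases Finset.mem_union.1 hw with hw | hw
    · exact h.mixed w hw K hK
    · exact Or.inl fun x hx => hj w hw x (h.piece_subset hK hx)
  · intro w hw
    rcases Finset.mem_union.1 hw with hw | hw
    · exact h.attach w hw
    · obtain ⟨K, hK⟩ := Finset.card_pos.1 (by omega : 0 < 𝒦.card)
      exact ⟨K, hK, fun x hx => hj w hw x (h.piece_subset hK hx)⟩
  · intro f hf hcount p hp
    obtain ⟨M, h1, h2, h3, h4, h5, h6⟩ := h.realize f hf hcount p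
      (fun w hw => hp w (Finset.mem_union_left _ hw))
    obtain ⟨N, k1, k2, k3, k4, k5, k6⟩ := exists_link (IsPortIn A) (p := p)
      (by rintro ⟨a, ha, rfl⟩; exact hp a (Finset.mem_union_right _ ha) rfl) 0 A (M := M) (by omega)
      h2 hj (countP_isPortIn_le_card fun a _ => (Multiset.count_le_of_le _ h4).trans (hcount a))
    refine ⟨N, by omega, ?_, ?_, k4.trans h4, ?_, k6 ∘ h6⟩
    · intro P hP
      exact (k2 P hP).mono fun x hx => (Finset.mem_iff_of_val_eq_add hC).2 (Or.inr hx)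
    · rw [k3, h3, hC]
    · intro w hw hwp
      rcases Finset.mem_union.1 hw with hw | hw
      · exact h5 w hw (Multiset.mem_of_le k4 hwp)
      · have : 0 < (systemPorts N).countP (IsPortIn A) :=
          Multiset.countP_pos.2 ⟨_, hwp, w, hw, rfl⟩
        omega

theorem NoPathOn.exists_layout : ∀ (n : ℕ) {C : Finset V}, C.card = n → NoPathOn G C →
    C.Nonempty → ∃ W 𝒦, Layout G C W 𝒦 := by
  intro n
  induction n using Nat.strong_induction_on with
  | _ n ih =>
    intro C hn hN hC
    by_cases h2 : 2 ≤ C.card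
    · obtain ⟨X, Y, hXY, hX, hY, h⟩ := hN.split h2
      have hc := Finset.card_of_val_eq_add hXY
      have hX0 := hX.card_pos
      have hY0 := hY.card_pos
      have hXC : X ⊆ C := fun v hv => (Finset.mem_iff_of_val_eq_add hXY).2 (Or.inl hv)
      have hYC : Y ⊆ C := fun v hv => (Finset.mem_iff_of_val_eq_add hXY).2 (Or.inr hv)
      have hjoin : ∀ {A B : Finset V}, C.val = A.val + B.val → JoinedTo G A B → A.Nonempty →
          A.card ≤ B.card → B.card < n → B ⊆ C → ∃ W 𝒦, Layout G C W 𝒦 := by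
        intro A B hAB hj hA hle hlt hBC
        have hB : B.Nonempty := Finset.card_pos.1 (hA.card_pos.trans_le hle)
        obtain ⟨W, 𝒦, hL⟩ := ih B.card hlt rfl (hN.mono hBC) hB
        by_cases hr : W.card + A.card + 1 ≤ 𝒦.card
        · exact ⟨_, _, hL.join hAB hj hr⟩
        · exact ⟨_, _, Layout.single hC fun x hx =>
            hamFrom_of_join hAB hj hL.hasCover_card (by omega) hA hle hx⟩
      rcases h with h | h
      · rcases le_total X.card Y.card with hle | hle
        · exact hjoin hXY h hX hle (by omega) hYC
        · exact hjoin (val_eq_add_comm hXY) h.symm hY hle (by omega) hXC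
      · obtain ⟨W, 𝒦, h1⟩ := ih X.card (by omega) rfl (hN.mono hXC) hX
        obtain ⟨W', 𝒦', h2⟩ := ih Y.card (by omega) rfl (hN.mono hYC) hY
        exact ⟨_, _, h1.union hXY h h2⟩
    · have h1 : C.card = 1 := by have := hC.card_pos; omega
      obtain ⟨u, rfl⟩ := Finset.card_eq_one.1 h1
      refine ⟨_, _, Layout.single hC fun x hx => ⟨[u], by simp, by simp, ?_⟩⟩
      obtain rfl : x = u := by simpa using hx
      rfl

end Layouts

section JoinStructure
open scoped Classical

variable {V : Type*} {G : SimpleGraph V}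

theorem HasCover.add {C X Y : Finset V} {r q : ℕ} (hC : C.val = X.val + Y.val)
    (hX : HasCover G r X) (hY : HasCover G q Y) : HasCover G (r + q) C := by
  obtain ⟨E, hE, Ls, h1, h2, rfl⟩ := hX
  obtain ⟨F, hF, Ms, k1, k2, rfl⟩ := hY
  refine ⟨Ls.flatten ++ Ms.flatten, by rw [hC, ← hE, ← hF, Multiset.coe_add], Ls ++ Ms, ?_, ?_,
    by simp⟩
  · rw [List.length_append]; omega
  · intro L hL
    rcases List.mem_append.1 hL with hL | hL
    · exact h2 L hL
    · exact k2 L hL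

theorem hasCover_of_join {A B C : Finset V} (hC : C.val = A.val + B.val) (hj : JoinedTo G A B)
    (hA : A.Nonempty) (hle : A.card ≤ B.card) : HasCover G (max 1 (B.card - A.card)) C := by
  rcases hle.eq_or_lt with h | h
  · obtain ⟨a, ha⟩ := hA
    have hB : B.Nonempty := Finset.card_pos.1 (by rw [← h]; exact Finset.card_pos.2 ⟨a, ha⟩)
    obtain ⟨b, hb⟩ := hB
    exact (hamPath_of_balanced hC hj h ha hb).hamFrom.hasCover.mono (le_max_left _ _)
  · obtain ⟨B', hB', hcard⟩ := Finset.exists_subset_card_eq (s := B) (n := A.card + 1) h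
    have hA0 := hA.card_pos
    obtain ⟨x, hx, y, hy, hxy⟩ := Finset.one_lt_card.1 (by omega : 1 < B'.card)
    have hd := Finset.disjoint_of_val_eq_add hC
    have hd' : Disjoint B' A := (Finset.disjoint_of_subset_right hB' hd).symm
    have h1 : HamPath G (B' ∪ A) x y :=
      hamPath_of_mem_left (Finset.val_eq_add_of_disjoint hd' rfl)
        (fun b hb a ha => (hj a ha b (hB' hb)).symm) (hasCover_card A) (by omega) (by omega) hx hy hxy
    have h2 : C.val = (B' ∪ A).val + (B \ B').val := by
      rw [Finset.val_eq_add_of_disjoint hd' rfl, hC, add_right_comm,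
        ← Finset.val_eq_add_of_disjoint Finset.disjoint_sdiff (Finset.union_sdiff_of_subset hB'),
        add_comm]
    refine (h1.hamFrom.hasCover.add h2 (hasCover_card _)).mono ?_
    rw [Finset.card_sdiff_of_subset hB']
    omega

/-- A decomposition of `D` as a join with a disconnected side whose layout has many pieces. -/
structure JoinLayout (G : SimpleGraph V) (D A B W : Finset V) (𝒦 : Finset (Finset V)) : Prop where
  val : D.val = A.val + B.val
  joined : JoinedTo G A B
  nonempty : A.Nonempty
  card_lt : A.card < B.card
  layout : Layout G B W 𝒦
  card_le : W.card + A.card ≤ 𝒦.card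
  two_le : W.card + 2 ≤ 𝒦.card
  detach : ∀ w ∈ W, ∃ K ∈ 𝒦, ∀ x ∈ K, ¬ G.Adj w x

theorem hamPath_or_joinLayout {D A B : Finset V} (hN : NoPathOn G D) (hD : D.val = A.val + B.val)
    (hj : JoinedTo G A B) (hA : A.Nonempty) (hlt : A.card < B.card)
    (hmin : ∀ A' B' : Finset V, D.val = A'.val + B'.val → JoinedTo G A' B' → A'.Nonempty →
      A'.card ≤ B'.card → B.card ≤ B'.card) :
    (∀ x ∈ D, ∀ y ∈ D, x ≠ y → HamPath G D x y) ∨ ∃ W 𝒦, JoinLayout G D A B W 𝒦 := by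
  have hA0 := hA.card_pos
  have hBD : B ⊆ D := fun v hv => (Finset.mem_iff_of_val_eq_add hD).2 (Or.inr hv)
  have hd := Finset.disjoint_of_val_eq_add hD
  obtain ⟨X, Y, hB, hX, hY, h⟩ := (hN.mono hBD).split (by omega)
  have hXB : X ⊆ B := fun v hv => (Finset.mem_iff_of_val_eq_add hB).2 (Or.inl hv)
  have hYB : Y ⊆ B := fun v hv => (Finset.mem_iff_of_val_eq_add hB).2 (Or.inr hv)
  rcases h with h | h
  · left
    have key : ∀ {X Y : Finset V}, B.val = X.val + Y.val → JoinedTo G X Y → X.Nonempty →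
        Y.Nonempty → X.card ≤ Y.card → X ⊆ B → Y ⊆ B →
        ∀ x ∈ D, ∀ y ∈ D, x ≠ y → HamPath G D x y := by
      intro X Y hB h hX hY hle hXB hYB
      have hX0 := hX.card_pos
      have hY0 := hY.card_pos
      have hBc := Finset.card_of_val_eq_add hB
      have hAX : Disjoint A X := Finset.disjoint_of_subset_right hXB hd
      have hAXv := Finset.val_eq_add_of_disjoint hAX rfl
      have hAXc : (A ∪ X).card = A.card + X.card := Finset.card_union_of_disjoint hAX
      have hsplit : D.val = (A ∪ X).val + Y.val := by rw [hAXv, hD, hB, add_assoc]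
      have hjoin : JoinedTo G (A ∪ X) Y := by
        intro a ha b hb
        rcases Finset.mem_union.1 ha with ha | ha
        · exact hj a ha b (hYB hb)
        · exact h a ha b hb
      have h1 : Y.card ≤ A.card := by
        rcases le_total (A ∪ X).card Y.card with hle' | hle'
        · have := hmin _ _ hsplit hjoin (hA.mono Finset.subset_union_left) hle'
          omega
        · have := hmin _ _ (val_eq_add_comm hsplit) hjoin.symm hY hle'
          omega
      intro x hx y hy hxy
      by_cases hA1 : 2 ≤ A.card
      · exact hamPath_of_join hD hj (hasCover_of_join hB h hX hle) (by omega) hlt hx hy hxy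
      · have hD3 : D.card = 3 := by have := Finset.card_of_val_eq_add hD; omega
        obtain ⟨a, rfl⟩ := Finset.card_eq_one.1 (by omega : A.card = 1)
        obtain ⟨b, rfl⟩ := Finset.card_eq_one.1 (by omega : X.card = 1)
        obtain ⟨c, rfl⟩ := Finset.card_eq_one.1 (by omega : Y.card = 1)
        have hab : G.Adj a b := hj a (by simp) b (hXB (by simp))
        have hac : G.Adj a c := hj a (by simp) c (hYB (by simp))
        have hbc : G.Adj b c := h b (by simp) c (by simp)
        have hm : ∀ {v}, v ∈ D → v = a ∨ v = b ∨ v = c := by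
          intro v hv
          simpa [Finset.mem_iff_of_val_eq_add hsplit, or_assoc] using hv
        have hadj : ∀ u ∈ D, ∀ v ∈ D, u ≠ v → G.Adj u v := by
          intro u hu v hv huv
          rcases hm hu with rfl | rfl | rfl <;> rcases hm hv with rfl | rfl | rfl <;>
            first | exact absurd rfl huv | assumption | (apply SimpleGraph.Adj.symm; assumption)
        have hxyD : ({x, y} : Finset V) ⊆ D := by
          intro v hv
          rcases Finset.mem_insert.1 hv with rfl | hv
          · exact hx
          · rw [Finset.mem_singleton.1 hv]; exact hy
        have hc2 : ({x, y} : Finset V).card = 2 := Finset.card_pair hxy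
        have hc1 : (D \ {x, y}).card = 1 := by rw [Finset.card_sdiff_of_subset hxyD]; omega
        refine hamPath_of_mem_left (A := {x, y}) (B := D \ {x, y})
          (Finset.val_eq_add_of_disjoint Finset.disjoint_sdiff (Finset.union_sdiff_of_subset hxyD))
          ?_ (hasCover_card _) (by omega) (by omega) (by simp) (by simp) hxy
        intro u hu v hv
        refine hadj u (hxyD hu) v (Finset.mem_sdiff.1 hv).1 ?_
        rintro rfl
        exact (Finset.mem_sdiff.1 hv).2 hu
    rcases le_total X.card Y.card with hle | hle
    · exact key hB h hX hY hle hXB hYB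
    · exact key (val_eq_add_comm hB) h.symm hY hX hle hYB hXB
  · obtain ⟨W, 𝒦, h1⟩ := ((hN.mono hBD).mono hXB).exists_layout _ rfl hX
    obtain ⟨W', 𝒦', h2⟩ := ((hN.mono hBD).mono hYB).exists_layout _ rfl hY
    have hL := h1.union hB h h2
    have hc : (W ∪ W').card + 2 ≤ (𝒦 ∪ 𝒦').card := by
      have k1 := h1.card
      have k2 := h2.card
      have k3 := Finset.card_union_le W W'
      have hK : Disjoint 𝒦 𝒦' := by
        rw [Finset.disjoint_left]
        intro K hK hK'
        obtain ⟨x, hx⟩ := h1.nonempty K hK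
        exact Finset.disjoint_left.1 (Finset.disjoint_of_val_eq_add hB) (h1.piece_subset hK hx)
          (h2.piece_subset hK' hx)
      rw [Finset.card_union_of_disjoint hK]
      omega
    by_cases hr : (W ∪ W').card + A.card ≤ (𝒦 ∪ 𝒦').card
    · refine Or.inr ⟨_, _, hD, hj, hA, hlt, hL, hr, hc, ?_⟩
      intro w hw
      rcases Finset.mem_union.1 hw with hw | hw
      · obtain ⟨K, hK⟩ := Finset.card_pos.1 (by have := h2.card; omega : 0 < 𝒦'.card)
        exact ⟨K, Finset.mem_union_right _ hK,
          fun x hx => h w (h1.subset hw) x (h2.piece_subset hK hx)⟩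
      · obtain ⟨K, hK⟩ := Finset.card_pos.1 (by have := h1.card; omega : 0 < 𝒦.card)
        exact ⟨K, Finset.mem_union_left _ hK,
          fun x hx => h.symm w (h2.subset hw) x (h1.piece_subset hK hx)⟩
    · exact Or.inl fun x hx y hy hxy =>
        hamPath_of_join hD hj hL.hasCover_card (by omega) hlt hx hy hxy

/-- The structure of a connected `P₄`-free graph. -/
theorem NoPathOn.exists_structure {D : Finset V} (hN : NoPathOn G D) (hD : D.Nonempty)
    (hconn : ∀ X Y : Finset V, D.val = X.val + Y.val → X.Nonempty → Y.Nonempty → ¬ Apart G X Y) :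
    D.card = 1 ∨ (∃ A B : Finset V, D.val = A.val + B.val ∧ JoinedTo G A B ∧ A.card = B.card) ∨
      (∀ x ∈ D, ∀ y ∈ D, x ≠ y → HamPath G D x y) ∨ ∃ A B W 𝒦, JoinLayout G D A B W 𝒦 := by
  by_cases h2 : 2 ≤ D.card
  · obtain ⟨X, Y, hXY, hX, hY, h⟩ := hN.split h2
    have h := h.resolve_right (hconn X Y hXY hX hY)
    have hex : ∃ n, ∃ A B : Finset V, D.val = A.val + B.val ∧ JoinedTo G A B ∧ A.Nonempty ∧
        A.card ≤ B.card ∧ B.card = n := by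
      rcases le_total X.card Y.card with hle | hle
      · exact ⟨_, X, Y, hXY, h, hX, hle, rfl⟩
      · exact ⟨_, Y, X, val_eq_add_comm hXY, h.symm, hY, hle, rfl⟩
    obtain ⟨A, B, hAB, hj, hA, hle, hn⟩ := Nat.find_spec hex
    rcases hle.eq_or_lt with heq | hlt
    · exact Or.inr (Or.inl ⟨A, B, hAB, hj, heq⟩)
    · rcases hamPath_or_joinLayout hN hAB hj hA hlt (fun A' B' h1 h2 h3 h4 =>
        hn.le.trans (Nat.find_min' hex ⟨A', B', h1, h2, h3, h4, rfl⟩)) with h | ⟨W, 𝒦, h⟩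
      · exact Or.inr (Or.inr (Or.inl h))
      · exact Or.inr (Or.inr (Or.inr ⟨A, B, W, 𝒦, h⟩))
  · left
    have := hD.card_pos
    omega

end JoinStructure

section Packages
open scoped Classical

variable {V ι : Type*} {G : SimpleGraph V} {S : Finset V} {D : ι → Finset V}

/-- `F` is a family of disjoint nonempty subsets of `C` separated from the rest by `T`. -/
structure ClosedFamily (G : SimpleGraph V) (C T : Finset V) (F : Finset (Finset V)) : Prop where
  nonempty : ∀ K ∈ F, K.Nonempty
  subset : ∀ K ∈ F, K ⊆ C
  disjoint : ∀ K ∈ F, Disjoint K T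
  closed : ∀ K ∈ F, ∀ x ∈ K, ∀ y, G.Adj x y → y ∈ K ∨ y ∈ T
  pairwise : (F : Set (Finset V)).PairwiseDisjoint id

theorem FamilyTough.card_le {C T : Finset V} {F : Finset (Finset V)} (h : FamilyTough G)
    (hF : ClosedFamily G C T F) (h2 : 2 ≤ F.card) : 9 * F.card ≤ 2 * T.card :=
  h F T (fun K hK => ⟨hF.nonempty K hK, hF.disjoint K hK, hF.closed K hK⟩) hF.pairwise h2

theorem FamilyTough.nine_le [Fintype V] {C T : Finset V} {F : Finset (Finset V)}
    (h : FamilyTough G) (hF : ClosedFamily G C T F) (hne : F.Nonempty) {v : V} (hvC : v ∉ C)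
    (hvT : v ∉ T) : 9 ≤ T.card ∧ 9 * F.card ≤ 2 * T.card := by
  have hpos := hne.card_pos
  suffices h9 : 9 ≤ T.card by
    refine ⟨h9, ?_⟩
    by_cases h2 : 2 ≤ F.card
    · exact h.card_le hF h2
    · omega
  by_cases h2 : 2 ≤ F.card
  · have := h.card_le hF h2
    omega
  obtain ⟨K, hK⟩ := hne
  have hvK : v ∉ K := fun hv => hvC (hF.subset K hK hv)
  let R : Finset V := Finset.univ \ (K ∪ T)
  have hR : ∀ {x}, x ∈ R ↔ x ∉ K ∧ x ∉ T := by simp [R]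
  have hKR : K ≠ R := fun e => hvK (e ▸ hR.2 ⟨hvK, hvT⟩)
  have hdis : Disjoint K R := Finset.disjoint_left.2 fun x hx hxR => (hR.1 hxR).1 hx
  have hfam := h {K, R} T ?_ ?_ ?_
  · rw [Finset.card_pair hKR] at hfam
    omega
  · intro L hL
    rcases Finset.mem_insert.1 hL with rfl | hL
    · exact ⟨hF.nonempty _ hK, hF.disjoint _ hK, hF.closed _ hK⟩
    · obtain rfl := Finset.mem_singleton.1 hL
      refine ⟨⟨v, hR.2 ⟨hvK, hvT⟩⟩, Finset.disjoint_left.2 fun x hx => (hR.1 hx).2, ?_⟩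
      intro x hx y hxy
      by_contra hcon
      push Not at hcon
      rw [hR] at hcon
      have hyK : y ∈ K := by
        by_contra hy
        exact hcon.2 (not_not.1 fun h => hcon.1 ⟨hy, h⟩)
      rcases hF.closed K hK y hyK x hxy.symm with h | h
      · exact (hR.1 hx).1 h
      · exact (hR.1 hx).2 h
  · intro L hL M hM hne
    simp only [Finset.coe_insert, Finset.coe_singleton, Set.mem_insert_iff,
      Set.mem_singleton_iff] at hL hM
    rcases hL with rfl | rfl <;> rcases hM with rfl | rfl
    · exact absurd rfl hne
    · exact hdis
    · exact hdis.symm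
    · exact absurd rfl hne
  · rw [Finset.card_pair hKR]

/-- A way of spanning `C` by paths with ends attached to distinct vertices of `S`, one of them
the prescribed vertex `s`, given a system of distinct representatives for the demands `P`. -/
structure Package (G : SimpleGraph V) (S C : Finset V) (s : V) (P : Finset (Finset V × Bool))
    (cand : Finset V × Bool → Finset V) : Prop where
  cand_subset : ∀ p ∈ P, cand p ⊆ S.erase s ∪ C
  hall : ∀ X ⊆ P, X.Nonempty →
    (X.card = 1 ∧ ((∃ w ∈ X.biUnion cand, w ∈ C) ∨ 2 ≤ (X.biUnion cand ∩ S).card)) ∨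
    ∃ (J : Finset (Finset V)) (a : V), a ∈ C ∧ J.Nonempty ∧ X.card ≤ 2 * J.card ∧
      ClosedFamily G C (insert s (insert a (X.biUnion cand))) J
  realize : ∀ φ : Finset V × Bool → V, (∀ p ∈ P, φ p ∈ cand p) → Set.InjOn φ P →
    ∃ M : Multiset (PortedPath V), (∀ Q ∈ M, Q.Good G (· ∈ C)) ∧ systemVerts M = C.val ∧
      (∀ o ∈ systemPorts M, ∃ t ∈ S, o = some t) ∧ (∀ v, (systemPorts M).count (some v) ≤ 1) ∧
      (∀ o ∈ systemPorts M, o = some s ∨ ∃ p ∈ P, o = some (φ p)) ∧ some s ∈ systemPorts M ∧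
      ∃ (F : Finset (Finset V)) (W : Finset V), W ⊆ C ∧ ClosedFamily G C (S ∪ W) F ∧ F.Nonempty ∧
        8 * M.card + 2 * W.card ≤ 9 * F.card

/-- The vertices of `S` other than `s` with a neighbour in `Y`. -/
noncomputable def otherNeighbors (G : SimpleGraph V) (S : Finset V) (s : V) (Y : Finset V) :
    Finset V := (S.erase s).filter fun t => ∃ y ∈ Y, G.Adj t y

theorem mem_otherNeighbors {s t : V} {Y : Finset V} :
    t ∈ otherNeighbors G S s Y ↔ (t ≠ s ∧ t ∈ S) ∧ ∃ y ∈ Y, G.Adj t y := by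
  rw [otherNeighbors, Finset.mem_filter, Finset.mem_erase]

theorem otherNeighbors_subset {s : V} {Y : Finset V} : otherNeighbors G S s Y ⊆ S :=
  fun _ h => (mem_otherNeighbors.1 h).1.2

theorem CutSystem.mem_or_of_adj (C : CutSystem G S D) {i : ι} {x y : V} (hx : x ∈ D i)
    (h : G.Adj x y) : y ∈ D i ∨ y ∈ S := by
  by_contra hcon
  push Not at hcon
  exact C.not_adj_of_notMem hx hcon.1 hcon.2 h

theorem CutSystem.exists_notMem (C : CutSystem G S D) (i : ι) : ∃ v, v ∉ D i ∧ v ∉ S := by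
  obtain ⟨j, hj⟩ := C.two i
  obtain ⟨v, hv⟩ := C.nonempty j
  exact ⟨v, fun h => hj (C.mem_unique hv h), C.notMem hv⟩

theorem CutSystem.nine_le [Fintype V] (C : CutSystem G S D) {i : ι} {T : Finset V}
    {F : Finset (Finset V)} (hF : ClosedFamily G (D i) T F) (hne : F.Nonempty) (hT : T ⊆ S ∪ D i) :
    9 ≤ T.card ∧ 9 * F.card ≤ 2 * T.card := by
  obtain ⟨v, hv, hvS⟩ := C.exists_notMem i
  refine C.tough.nine_le hF hne hv fun h => ?_
  rcases Finset.mem_union.1 (hT h) with h | h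
  · exact hvS h
  · exact hv h

theorem closedFamily_singleton {C T K : Finset V} (hK : K.Nonempty) (hKC : K ⊆ C)
    (hT : Disjoint K T) (hcl : ∀ x ∈ K, ∀ y, G.Adj x y → y ∈ K ∨ y ∈ T) :
    ClosedFamily G C T {K} where
  nonempty := by simpa using hK
  subset := by simpa using hKC
  disjoint := by simpa using hT
  closed := by simpa using hcl
  pairwise := by simp

theorem CutSystem.package_of_hamPath (C : CutSystem G S D) {i : ι} {s x : V} (hs : s ∈ S)
    {Y : Finset V} (hx : x ∈ D i) (hsx : G.Adj s x) (hYD : Y ⊆ D i)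
    (hY : ∀ y ∈ Y, HamPath G (D i) x y) (h2 : 2 ≤ (otherNeighbors G S s Y).card) :
    Package G S (D i) s {(D i, true)} fun _ => otherNeighbors G S s Y where
  cand_subset := by
    intro p hp t ht
    have := mem_otherNeighbors.1 ht
    exact Finset.mem_union_left _ (Finset.mem_erase.2 this.1)
  hall := by
    intro X hX hne
    left
    have hXe : X = {(D i, true)} := by
      rcases Finset.subset_singleton_iff.1 hX with rfl | h
      · simp at hne
      · exact h
    refine ⟨by simp [hXe], Or.inr ?_⟩
    rw [hXe, Finset.singleton_biUnion, Finset.inter_eq_left.2 otherNeighbors_subset]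
    exact h2
  realize := by
    intro φ hφ _
    obtain ⟨⟨hts, htS⟩, y, hy, hty⟩ := mem_otherNeighbors.1 (hφ (D i, true) (by simp))
    set t := φ (D i, true)
    obtain ⟨L, h1, h2, h3, h4⟩ := hY y hy
    have hports : systemPorts {(⟨some s, L, some t⟩ : PortedPath V)} = {some s, some t} := by
      simp [systemPorts, PortedPath.ports]
    refine ⟨{⟨some s, L, some t⟩}, ?_, by simp [systemVerts, h1], ?_, ?_, ?_, ?_, {D i}, ∅, by simp,
      ?_, by simp, by simp⟩
    · intro Q hQ
      obtain rfl := Multiset.mem_singleton.1 hQ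
      refine ⟨by rintro rfl; simp at h3, h2, ?_, ?_⟩
      · intro z hz
        obtain rfl : x = z := by simpa [h3] using hz
        refine ⟨hx, fun s' e => ?_⟩
        obtain rfl : s = s' := by simpa using e
        exact hsx
      · intro z hz
        obtain rfl : y = z := by simpa [h4] using hz
        refine ⟨hYD hy, fun s' e => ?_⟩
        obtain rfl : t = s' := by simpa using e
        exact hty
    · rw [hports]
      intro o ho
      simp only [Multiset.insert_eq_cons, Multiset.mem_cons, Multiset.mem_singleton] at ho
      rcases ho with rfl | rfl
      · exact ⟨s, hs, rfl⟩
      · exact ⟨t, htS, rfl⟩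
    · rw [hports]
      intro v
      refine Multiset.nodup_iff_count_le_one.1 ?_ _
      simpa using hts.symm
    · rw [hports]
      intro o ho
      simp only [Multiset.insert_eq_cons, Multiset.mem_cons, Multiset.mem_singleton] at ho
      rcases ho with rfl | rfl
      · exact Or.inl rfl
      · exact Or.inr ⟨_, by simp, rfl⟩
    · rw [hports]; simp
    · refine closedFamily_singleton (C.nonempty i) le_rfl ?_ ?_
      · rw [Finset.union_empty]
        exact Finset.disjoint_left.2 fun _ h => C.notMem h
      · intro z hz y hzy
        simpa using C.mem_or_of_adj hz hzy

theorem CutSystem.exists_package_of_balanced [Fintype V] (C : CutSystem G S D) {i : ι} {s x : V}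
    (hs : s ∈ S) {A B : Finset V} (hAB : (D i).val = A.val + B.val) (hj : JoinedTo G A B)
    (hc : A.card = B.card) (hx : x ∈ A) (hsx : G.Adj s x) :
    ∃ P cand, Package G S (D i) s P cand := by
  have hm := @Finset.mem_iff_of_val_eq_add _ _ _ _ hAB
  have hAD : A ⊆ D i := fun v hv => hm.2 (Or.inl hv)
  have hBD : B ⊆ D i := fun v hv => hm.2 (Or.inr hv)
  have hd := Finset.disjoint_of_val_eq_add hAB
  by_cases h2 : 2 ≤ (otherNeighbors G S s B).card
  · exact ⟨_, _, C.package_of_hamPath hs (hAD hx) hsx hBD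
      (fun y hy => hamPath_of_balanced hAB hj hc hx hy) h2⟩
  · have hpos : 0 < B.card := hc ▸ Finset.card_pos.2 ⟨x, hx⟩
    have hedge : ∃ u ∈ B, ∃ v ∈ B, G.Adj u v := by
      by_contra hcon
      push Not at hcon
      have hF : ClosedFamily G (D i) (A ∪ insert s (otherNeighbors G S s B))
          (B.image fun b => {b}) := by
        refine ⟨by simp, ?_, ?_, ?_, ?_⟩
        · intro K hK
          obtain ⟨b, hb, rfl⟩ := Finset.mem_image.1 hK
          simpa using hBD hb
        · intro K hK
          obtain ⟨b, hb, rfl⟩ := Finset.mem_image.1 hK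
          rw [Finset.disjoint_singleton_left, Finset.mem_union, Finset.mem_insert]
          rintro (h | rfl | h)
          · exact Finset.disjoint_left.1 hd h hb
          · exact C.notMem (hBD hb) hs
          · exact C.notMem (hBD hb) (otherNeighbors_subset h)
        · intro K hK z hz y hzy
          obtain ⟨b, hb, rfl⟩ := Finset.mem_image.1 hK
          obtain rfl := Finset.mem_singleton.1 hz
          right
          rw [Finset.mem_union, Finset.mem_insert]
          rcases C.mem_or_of_adj (hBD hb) hzy with h | h
          · rcases hm.1 h with h | h
            · exact Or.inl h
            · exact absurd hzy (hcon _ hb _ h)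
          · by_cases hys : y = s
            · exact Or.inr (Or.inl hys)
            · exact Or.inr (Or.inr (mem_otherNeighbors.2 ⟨⟨hys, h⟩, _, hb, hzy.symm⟩))
        · intro K hK L hL hne
          obtain ⟨b, hb, rfl⟩ := Finset.mem_image.1 (Finset.mem_coe.1 hK)
          obtain ⟨b', hb', rfl⟩ := Finset.mem_image.1 (Finset.mem_coe.1 hL)
          simp only [Function.onFun, id]
          rw [Finset.disjoint_singleton]
          rintro rfl
          exact hne rfl
      have hcard : (B.image fun b => ({b} : Finset V)).card = B.card :=
        Finset.card_image_of_injective _ Finset.singleton_injective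
      have hne : (B.image fun b => ({b} : Finset V)).Nonempty := Finset.card_pos.1 (by omega)
      obtain ⟨h9, h9'⟩ := C.nine_le hF hne (by
        intro v hv
        rw [Finset.mem_union, Finset.mem_insert] at hv
        rw [Finset.mem_union]
        rcases hv with h | rfl | h
        · exact Or.inr (hAD h)
        · exact Or.inl hs
        · exact Or.inl (otherNeighbors_subset h))
      have k1 := Finset.card_union_le A (insert s (otherNeighbors G S s B))
      have k2 := Finset.card_insert_le s (otherNeighbors G S s B)
      omega
    obtain ⟨u, hu, v, hv, huv⟩ := hedge
    refine ⟨_, _, C.package_of_hamPath hs (hAD hx) hsx (Y := A.erase x)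
      ((Finset.erase_subset _ _).trans hAD) (fun y hy => ?_) ?_⟩
    · exact hamPath_of_mem_left hAB hj (hasCover_of_adj hu hv huv) (by omega) (by omega) hx
        (Finset.mem_erase.1 hy).2 (Finset.mem_erase.1 hy).1.symm
    · have hF : ClosedFamily G (D i) (insert s (insert x (otherNeighbors G S s (A.erase x) ∪
          otherNeighbors G S s B))) {(D i).erase x} := by
        have hxB : x ∉ B := Finset.disjoint_left.1 hd hx
        refine closedFamily_singleton ⟨u, ?_⟩ (Finset.erase_subset _ _) ?_ ?_
        · rw [Finset.mem_erase]
          exact ⟨by rintro rfl; exact hxB hu, hBD hu⟩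
        · rw [Finset.disjoint_left]
          intro z hz hz'
          rw [Finset.mem_erase] at hz
          simp only [Finset.mem_insert, Finset.mem_union] at hz'
          rcases hz' with rfl | rfl | h | h
          · exact C.notMem hz.2 hs
          · exact hz.1 rfl
          · exact C.notMem hz.2 (otherNeighbors_subset h)
          · exact C.notMem hz.2 (otherNeighbors_subset h)
        · intro z hz y hzy
          rw [Finset.mem_erase] at hz ⊢
          simp only [Finset.mem_insert, Finset.mem_union]
          by_cases hyx : y = x
          · exact Or.inr (Or.inr (Or.inl hyx))
          by_cases hys : y = s
          · exact Or.inr (Or.inl hys)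
          rcases C.mem_or_of_adj hz.2 hzy with h | h
          · exact Or.inl ⟨hyx, h⟩
          · refine Or.inr (Or.inr (Or.inr ?_))
            rcases hm.1 hz.2 with hzA | hzB
            · exact Or.inl (mem_otherNeighbors.2
                ⟨⟨hys, h⟩, z, Finset.mem_erase.2 ⟨hz.1, hzA⟩, hzy.symm⟩)
            · exact Or.inr (mem_otherNeighbors.2 ⟨⟨hys, h⟩, z, hzB, hzy.symm⟩)
      obtain ⟨h9, -⟩ := C.nine_le hF (by simp) (by
        intro v hv
        simp only [Finset.mem_insert, Finset.mem_union] at hv ⊢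
        rcases hv with rfl | rfl | h | h
        · exact Or.inl hs
        · exact Or.inr (hAD hx)
        · exact Or.inl (otherNeighbors_subset h)
        · exact Or.inl (otherNeighbors_subset h))
      have k1 := Finset.card_union_le (otherNeighbors G S s (A.erase x)) (otherNeighbors G S s B)
      have k2 := Finset.card_insert_le x (otherNeighbors G S s (A.erase x) ∪
          otherNeighbors G S s B)
      have k3 := Finset.card_insert_le s (insert x (otherNeighbors G S s (A.erase x) ∪
          otherNeighbors G S s B))
      omega

theorem CutSystem.exists_package_of_hamPath [Fintype V] (C : CutSystem G S D) {i : ι} {s : V}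
    (hs : s ∈ S) (h : ∀ x ∈ D i, ∀ y ∈ D i, x ≠ y → HamPath G (D i) x y) :
    ∃ P cand, Package G S (D i) s P cand := by
  obtain ⟨x, hx, hsx⟩ := C.nbr s hs i
  have key : ∀ {Y : Finset V} {a : V}, Y.Nonempty → Y ⊆ D i → a ∉ Y → (a = s ∨ a ∈ D i) →
      (∀ v ∈ D i, v ∈ Y ∨ v = a) → 2 ≤ (otherNeighbors G S s Y).card := by
    intro Y a hne hYD haY ha hYa
    have hF : ClosedFamily G (D i) (insert s (insert a (otherNeighbors G S s Y))) {Y} := by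
      refine closedFamily_singleton hne hYD ?_ ?_
      · rw [Finset.disjoint_left]
        intro z hz hz'
        simp only [Finset.mem_insert] at hz'
        rcases hz' with rfl | rfl | h
        · exact C.notMem (hYD hz) hs
        · exact haY hz
        · exact C.notMem (hYD hz) (otherNeighbors_subset h)
      · intro z hz y hzy
        simp only [Finset.mem_insert]
        by_cases hys : y = s
        · exact Or.inr (Or.inl hys)
        rcases C.mem_or_of_adj (hYD hz) hzy with h | h
        · rcases hYa y h with h | h
          · exact Or.inl h
          · exact Or.inr (Or.inr (Or.inl h))
        · exact Or.inr (Or.inr (Or.inr (mem_otherNeighbors.2 ⟨⟨hys, h⟩, z, hz, hzy.symm⟩)))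
    obtain ⟨h9, -⟩ := C.nine_le hF (by simp) (by
      intro v hv
      simp only [Finset.mem_insert, Finset.mem_union] at hv ⊢
      rcases hv with rfl | rfl | h
      · exact Or.inl hs
      · rcases ha with rfl | ha
        · exact Or.inl hs
        · exact Or.inr ha
      · exact Or.inl (otherNeighbors_subset h))
    have k1 := Finset.card_insert_le a (otherNeighbors G S s Y)
    have k2 := Finset.card_insert_le s (insert a (otherNeighbors G S s Y))
    omega
  by_cases h1 : D i = {x}
  · refine ⟨_, _, C.package_of_hamPath hs hx hsx le_rfl (fun y hy => ?_)
      (key (a := s) (C.nonempty i) le_rfl (fun h => C.notMem h hs) (Or.inl rfl)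
        fun v hv => Or.inl hv)⟩
    rw [h1, Finset.mem_singleton] at hy
    subst hy
    exact ⟨[y], by simp [h1], by simp, rfl, rfl⟩
  · refine ⟨_, _, C.package_of_hamPath hs hx hsx (Finset.erase_subset x _) (fun y hy => ?_)
      (key (a := x) ?_ (Finset.erase_subset x _) (by simp) (Or.inr hx) fun v hv => ?_)⟩
    · exact h x hx y (Finset.mem_erase.1 hy).2 (Finset.mem_erase.1 hy).1.symm
    · rw [Finset.nonempty_iff_ne_empty, Ne, Finset.erase_eq_empty_iff]
      rintro (h | h)
      · simp [h] at hx
      · exact h1 h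
    · by_cases hvx : v = x
      · exact Or.inr hvx
      · exact Or.inl (Finset.mem_erase.2 ⟨hvx, hv⟩)

end Packages

section JoinPackages
open scoped Classical

variable {V ι : Type*} {G : SimpleGraph V} {S : Finset V} {D : ι → Finset V}

theorem List.IsChain.iff_of_adj {p : V → Prop} {x : V} {L : List V} (hL : (x :: L).IsChain G.Adj)
    (h : ∀ a ∈ x :: L, ∀ b ∈ x :: L, G.Adj a b → (p a ↔ p b)) : ∀ y ∈ x :: L, p x ↔ p y := by
  induction L generalizing x with
  | nil => simp
  | cons z L ih =>
    rw [List.isChain_cons_cons] at hL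
    intro y hy
    rcases List.mem_cons.1 hy with rfl | hy
    · exact Iff.rfl
    · exact (h x (by simp) z (by simp) hL.1).trans
        (ih hL.2 (fun a ha b hb => h a (List.mem_cons_of_mem _ ha) b (List.mem_cons_of_mem _ hb))
          y hy)

theorem HamFrom.exists_adj {p : V → Prop} {K : Finset V} {x u v : V} (h : HamFrom G K x)
    (hu : u ∈ K) (hpu : p u) (hv : v ∈ K) (hpv : ¬ p v) :
    ∃ a ∈ K, ∃ b ∈ K, G.Adj a b ∧ p a ∧ ¬ p b := by
  by_contra hcon
  push Not at hcon
  obtain ⟨L, hL, hc, hx⟩ := h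
  have hm := @mem_of_coe_eq_val _ _ _ hL
  cases L with
  | nil => simp at hx
  | cons y L =>
    have := hc.iff_of_adj (p := p) fun a ha b hb hab =>
      ⟨fun h => hcon a (hm.1 ha) b (hm.1 hb) hab h, fun h => hcon b (hm.1 hb) a (hm.1 ha) hab.symm h⟩
    exact hpv ((this v (hm.2 hv)).1 ((this u (hm.2 hu)).2 hpu))

theorem CutSystem.adj_of_mixed (C : CutSystem G S D) {i : ι} {t u v x : V} {K K' : Finset V}
    (ht : t ∈ S) (hK : K ⊆ D i) (hK' : K' ⊆ D i) (ha : Apart G K K') (hh : HamFrom G K x)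
    (hu : u ∈ K) (htu : G.Adj t u) (hv : v ∈ K) (htv : ¬ G.Adj t v) : ∀ z ∈ K', G.Adj t z := by
  intro z hz
  by_contra htz
  obtain ⟨a, haK, b, hb, hab, hta, htb⟩ := hh.exists_adj (p := G.Adj t) hu htu hv htv
  obtain ⟨j, hj⟩ := C.two i
  obtain ⟨c, hc, htc⟩ := C.nbr t ht j
  exact C.noPathPoint b a t c z hab.symm hta.symm htc (fun h => htb h.symm)
    (C.not_adj (hK haK) hc hj.symm) (C.not_adj (hK hb) hc hj.symm)
    (fun h => ha b hb z hz h.symm) (fun h => ha a haK z hz h.symm) (fun h => htz h.symm)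
    (C.not_adj (hK' hz) hc hj.symm)

theorem JoinLayout.mem_iff {C A B W : Finset V} {𝒦 : Finset (Finset V)}
    (h : JoinLayout G C A B W 𝒦) {v : V} : v ∈ C ↔ v ∈ A ∨ v ∈ W ∨ ∃ K ∈ 𝒦, v ∈ K := by
  rw [Finset.mem_iff_of_val_eq_add h.val, h.layout.mem_iff]

theorem CutSystem.adj_piece (C : CutSystem G S D) {i : ι} {A B W K : Finset V}
    {𝒦 : Finset (Finset V)} (h : JoinLayout G (D i) A B W 𝒦) (hK : K ∈ 𝒦) {x y : V} (hx : x ∈ K)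
    (hxy : G.Adj x y) : y ∈ K ∨ y ∈ W ∨ y ∈ A ∨ y ∈ S := by
  rcases C.mem_or_of_adj (h.mem_iff.2 (Or.inr (Or.inr ⟨K, hK, hx⟩))) hxy with hy | hy
  · rcases h.mem_iff.1 hy with hy | hy | ⟨K', hK', hy⟩
    · exact Or.inr (Or.inr (Or.inl hy))
    · exact Or.inr (Or.inl hy)
    · left
      by_contra hcon
      exact h.layout.apart K hK K' hK' (by rintro rfl; exact hcon hy) x hx y hy hxy
  · exact Or.inr (Or.inr (Or.inr hy))

theorem Layout.pairwiseDisjoint {C W : Finset V} {𝒦 : Finset (Finset V)} (h : Layout G C W 𝒦) :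
    (𝒦 : Set (Finset V)).PairwiseDisjoint id := by
  have hn : (𝒦.val.bind Finset.val).Nodup := by
    have := C.nodup
    rw [h.val] at this
    exact Multiset.nodup_of_le (Multiset.le_add_left _ _) this
  intro K hK K' hK' hne
  rw [Multiset.nodup_bind] at hn
  have : Std.Symm (Function.onFun Disjoint (Finset.val : Finset V → Multiset V)) :=
    ⟨fun _ _ h => Disjoint.symm h⟩
  exact Finset.disjoint_val.1 (Multiset.Pairwise.forall hn.2 hK hK' hne)

theorem Layout.disjoint_piece {C W : Finset V} {𝒦 : Finset (Finset V)} (h : Layout G C W 𝒦)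
    {K : Finset V} (hK : K ∈ 𝒦) : Disjoint K W := by
  have hn := C.nodup
  rw [h.val, Multiset.nodup_add] at hn
  rw [Finset.disjoint_left]
  intro v hv hvW
  exact Multiset.disjoint_left.1 hn.2.2 hvW (Multiset.mem_bind.2 ⟨K, hK, hv⟩)

/-- The vertices of `T` usable for a demand: adjacent to some vertex (`true`) or to every vertex
(`false`) of the given piece. -/
noncomputable def pieceCand (G : SimpleGraph V) (T : Finset V) (q : Finset V × Bool) : Finset V :=
  T.filter fun t => if q.2 then ∃ x ∈ q.1, G.Adj t x else ∀ x ∈ q.1, G.Adj t x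

theorem mem_pieceCand_true {T K : Finset V} {t : V} :
    t ∈ pieceCand G T (K, true) ↔ t ∈ T ∧ ∃ x ∈ K, G.Adj t x := by simp [pieceCand]

theorem mem_pieceCand_false {T K : Finset V} {t : V} :
    t ∈ pieceCand G T (K, false) ↔ t ∈ T ∧ ∀ x ∈ K, G.Adj t x := by simp [pieceCand]

theorem mem_pieceCand_of_complete {T K : Finset V} {t : V} (hK : K.Nonempty) (ht : t ∈ T)
    (h : ∀ x ∈ K, G.Adj t x) (b : Bool) : t ∈ pieceCand G T (K, b) := by
  obtain ⟨x, hx⟩ := hK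
  cases b
  · exact mem_pieceCand_false.2 ⟨ht, h⟩
  · exact mem_pieceCand_true.2 ⟨ht, x, hx, h x hx⟩

theorem pieceCand_subset {T : Finset V} {q : Finset V × Bool} : pieceCand G T q ⊆ T :=
  Finset.filter_subset _ _

theorem CutSystem.joinLayout_hall (C : CutSystem G S D) {i : ι} {s a : V} (hs : s ∈ S)
    {A A₀ B W : Finset V} {𝒦 : Finset (Finset V)} (h : JoinLayout G (D i) A B W 𝒦) (hA₀ : A₀ ⊆ A)
    (hne : A₀.Nonempty) (ha : a ∈ A) (hA : A ⊆ insert a A₀) {P X : Finset (Finset V × Bool)}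
    (hP : ∀ q ∈ P, q.1 ∈ 𝒦) (hX : X ⊆ P) (hXne : X.Nonempty) :
    (X.card = 1 ∧ ((∃ w ∈ X.biUnion (pieceCand G (S.erase s ∪ W ∪ A₀)), w ∈ D i) ∨
      2 ≤ (X.biUnion (pieceCand G (S.erase s ∪ W ∪ A₀)) ∩ S).card)) ∨
    ∃ (J : Finset (Finset V)) (a : V), a ∈ D i ∧ J.Nonempty ∧ X.card ≤ 2 * J.card ∧
      ClosedFamily G (D i)
        (insert s (insert a (X.biUnion (pieceCand G (S.erase s ∪ W ∪ A₀))))) J := by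
  have hAD : A ⊆ D i := fun v hv => h.mem_iff.2 (Or.inl hv)
  have hWD : W ⊆ D i := fun v hv => h.mem_iff.2 (Or.inr (Or.inl hv))
  have hKD : ∀ K ∈ 𝒦, K ⊆ D i := fun K hK v hv => h.mem_iff.2 (Or.inr (Or.inr ⟨K, hK, hv⟩))
  have hAK : ∀ K ∈ 𝒦, ∀ y ∈ A, ∀ x ∈ K, G.Adj y x := fun K hK y hy x hx =>
    h.joined y hy x (h.layout.mem_iff.2 (Or.inr ⟨K, hK, hx⟩))
  by_cases hsing : ∃ K, X = {(K, false)}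
  · obtain ⟨K, rfl⟩ := hsing
    obtain ⟨w, hw⟩ := hne
    have hK := hP _ (hX (Finset.mem_singleton_self _))
    refine Or.inl ⟨by simp, Or.inl ⟨w, ?_, hAD (hA₀ hw)⟩⟩
    rw [Finset.singleton_biUnion, mem_pieceCand_false]
    exact ⟨by simp [hw], hAK K hK w (hA₀ hw)⟩
  right
  refine ⟨X.image Prod.fst, a, hAD ha, hXne.image _, ?_, ?_⟩
  · have : X ⊆ (X.image Prod.fst) ×ˢ (Finset.univ : Finset Bool) := by
      intro q hq
      simpa using Finset.mem_image_of_mem Prod.fst hq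
    have := Finset.card_le_card this
    rw [Finset.card_product, Finset.card_univ, Fintype.card_bool] at this
    omega
  have hJ : ∀ K ∈ X.image Prod.fst, K ∈ 𝒦 ∧ ∃ b, (K, b) ∈ X := by
    intro K hK
    obtain ⟨⟨K', b⟩, hq, rfl⟩ := Finset.mem_image.1 hK
    exact ⟨hP _ (hX hq), b, hq⟩
  refine ⟨fun K hK => h.layout.nonempty K (hJ K hK).1, fun K hK => hKD K (hJ K hK).1, ?_, ?_, ?_⟩
  · intro K hK
    rw [Finset.disjoint_left]
    intro x hx hx'
    have hK := (hJ K hK).1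
    have hxA : x ∉ A := fun hxA => G.loopless.irrefl _ (hAK K hK x hxA x hx)
    simp only [Finset.mem_insert, Finset.mem_biUnion] at hx'
    rcases hx' with rfl | rfl | ⟨q, hq, hxq⟩
    · exact C.notMem (hKD K hK hx) hs
    · exact hxA ha
    · have := pieceCand_subset hxq
      simp only [Finset.mem_union, Finset.mem_erase] at this
      rcases this with (h' | h') | h'
      · exact C.notMem (hKD K hK hx) h'.2
      · exact Finset.disjoint_left.1 (h.layout.disjoint_piece hK) hx h'
      · exact hxA (hA₀ h')
  · intro K hKJ x hx y hxy
    obtain ⟨hK, b, hb⟩ := hJ K hKJ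
    have hcomp : y ∈ S.erase s ∪ W ∪ A₀ → (∀ x ∈ K, G.Adj y x) →
        y ∈ insert s (insert a (X.biUnion (pieceCand G (S.erase s ∪ W ∪ A₀)))) := by
      intro hy hc
      rw [Finset.mem_insert, Finset.mem_insert, Finset.mem_biUnion]
      exact Or.inr (Or.inr ⟨_, hb, mem_pieceCand_of_complete (h.layout.nonempty K hK) hy hc b⟩)
    rcases C.adj_piece h hK hx hxy with hy | hy | hy | hy
    · exact Or.inl hy
    · right
      refine hcomp (by simp [hy]) ?_
      rcases h.layout.mixed y hy K hK with h' | h'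
      · exact h'
      · exact absurd hxy.symm (h' x hx)
    · right
      rcases Finset.mem_insert.1 (hA hy) with rfl | hy'
      · simp
      · exact hcomp (by simp [hy']) (hAK K hK y hy)
    · right
      by_cases hys : y = s
      · simp [hys]
      have hyT : y ∈ S.erase s ∪ W ∪ A₀ := by simp [hy, hys]
      by_cases hc : ∀ x ∈ K, G.Adj y x
      · exact hcomp hyT hc
      push Not at hc
      obtain ⟨v, hv, hyv⟩ := hc
      rw [Finset.mem_insert, Finset.mem_insert, Finset.mem_biUnion]
      refine Or.inr (Or.inr ?_)
      by_cases hKt : (K, true) ∈ X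
      · exact ⟨_, hKt, mem_pieceCand_true.2 ⟨hyT, x, hx, hxy.symm⟩⟩
      · have hbf : b = false := by
          cases b
          · rfl
          · exact absurd hb hKt
        obtain ⟨⟨K', b'⟩, hq', hne'⟩ : ∃ q ∈ X, q ≠ (K, false) := by
          by_contra hcon
          push Not at hcon
          exact hsing ⟨K, Finset.eq_singleton_iff_unique_mem.2 ⟨hbf ▸ hb, hcon⟩⟩
        have hKK' : K ≠ K' := by
          rintro rfl
          cases b'
          · exact hne' rfl
          · exact hKt hq'
        have hK' := hP _ (hX hq')
        exact ⟨_, hq', mem_pieceCand_of_complete (h.layout.nonempty K' hK') hyT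
          (C.adj_of_mixed hy (hKD K hK) (hKD K' hK') (h.layout.apart K hK K' hK' hKK')
            (h.layout.ham K hK x hx) hx hxy.symm hv hyv) b'⟩
  · exact h.layout.pairwiseDisjoint.subset fun K hK => (hJ K (Finset.mem_coe.1 hK)).1

theorem HamFrom.exists_good {K : Finset V} {x t u : V} (h : HamFrom G K x) (htx : G.Adj t x)
    (hu : ∀ y ∈ K, G.Adj u y) : ∃ Q : PortedPath V, Q.Good G (· ∈ K) ∧
      (Q.core : Multiset V) = K.val ∧ Q.left = some t ∧ Q.right = some u := by
  obtain ⟨L, hL, hc, hx⟩ := h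
  have hm := @mem_of_coe_eq_val _ _ _ hL
  refine ⟨⟨some t, L, some u⟩, ⟨by rintro rfl; simp at hx, hc, ?_, ?_⟩, hL, rfl, rfl⟩
  · intro y hy
    refine ⟨hm.1 (List.mem_of_mem_head? hy), ?_⟩
    rintro _ ⟨rfl⟩
    obtain rfl : x = y := by simpa [hx] using hy
    exact htx
  · intro y hy
    have hyK := hm.1 (List.mem_of_mem_getLast? hy)
    refine ⟨hyK, ?_⟩
    rintro _ ⟨rfl⟩
    exact hu y hyK

theorem Layout.exists_system {C W : Finset V} {𝒦 : Finset (Finset V)} (h : Layout G C W 𝒦)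
    {ψ : Finset V × Bool → V} (hinj : ∀ q q', q.1 ∈ 𝒦 → q'.1 ∈ 𝒦 → ψ q = ψ q' → q = q')
    (ht : ∀ K ∈ 𝒦, ∃ x ∈ K, G.Adj (ψ (K, true)) x) (hf : ∀ K ∈ 𝒦, ∀ x ∈ K, G.Adj (ψ (K, false)) x)
    {p : Option V} (hp : ∀ w ∈ W, p ≠ some w) :
    ∃ M : Multiset (PortedPath V), M.card + W.card = 𝒦.card ∧ (∀ P ∈ M, P.Good G (· ∈ C)) ∧
      systemVerts M = C.val ∧ (∀ v, (systemPorts M).count (some v) ≤ 1) ∧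
      (∀ o ∈ systemPorts M, ∃ q, q.1 ∈ 𝒦 ∧ o = some (ψ q) ∧ ψ q ∉ W) ∧
      ((∃ q, q.1 ∈ 𝒦 ∧ p = some (ψ q)) → p ∈ systemPorts M) := by
  have hQ : ∀ K, ∃ Q : PortedPath V, K ∈ 𝒦 → Q.Good G (· ∈ K) ∧ (Q.core : Multiset V) = K.val ∧
      Q.left = some (ψ (K, true)) ∧ Q.right = some (ψ (K, false)) := by
    intro K
    by_cases hK : K ∈ 𝒦
    · obtain ⟨x, hx, hxt⟩ := ht K hK
      obtain ⟨Q, hQ⟩ := (h.ham K hK x hx).exists_good hxt (hf K hK)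
      exact ⟨Q, fun _ => hQ⟩
    · exact ⟨⟨none, [], none⟩, fun h => absurd h hK⟩
  choose f hQ using hQ
  have hports : ∀ K ∈ 𝒦, (f K).ports = {some (ψ (K, true)), some (ψ (K, false))} := by
    intro K hK
    rw [PortedPath.ports, (hQ K hK).2.2.1, (hQ K hK).2.2.2]
  have hmem : ∀ o, o ∈ systemPorts (𝒦.val.map f) ↔ ∃ q, q.1 ∈ 𝒦 ∧ o = some (ψ q) := by
    intro o
    rw [mem_systemPorts]
    constructor
    · rintro ⟨P, hP, ho⟩
      obtain ⟨K, hK, rfl⟩ := Multiset.mem_map.1 hP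
      rw [hports K hK] at ho
      simp only [Multiset.insert_eq_cons, Multiset.mem_cons, Multiset.mem_singleton] at ho
      rcases ho with rfl | rfl
      · exact ⟨(K, true), hK, rfl⟩
      · exact ⟨(K, false), hK, rfl⟩
    · rintro ⟨⟨K, b⟩, hK, rfl⟩
      refine ⟨f K, Multiset.mem_map_of_mem _ hK, ?_⟩
      rw [hports K hK]
      cases b <;> simp
  have hcount : ∀ v, (systemPorts (𝒦.val.map f)).count (some v) ≤ 1 := by
    intro v
    refine Multiset.nodup_iff_count_le_one.1 ?_ _
    rw [systemPorts, Multiset.bind_map, Multiset.nodup_bind]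
    constructor
    · intro K hK
      rw [hports K hK]
      suffices ψ (K, true) ≠ ψ (K, false) by simpa using this
      intro e
      simpa using hinj (K, true) (K, false) hK hK e
    · refine 𝒦.nodup.pairwise ?_
      intro K hK K' hK' hne
      simp only [Function.onFun]
      rw [hports K hK, hports K' hK', Multiset.disjoint_left]
      have key : ∀ b b', ψ (K, b) ≠ ψ (K', b') := fun b b' e =>
        hne (congrArg Prod.fst (hinj (K, b) (K', b') hK hK' e))
      simp [key]
  obtain ⟨M, h1, h2, h3, h4, h5, h6⟩ := h.realize f (fun K hK => ⟨(hQ K hK).1, (hQ K hK).2.1⟩)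
    hcount p hp
  refine ⟨M, h1, h2, h3, fun v => (Multiset.count_le_of_le _ h4).trans (hcount v), ?_, ?_⟩
  · intro o ho
    obtain ⟨q, hq, rfl⟩ := (hmem o).1 (Multiset.mem_of_le h4 ho)
    exact ⟨q, hq, rfl, fun hw => h5 _ hw ho⟩
  · exact fun hq => h6 ((hmem p).2 hq)

end JoinPackages

section PackageCases
open scoped Classical

variable {V ι : Type*} {G : SimpleGraph V} {S : Finset V} {D : ι → Finset V}

theorem PortedPath.Good.exists_insert {E : V → Prop} {P : PortedPath V} (h : P.Good G E) {a : V}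
    (h2 : 2 ≤ P.core.length) (ha : ∀ x ∈ P.core, G.Adj a x) : ∃ Q : PortedPath V, Q.Good G E ∧
      (Q.core : Multiset V) = a ::ₘ (P.core : Multiset V) ∧ Q.ports = P.ports := by
  obtain ⟨l, core, r⟩ := P
  match core, h2 with
  | x :: y :: L, _ =>
    obtain ⟨h1, h2, h3, h4⟩ := h
    refine ⟨⟨l, x :: a :: y :: L, r⟩, ⟨by simp, ?_, ?_, ?_⟩, ?_, rfl⟩
    · simp only [List.isChain_cons_cons] at h2 ⊢
      exact ⟨(ha x (by simp)).symm, ha y (by simp), h2.2⟩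
    · simpa using h3
    · simpa using h4
    · rw [Multiset.cons_coe]
      exact Multiset.coe_eq_coe.2 (List.Perm.swap _ _ _)

theorem exists_two_le_length {M : Multiset (PortedPath V)} {C : Finset V}
    (hv : systemVerts M = C.val) (hc : M.card < C.card) : ∃ P ∈ M, 2 ≤ P.core.length := by
  by_contra hcon
  push Not at hcon
  have h1 : C.card = (M.map fun P => P.core.length).sum := by
    rw [← Finset.card_val, ← hv, systemVerts, Multiset.card_bind]
    rfl
  have h2 : (M.map fun P => P.core.length).sum ≤ (M.map fun _ => 1).sum :=
    Multiset.sum_map_le_sum_map _ _ fun P hP => Nat.le_of_lt_succ (hcon P hP)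
  simp at h2
  omega

theorem CutSystem.closedFamily_joinLayout (C : CutSystem G S D) {i : ι} {A B W : Finset V}
    {𝒦 : Finset (Finset V)} (h : JoinLayout G (D i) A B W 𝒦) :
    ClosedFamily G (D i) (S ∪ (W ∪ A)) 𝒦 := by
  have hKD : ∀ K ∈ 𝒦, K ⊆ D i := fun K hK v hv => h.mem_iff.2 (Or.inr (Or.inr ⟨K, hK, hv⟩))
  refine ⟨h.layout.nonempty, hKD, ?_, ?_, h.layout.pairwiseDisjoint⟩
  · intro K hK
    rw [Finset.disjoint_left]
    intro x hx hx'
    simp only [Finset.mem_union] at hx'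
    rcases hx' with hx' | hx' | hx'
    · exact C.notMem (hKD K hK hx) hx'
    · exact Finset.disjoint_left.1 (h.layout.disjoint_piece hK) hx hx'
    · exact G.loopless.irrefl _ (h.joined x hx' x (h.layout.mem_iff.2 (Or.inr ⟨K, hK, hx⟩)))
  · intro K hK x hx y hxy
    have := C.adj_piece h hK hx hxy
    simp only [Finset.mem_union]
    tauto

/-- Joining up a system of paths through the vertices of `A₀` turns it into one with ports in `S`. -/
theorem exists_link_ports {E : V → Prop} {A₀ : Finset V} {N : Multiset (PortedPath V)} {s : V}
    (hsA : s ∉ A₀) (hlt : A₀.card + 1 ≤ N.card) (hg : ∀ P ∈ N, P.Good G E)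
    (hA : ∀ a ∈ A₀, ∀ x, E x → G.Adj a x) (hcount : ∀ v, (systemPorts N).count (some v) ≤ 1) :
    ∃ M : Multiset (PortedPath V), M.card + A₀.card = N.card ∧ (∀ P ∈ M, P.Good G E) ∧
      systemVerts M = A₀.val + systemVerts N ∧ systemPorts M ≤ systemPorts N ∧
      (∀ a ∈ A₀, some a ∉ systemPorts M) ∧ (some s ∈ systemPorts N → some s ∈ systemPorts M) := by
  obtain ⟨M, h1, h2, h3, h4, h5, h6⟩ := exists_link (E := E) (IsPortIn A₀) (p := some s)
    (by rintro ⟨a, ha, e⟩; cases e; exact hsA ha) 0 A₀ hlt hg hA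
    (countP_isPortIn_le_card fun a _ => hcount a)
  refine ⟨M, h1, h2, h3, h4, fun a ha hm => ?_, h6⟩
  exact Multiset.countP_eq_zero.1 (Nat.le_zero.1 h5) _ hm ⟨a, ha, rfl⟩

theorem CutSystem.exists_package_of_adj_piece (C : CutSystem G S D) {i : ι} {s x : V}
    (hs : s ∈ S) {A B W K₀ : Finset V} {𝒦 : Finset (Finset V)}
    (h : JoinLayout G (D i) A B W 𝒦) (hK₀ : K₀ ∈ 𝒦) (hx : x ∈ K₀) (hsx : G.Adj s x) :
    ∃ P cand, Package G S (D i) s P cand := by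
  have hAD : A ⊆ D i := fun v hv => h.mem_iff.2 (Or.inl hv)
  have hWD : W ⊆ D i := fun v hv => h.mem_iff.2 (Or.inr (Or.inl hv))
  have hBD : B ⊆ D i := fun v hv => (Finset.mem_iff_of_val_eq_add h.val).2 (Or.inr hv)
  have hcBW := h.card_lt
  have hle := h.card_le
  have h2 := h.two_le
  -- the set of linking vertices, together with the way to complete the spanning system
  obtain ⟨A₀, a, hA₀, hne, ha, hAa, hfin⟩ : ∃ (A₀ : Finset V) (a : V), A₀ ⊆ A ∧ A₀.Nonempty ∧
      a ∈ A ∧ A ⊆ insert a A₀ ∧ ∀ N : Multiset (PortedPath V), N.card + W.card = 𝒦.card →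
      (∀ P ∈ N, P.Good G (· ∈ B)) → systemVerts N = B.val →
      (∀ v, (systemPorts N).count (some v) ≤ 1) →
      ∃ M : Multiset (PortedPath V), (∀ P ∈ M, P.Good G (· ∈ B)) ∧ systemVerts M = (D i).val ∧
        systemPorts M ≤ systemPorts N ∧ (∀ a ∈ A₀, some a ∉ systemPorts M) ∧
        (some s ∈ systemPorts N → some s ∈ systemPorts M) ∧
        8 * M.card + 2 * (W.card + A.card) ≤ 9 * 𝒦.card := by
    by_cases hlt : W.card + A.card + 1 ≤ 𝒦.card
    · obtain ⟨a, ha⟩ := h.nonempty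
      refine ⟨A, a, le_rfl, h.nonempty, ha, Finset.subset_insert _ _, ?_⟩
      intro N hc hg hv hcount
      obtain ⟨M, h1, h2, h3, h4, h5, h6⟩ := exists_link_ports (s := s)
        (fun h => C.notMem (hAD h) hs) (by omega) hg h.joined hcount
      exact ⟨M, h2, by rw [h3, hv, h.val], h4, h5, h6, by omega⟩
    · obtain ⟨a, ha⟩ := h.nonempty
      have hce := Finset.card_erase_of_mem ha
      refine ⟨A.erase a, a, Finset.erase_subset _ _, Finset.card_pos.1 (by omega), ha,
        by rw [Finset.insert_erase ha], ?_⟩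
      intro N hc hg hv hcount
      obtain ⟨Q, hQ, hQ2⟩ := exists_two_le_length hv (by omega)
      obtain ⟨N, rfl⟩ := Multiset.exists_cons_of_mem hQ
      have hQB : ∀ y ∈ Q.core, y ∈ B := by
        intro y hy
        rw [← Finset.mem_val, ← hv, systemVerts_cons, Multiset.mem_add]
        exact Or.inl (Multiset.mem_coe.2 hy)
      obtain ⟨Q', hQ', hv', hp'⟩ := (hg Q hQ).exists_insert hQ2
        fun y hy => h.joined a ha y (hQB y hy)
      have hports : systemPorts (Q' ::ₘ N) = systemPorts (Q ::ₘ N) := by simp [hp']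
      obtain ⟨M, h1, h2, h3, h4, h5, h6⟩ := exists_link_ports (s := s) (A₀ := A.erase a)
        (N := Q' ::ₘ N) (E := (· ∈ B)) (fun h => C.notMem (hAD (Finset.mem_of_mem_erase h)) hs)
        (by simp at hc ⊢; omega)
        (by
          intro P hP
          rcases Multiset.mem_cons.1 hP with rfl | hP
          · exact hQ'
          · exact hg P (Multiset.mem_cons_of_mem hP))
        (fun y hy => h.joined y (Finset.mem_of_mem_erase hy)) (by rwa [hports])
      rw [hports] at h4 h6
      refine ⟨M, h2, ?_, h4, h5, h6, by simp at hc h1; omega⟩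
      rw [h3, h.val, ← hv, systemVerts_cons, systemVerts_cons, hv', Multiset.cons_add,
        Multiset.add_cons, ← Multiset.cons_add, Finset.erase_val, Multiset.cons_erase ha]
  refine ⟨(𝒦 ×ˢ Finset.univ).erase (K₀, true), pieceCand G (S.erase s ∪ W ∪ A₀), ?_, ?_, ?_⟩
  · intro q _ t ht
    have := pieceCand_subset ht
    simp only [Finset.mem_union] at this ⊢
    rcases this with (h | h) | h
    · exact Or.inl h
    · exact Or.inr (hWD h)
    · exact Or.inr (hAD (hA₀ h))
  · intro X hX hXne
    refine C.joinLayout_hall hs h hA₀ hne ha hAa (fun q hq => ?_) hX hXne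
    simpa using (Finset.mem_product.1 (Finset.mem_of_mem_erase hq)).1
  · intro φ hφ hφi
    let ψ : Finset V × Bool → V := fun q => if q = (K₀, true) then s else φ q
    have hmemP : ∀ q, q.1 ∈ 𝒦 → q ≠ (K₀, true) →
        q ∈ (𝒦 ×ˢ (Finset.univ : Finset Bool)).erase (K₀, true) := by
      intro q hq hq'
      simp [hq, hq']
    have hψ : ∀ q, q.1 ∈ 𝒦 → q ≠ (K₀, true) →
        ψ q = φ q ∧ ψ q ∈ pieceCand G (S.erase s ∪ W ∪ A₀) q := by
      intro q hq hq'
      have e : ψ q = φ q := if_neg hq'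
      exact ⟨e, e ▸ hφ q (hmemP q hq hq')⟩
    have hψs : ψ (K₀, true) = s := if_pos rfl
    have hψT : ∀ q, q.1 ∈ 𝒦 → q ≠ (K₀, true) → (ψ q ∈ S ∧ ψ q ≠ s) ∨ ψ q ∈ W ∨ ψ q ∈ A₀ := by
      intro q hq hq'
      have := pieceCand_subset (hψ q hq hq').2
      simp only [Finset.mem_union, Finset.mem_erase] at this
      tauto
    have hψne : ∀ q, q.1 ∈ 𝒦 → q ≠ (K₀, true) → ψ q ≠ s := by
      intro q hq hq' e
      rcases hψT q hq hq' with h | h | h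
      · exact h.2 e
      · exact C.notMem (hWD h) (e ▸ hs)
      · exact C.notMem (hAD (hA₀ h)) (e ▸ hs)
    obtain ⟨N, hc, hg, hv, hcount, hpN, hkeep⟩ := h.layout.exists_system (ψ := ψ)
      (by
        intro q q' hq hq' e
        by_cases h1 : q = (K₀, true)
        · by_cases h2 : q' = (K₀, true)
          · rw [h1, h2]
          · rw [h1, hψs] at e
            exact absurd e.symm (hψne q' hq' h2)
        · by_cases h2 : q' = (K₀, true)
          · rw [h2, hψs] at e
            exact absurd e (hψne q hq h1)
          · rw [(hψ q hq h1).1, (hψ q' hq' h2).1] at e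
            exact hφi (hmemP q hq h1) (hmemP q' hq' h2) e)
      (by
        intro K hK
        by_cases hKK : (K, true) = (K₀, true)
        · obtain rfl : K = K₀ := by simpa using hKK
          rw [hψs]
          exact ⟨x, hx, hsx⟩
        · exact (mem_pieceCand_true.1 (hψ (K, true) hK hKK).2).2)
      (fun K hK => (mem_pieceCand_false.1 (hψ (K, false) hK (by simp)).2).2)
      (p := some s) (by rintro w hw e; cases e; exact C.notMem (hWD hw) hs)
    obtain ⟨M, hgM, hvM, hpM, hA₀M, hsM, hcM⟩ := hfin N hc hg hv hcount
    have hport : ∀ o ∈ systemPorts M, ∃ q, q.1 ∈ 𝒦 ∧ o = some (ψ q) ∧ ψ q ∉ W ∧ ψ q ∉ A₀ := by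
      intro o ho
      obtain ⟨q, hq, rfl, hqW⟩ := hpN o (Multiset.mem_of_le hpM ho)
      exact ⟨q, hq, rfl, hqW, fun hq => hA₀M _ hq ho⟩
    refine ⟨M, fun Q hQ => (hgM Q hQ).mono fun _ hy => hBD hy, hvM, ?_,
      fun v => (Multiset.count_le_of_le _ hpM).trans (hcount v), ?_,
      hsM (hkeep ⟨_, hK₀, by rw [hψs]⟩), 𝒦, W ∪ A, Finset.union_subset hWD hAD,
      C.closedFamily_joinLayout h, ⟨K₀, hK₀⟩, ?_⟩
    · intro o ho
      obtain ⟨q, hq, rfl, hqW, hqA⟩ := hport o ho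
      by_cases hq' : q = (K₀, true)
      · exact ⟨s, hs, by rw [hq', hψs]⟩
      · rcases hψT q hq hq' with h | h | h
        · exact ⟨_, h.1, rfl⟩
        · exact absurd h hqW
        · exact absurd h hqA
    · intro o ho
      obtain ⟨q, hq, rfl, -⟩ := hport o ho
      by_cases hq' : q = (K₀, true)
      · exact Or.inl (by rw [hq', hψs])
      · exact Or.inr ⟨q, hmemP q hq hq', by rw [(hψ q hq hq').1]⟩
    · have := Finset.card_union_le W A
      omega

end PackageCases

section PackageExistence
open scoped Classical

variable {V ι : Type*} {G : SimpleGraph V} {S : Finset V} {D : ι → Finset V}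

theorem PortedPath.Good.append {E E' : V → Prop} {P : PortedPath V} (h : P.Good G E)
    (hE : ∀ x, E x → E' x) {a s : V} (ha : ∀ x, E x → G.Adj a x) (haE : E' a) (hs : G.Adj s a) :
    (⟨P.left, P.core ++ [a], some s⟩ : PortedPath V).Good G E' where
  ne_nil := by simp
  chain := by
    rw [List.isChain_append]
    refine ⟨h.chain, by simp, fun x hx y hy => ?_⟩
    obtain rfl : a = y := by simpa using hy
    exact (ha x (h.last x hx).1).symm
  head := by
    intro x hx
    obtain ⟨y, L, e⟩ := List.exists_cons_of_ne_nil h.ne_nil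
    have := h.head x (by simpa [e] using hx)
    exact ⟨hE x this.1, this.2⟩
  last := by
    intro x hx
    obtain rfl : a = x := by simpa using hx
    refine ⟨haE, ?_⟩
    rintro _ ⟨rfl⟩
    exact hs

/-- In a system with at most one port in `A`, some port can be replaced by `s`. -/
theorem exists_replace_port {B C A : Finset V} (hBC : B ⊆ C) {M : Multiset (PortedPath V)}
    {a s : V} (ha : ∀ x ∈ B, G.Adj a x) (haC : a ∈ C) (hsa : G.Adj s a) (hM : 0 < M.card)
    (hg : ∀ P ∈ M, P.Good G (· ∈ B)) (hb : (systemPorts M).countP (IsPortIn A) ≤ 1) :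
    ∃ (M' : Multiset (PortedPath V)) (m : Multiset (Option V)), M'.card = M.card ∧
      (∀ P ∈ M', P.Good G (· ∈ C)) ∧ systemVerts M' = a ::ₘ systemVerts M ∧
      systemPorts M' = some s ::ₘ m ∧ m ≤ systemPorts M ∧ ∀ o ∈ m, ¬ IsPortIn A o := by
  obtain ⟨P, hP, o, ho, hoA⟩ : ∃ P ∈ M, ∃ o ∈ P.ports, IsPortIn A o ∨
      ∀ o ∈ systemPorts M, ¬ IsPortIn A o := by
    by_cases h : ∃ P ∈ M, ∃ o ∈ P.ports, IsPortIn A o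
    · obtain ⟨P, hP, o, ho, h⟩ := h
      exact ⟨P, hP, o, ho, Or.inl h⟩
    · obtain ⟨P, hP⟩ := Multiset.card_pos_iff_exists_mem.1 hM
      refine ⟨P, hP, P.left, PortedPath.mem_ports.2 (Or.inl rfl), Or.inr fun o ho hoA => ?_⟩
      obtain ⟨P, hP, ho⟩ := mem_systemPorts.1 ho
      exact h ⟨P, hP, o, ho, hoA⟩
  obtain ⟨R, rfl⟩ := Multiset.exists_cons_of_mem hP
  obtain ⟨Q, hQ, hQv, hQp, hQo⟩ := (hg P hP).exists_right o
  have hports : systemPorts (P ::ₘ R) = o ::ₘ Q.left ::ₘ systemPorts R := by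
    rw [systemPorts_cons, ← hQp, PortedPath.ports, hQo ho, Multiset.pair_comm]
    simp [Multiset.insert_eq_cons]
  refine ⟨⟨Q.left, Q.core ++ [a], some s⟩ ::ₘ R, Q.left ::ₘ systemPorts R, by simp, ?_, ?_, ?_, ?_,
    ?_⟩
  · intro T hT
    rcases Multiset.mem_cons.1 hT with rfl | hT
    · exact hQ.append (fun _ h => hBC h) ha haC hsa
    · exact (hg T (Multiset.mem_cons_of_mem hT)).mono fun _ h => hBC h
  · rw [systemVerts_cons, systemVerts_cons, ← hQv, ← Multiset.cons_add]
    congr 1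
    exact Multiset.coe_eq_coe.2 (List.perm_append_singleton _ _)
  · rw [systemPorts_cons, PortedPath.ports, Multiset.pair_comm]
    simp [Multiset.insert_eq_cons]
  · rw [hports]
    exact Multiset.le_cons_self _ _
  · intro o' ho' hoA'
    rcases hoA with hoA | hoA
    · rw [hports, Multiset.countP_cons_of_pos _ hoA] at hb
      exact Multiset.countP_eq_zero.1 (by omega : Multiset.countP (IsPortIn A) _ = 0) o' ho' hoA'
    · refine hoA o' ?_ hoA'
      rw [hports]
      exact Multiset.mem_cons_of_mem ho'

theorem CutSystem.exists_package_of_adj_joined (C : CutSystem G S D) {i : ι} {s a : V}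
    (hs : s ∈ S) {A B W : Finset V} {𝒦 : Finset (Finset V)}
    (h : JoinLayout G (D i) A B W 𝒦) (ha : a ∈ A) (hsa : G.Adj s a) :
    ∃ P cand, Package G S (D i) s P cand := by
  have hAD : A ⊆ D i := fun v hv => h.mem_iff.2 (Or.inl hv)
  have hWD : W ⊆ D i := fun v hv => h.mem_iff.2 (Or.inr (Or.inl hv))
  have hBD : B ⊆ D i := fun v hv => (Finset.mem_iff_of_val_eq_add h.val).2 (Or.inr hv)
  have hle := h.card_le
  have h2 := h.two_le
  have hA0 := h.nonempty.card_pos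
  refine ⟨𝒦 ×ˢ Finset.univ, pieceCand G (S.erase s ∪ W ∪ A), ?_, ?_, ?_⟩
  · intro q _ t ht
    have := pieceCand_subset ht
    simp only [Finset.mem_union] at this ⊢
    rcases this with (h | h) | h
    · exact Or.inl h
    · exact Or.inr (hWD h)
    · exact Or.inr (hAD h)
  · intro X hX hXne
    exact C.joinLayout_hall hs h le_rfl h.nonempty ha (Finset.subset_insert _ _)
      (fun q hq => (Finset.mem_product.1 hq).1) hX hXne
  · intro φ hφ hφi
    have hmemP : ∀ q : Finset V × Bool, q.1 ∈ 𝒦 → q ∈ 𝒦 ×ˢ (Finset.univ : Finset Bool) := by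
      intro q hq
      simp [hq]
    have hφT : ∀ q, q.1 ∈ 𝒦 → (φ q ∈ S ∧ φ q ≠ s) ∨ φ q ∈ W ∨ φ q ∈ A := by
      intro q hq
      have := pieceCand_subset (hφ q (hmemP q hq))
      simp only [Finset.mem_union, Finset.mem_erase] at this
      tauto
    obtain ⟨N, hc, hg, hv, hcount, hpN, -⟩ := h.layout.exists_system (ψ := φ)
      (fun q q' hq hq' e => hφi (hmemP q hq) (hmemP q' hq') e)
      (fun K hK => (mem_pieceCand_true.1 (hφ (K, true) (hmemP _ hK))).2)
      (fun K hK => (mem_pieceCand_false.1 (hφ (K, false) (hmemP _ hK))).2)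
      (p := none) (by simp)
    have hce := Finset.card_erase_of_mem ha
    obtain ⟨M, h1, h2', h3, h4, h5, -⟩ := exists_link (IsPortIn A) (p := none)
      (by rintro ⟨_, _, e⟩; cases e) 1 (A.erase a) (by omega) hg
      (fun y hy => h.joined y (Finset.mem_of_mem_erase hy))
      ((countP_isPortIn_le_card fun a _ => hcount a).trans (by omega))
    obtain ⟨M', m, k1, k2, k3, k4, k5, k6⟩ := exists_replace_port hBD (h.joined a ha) (hAD ha) hsa
      (by omega) h2' h5
    have hport : ∀ o ∈ m, ∃ q, q.1 ∈ 𝒦 ∧ o = some (φ q) ∧ φ q ∈ S ∧ φ q ≠ s := by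
      intro o ho
      obtain ⟨q, hq, rfl, hqW⟩ := hpN o (Multiset.mem_of_le (k5.trans h4) ho)
      refine ⟨q, hq, rfl, ?_⟩
      rcases hφT q hq with h | h | h
      · exact h
      · exact absurd h hqW
      · exact absurd ⟨_, h, rfl⟩ (k6 _ ho)
    refine ⟨M', k2, ?_, ?_, ?_, ?_, by simp [k4], 𝒦, W ∪ A, Finset.union_subset hWD hAD,
      C.closedFamily_joinLayout h, Finset.card_pos.1 (by omega), ?_⟩
    · rw [k3, h3, h.val, hv, ← Multiset.cons_add, Finset.erase_val, Multiset.cons_erase ha]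
    · intro o ho
      rw [k4, Multiset.mem_cons] at ho
      rcases ho with rfl | ho
      · exact ⟨s, hs, rfl⟩
      · obtain ⟨q, -, rfl, h, -⟩ := hport o ho
        exact ⟨_, h, rfl⟩
    · intro v
      rw [k4, Multiset.count_cons]
      split_ifs with e
      · cases e
        rw [Multiset.count_eq_zero_of_notMem]
        intro hm
        obtain ⟨q, -, e, -, h⟩ := hport _ hm
        cases e
        exact h rfl
      · exact (Multiset.count_le_of_le _ (k5.trans h4)).trans (hcount v)
    · intro o ho
      rw [k4, Multiset.mem_cons] at ho
      rcases ho with rfl | ho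
      · exact Or.inl rfl
      · obtain ⟨q, hq, rfl, -⟩ := hport o ho
        exact Or.inr ⟨q, hmemP q hq, rfl⟩
    · have := Finset.card_union_le W A
      omega

theorem CutSystem.exists_package_of_joinLayout (C : CutSystem G S D) {i : ι} {s : V}
    (hs : s ∈ S) {A B W : Finset V} {𝒦 : Finset (Finset V)} (h : JoinLayout G (D i) A B W 𝒦) :
    ∃ P cand, Package G S (D i) s P cand := by
  have hKD : ∀ K ∈ 𝒦, K ⊆ D i := fun K hK v hv => h.mem_iff.2 (Or.inr (Or.inr ⟨K, hK, hv⟩))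
  by_cases hcase : (∃ K ∈ 𝒦, ∃ x ∈ K, G.Adj s x) ∨ ∃ a ∈ A, G.Adj s a
  · rcases hcase with ⟨K, hK, x, hx, hsx⟩ | ⟨a, ha, hsa⟩
    · exact C.exists_package_of_adj_piece hs h hK hx hsx
    · exact C.exists_package_of_adj_joined hs h ha hsa
  push Not at hcase
  exfalso
  obtain ⟨w, hw, hsw⟩ := C.nbr s hs i
  obtain ⟨j, hj⟩ := C.two i
  obtain ⟨x, hx, hsx⟩ := C.nbr s hs j
  rcases h.mem_iff.1 hw with hwA | hwW | ⟨K, hK, hwK⟩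
  · exact hcase.2 w hwA hsw
  · obtain ⟨K, hK, hwK⟩ := h.layout.attach w hwW
    obtain ⟨K', hK', hwK'⟩ := h.detach w hwW
    obtain ⟨k, hk⟩ := h.layout.nonempty K hK
    obtain ⟨z, hz⟩ := h.layout.nonempty K' hK'
    have hne : K ≠ K' := by
      rintro rfl
      exact hwK' k hk (hwK k hk)
    exact C.noPathPoint x s w k z hsx.symm hsw (hwK k hk) (C.not_adj hx hw hj)
      (hcase.1 K hK k hk) (C.not_adj hx (hKD K hK hk) hj)
      (C.not_adj (hKD K' hK' hz) hx hj.symm) (fun h => hcase.1 K' hK' z hz h.symm)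
      (fun h => hwK' z hz h.symm) (fun e => h.layout.apart K hK K' hK' hne k hk z hz e.symm)
  · exact hcase.1 K hK w hwK hsw

theorem CutSystem.noPathOn (C : CutSystem G S D) (i : ι) : NoPathOn G (D i) := by
  intro a ha b hb c hc d hd hab hbc hcd hac hbd had
  obtain ⟨j, hj⟩ := C.two i
  obtain ⟨z, hz⟩ := C.nonempty j
  exact C.noPathPoint a b c d z hab hbc hcd hac hbd had (C.not_adj hz ha hj) (C.not_adj hz hb hj)
    (C.not_adj hz hc hj) (C.not_adj hz hd hj)

theorem CutSystem.exists_package [Fintype V] (C : CutSystem G S D) {s : V} (hs : s ∈ S) (i : ι) :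
    ∃ P cand, Package G S (D i) s P cand := by
  have hconn : ∀ X Y, (D i).val = X.val + Y.val → X.Nonempty → Y.Nonempty → ¬ Apart G X Y := by
    intro X Y hD hX hY ha
    have hm := @Finset.mem_iff_of_val_eq_add _ _ _ _ hD
    have hd := Finset.disjoint_of_val_eq_add hD
    obtain ⟨x, hx, y, hy, hxy⟩ := C.conn i X (fun v hv => hm.2 (Or.inl hv)) hX (by
      rintro rfl
      obtain ⟨y, hy⟩ := hY
      exact Finset.disjoint_left.1 hd (hm.2 (Or.inr hy)) hy)
    rw [Finset.mem_sdiff] at hy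
    rcases hm.1 hy.1 with h | h
    · exact hy.2 h
    · exact ha x hx y h hxy
  rcases (C.noPathOn i).exists_structure (C.nonempty i) hconn with h | h | h | h
  · refine C.exists_package_of_hamPath hs fun x hx y hy hxy => absurd ?_ hxy
    exact Finset.card_le_one.1 h.le x hx y hy
  · obtain ⟨A, B, hAB, hj, hc⟩ := h
    obtain ⟨x, hx, hsx⟩ := C.nbr s hs i
    rcases (Finset.mem_iff_of_val_eq_add hAB).1 hx with hxA | hxB
    · exact C.exists_package_of_balanced hs hAB hj hc hxA hsx
    · exact C.exists_package_of_balanced hs (val_eq_add_comm hAB) hj.symm hc.symm hxB hsx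
  · exact C.exists_package_of_hamPath hs h
  · obtain ⟨A, B, W, 𝒦, h⟩ := h
    exact C.exists_package_of_joinLayout hs h

end PackageExistence

section JointHall
open scoped Classical

variable {V ι : Type*} {G : SimpleGraph V} {S : Finset V} {D : ι → Finset V}

theorem CutSystem.card_biUnion_le (C : CutSystem G S D) {I : Finset ι} {T : ι → Finset V}
    {F : ι → Finset (Finset V)} (hF : ∀ i ∈ I, ClosedFamily G (D i) (T i) (F i))
    (hT : ∀ i ∈ I, T i ⊆ S ∪ D i) (h2 : 2 ≤ ∑ i ∈ I, (F i).card) :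
    9 * ∑ i ∈ I, (F i).card ≤ 2 * (I.biUnion T).card := by
  have hdis : ∀ i ∈ I, ∀ j ∈ I, i ≠ j → ∀ K ∈ F i, ∀ K' ∈ F j, Disjoint K K' := by
    intro i hi j hj hij K hK K' hK'
    rw [Finset.disjoint_left]
    intro x hx hx'
    exact hij (C.mem_unique ((hF i hi).subset K hK hx) ((hF j hj).subset K' hK' hx'))
  have hcard : (I.biUnion F).card = ∑ i ∈ I, (F i).card := by
    refine Finset.card_biUnion fun i hi j hj hij => Finset.disjoint_left.2 fun K hK hK' => ?_
    obtain ⟨x, hx⟩ := (hF i hi).nonempty K hK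
    exact Finset.disjoint_left.1 (hdis i hi j hj hij K hK K hK') hx hx
  rw [← hcard] at h2 ⊢
  refine C.tough.card_le (C := I.biUnion D) (T := I.biUnion T) (F := I.biUnion F)
    ⟨?_, ?_, ?_, ?_, ?_⟩ h2
  · intro K hK
    obtain ⟨i, hi, hK⟩ := Finset.mem_biUnion.1 hK
    exact (hF i hi).nonempty K hK
  · intro K hK
    obtain ⟨i, hi, hK⟩ := Finset.mem_biUnion.1 hK
    exact ((hF i hi).subset K hK).trans (Finset.subset_biUnion_of_mem D hi)
  · intro K hK
    obtain ⟨i, hi, hK⟩ := Finset.mem_biUnion.1 hK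
    rw [Finset.disjoint_left]
    intro x hx hxT
    obtain ⟨j, hj, hxT⟩ := Finset.mem_biUnion.1 hxT
    have hxi := (hF i hi).subset K hK hx
    by_cases hij : i = j
    · subst hij
      exact Finset.disjoint_left.1 ((hF i hi).disjoint K hK) hx hxT
    · rcases Finset.mem_union.1 (hT j hj hxT) with h | h
      · exact C.notMem hxi h
      · exact hij (C.mem_unique hxi h)
  · intro K hK x hx y hxy
    obtain ⟨i, hi, hK⟩ := Finset.mem_biUnion.1 hK
    exact ((hF i hi).closed K hK x hx y hxy).imp_right
      fun h => Finset.mem_biUnion.2 ⟨i, hi, h⟩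
  · intro K hK K' hK' hne
    obtain ⟨i, hi, hK⟩ := Finset.mem_biUnion.1 (Finset.mem_coe.1 hK)
    obtain ⟨j, hj, hK'⟩ := Finset.mem_biUnion.1 (Finset.mem_coe.1 hK')
    by_cases hij : i = j
    · subst hij
      exact (hF i hi).pairwise hK hK' hne
    · exact hdis i hi j hj hij K hK K' hK'

theorem Package.biUnion_subset {C : Finset V} {s : V} {P X : Finset (Finset V × Bool)}
    {cand : Finset V × Bool → Finset V} (h : Package G S C s P cand) (hX : X ⊆ P) :
    X.biUnion cand ⊆ S.erase s ∪ C :=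
  Finset.biUnion_subset.2 fun p hp => h.cand_subset p (hX hp)

theorem Package.insert_subset {C : Finset V} {s a : V} {P X : Finset (Finset V × Bool)}
    {cand : Finset V × Bool → Finset V} (h : Package G S C s P cand) (hX : X ⊆ P) (hs : s ∈ S)
    (ha : a ∈ C) : insert s (insert a (X.biUnion cand)) ⊆ S ∪ C := by
  intro v hv
  rw [Finset.mem_insert, Finset.mem_insert] at hv
  rw [Finset.mem_union]
  rcases hv with rfl | rfl | hv
  · exact Or.inl hs
  · exact Or.inr ha
  · rcases Finset.mem_union.1 (h.biUnion_subset hX hv) with h | h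
    · exact Or.inl (Finset.mem_of_mem_erase h)
    · exact Or.inr h

theorem CutSystem.card_lt_of_closedFamily [Fintype V] (C : CutSystem G S D) {i : ι} {s a : V}
    (hs : s ∈ S) {P X : Finset (Finset V × Bool)} {cand : Finset V × Bool → Finset V}
    (h : Package G S (D i) s P cand) (hX : X ⊆ P) {J : Finset (Finset V)} (ha : a ∈ D i)
    (hJ : J.Nonempty) (hXJ : X.card ≤ 2 * J.card)
    (hF : ClosedFamily G (D i) (insert s (insert a (X.biUnion cand))) J) :
    X.card + 1 ≤ (X.biUnion cand).card := by
  obtain ⟨h1, h2⟩ := C.nine_le hF hJ (h.insert_subset hX hs ha)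
  have k1 := Finset.card_insert_le s (insert a (X.biUnion cand))
  have k2 := Finset.card_insert_le a (X.biUnion cand)
  omega

theorem CutSystem.package_card_le [Fintype V] (C : CutSystem G S D) {i : ι} {s : V}
    (hs : s ∈ S) {P X : Finset (Finset V × Bool)} {cand : Finset V × Bool → Finset V}
    (h : Package G S (D i) s P cand) (hX : X ⊆ P) : X.card ≤ (X.biUnion cand).card := by
  rcases X.eq_empty_or_nonempty with rfl | hne
  · simp
  rcases h.hall X hX hne with ⟨h1, h2⟩ | ⟨J, a, ha, hJ, hXJ, hF⟩
  · rw [h1, Nat.one_le_iff_ne_zero, ← Nat.pos_iff_ne_zero, Finset.card_pos]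
    rcases h2 with ⟨w, hw, -⟩ | h2
    · exact ⟨w, hw⟩
    · exact (Finset.card_pos.1 (by omega : 0 < (X.biUnion cand ∩ S).card)).mono
        Finset.inter_subset_left
  · exact (Nat.le_succ _).trans (C.card_lt_of_closedFamily hs h hX ha hJ hXJ hF)

theorem CutSystem.two_packages_card_le [Fintype V] (C : CutSystem G S D) {i j : ι} (hij : i ≠ j)
    {s : V} (hs : s ∈ S) {P Q X Y : Finset (Finset V × Bool)}
    {cand cand' : Finset V × Bool → Finset V} (hP : Package G S (D i) s P cand)
    (hQ : Package G S (D j) s Q cand') (hX : X ⊆ P) (hY : Y ⊆ Q) :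
    X.card + Y.card ≤ (X.biUnion cand ∪ Y.biUnion cand').card := by
  have hX' := C.package_card_le hs hP hX
  have hY' := C.package_card_le hs hQ hY
  have hl : (X.biUnion cand).card ≤ (X.biUnion cand ∪ Y.biUnion cand').card :=
    Finset.card_le_card Finset.subset_union_left
  have hr : (Y.biUnion cand').card ≤ (X.biUnion cand ∪ Y.biUnion cand').card :=
    Finset.card_le_card Finset.subset_union_right
  rcases X.eq_empty_or_nonempty with rfl | hXne
  · simp at hr ⊢; omega
  rcases Y.eq_empty_or_nonempty with rfl | hYne
  · simp at hl ⊢; omega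
  rcases hP.hall X hX hXne with ⟨hX1, hX2⟩ | ⟨J, a, ha, hJ, hXJ, hF⟩ <;>
    rcases hQ.hall Y hY hYne with ⟨hY1, hY2⟩ | ⟨J', a', ha', hJ', hYJ, hF'⟩
  · rcases hX2 with ⟨w, hw, hwD⟩ | hX2
    · rcases hY2 with ⟨w', hw', hwD'⟩ | hY2
      · have hne : w ≠ w' := by
          rintro rfl
          exact hij (C.mem_unique hwD hwD')
        rw [hX1, hY1, one_add_one_eq_two, ← Finset.card_pair hne]
        refine Finset.card_le_card ?_
        rw [Finset.insert_subset_iff, Finset.singleton_subset_iff]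
        exact ⟨Finset.mem_union_left _ hw, Finset.mem_union_right _ hw'⟩
      · have := Finset.card_le_card (Finset.inter_subset_left (s₁ := Y.biUnion cand') (s₂ := S))
        omega
    · have := Finset.card_le_card (Finset.inter_subset_left (s₁ := X.biUnion cand) (s₂ := S))
      omega
  · have := C.card_lt_of_closedFamily hs hQ hY ha' hJ' hYJ hF'
    omega
  · have := C.card_lt_of_closedFamily hs hP hX ha hJ hXJ hF
    omega
  · have hJ0 := hJ.card_pos
    have hJ0' := hJ'.card_pos
    have hsum : ∀ f : ι → ℕ, ∑ k ∈ {i, j}, f k = f i + f j := fun f => Finset.sum_pair hij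
    have key := C.card_biUnion_le (I := {i, j})
      (T := fun k => if k = i then insert s (insert a (X.biUnion cand)) else
        insert s (insert a' (Y.biUnion cand')))
      (F := fun k => if k = i then J else J')
      (by
        intro k hk
        rcases Finset.mem_insert.1 hk with rfl | hk
        · simpa using hF
        · obtain rfl := Finset.mem_singleton.1 hk
          simpa [hij.symm] using hF')
      (by
        intro k hk
        rcases Finset.mem_insert.1 hk with rfl | hk
        · simpa only [if_true] using hP.insert_subset hX hs ha
        · obtain rfl := Finset.mem_singleton.1 hk
          simpa only [hij.symm, if_false] using hQ.insert_subset hY hs ha')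
      (by rw [hsum]; simp [hij.symm]; omega)
    rw [hsum] at key
    simp only [if_true, hij.symm, if_false] at key
    have hsub : ({i, j} : Finset ι).biUnion (fun k => if k = i then
        insert s (insert a (X.biUnion cand)) else insert s (insert a' (Y.biUnion cand'))) ⊆
        insert s (insert a (insert a' (X.biUnion cand ∪ Y.biUnion cand'))) := by
      rw [Finset.biUnion_insert, Finset.singleton_biUnion]
      simp only [if_true, hij.symm, if_false]
      intro v hv
      rw [Finset.mem_union, Finset.mem_insert, Finset.mem_insert, Finset.mem_insert,
        Finset.mem_insert] at hv
      rw [Finset.mem_insert, Finset.mem_insert, Finset.mem_insert, Finset.mem_union]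
      tauto
    have k0 := Finset.card_le_card hsub
    have k1 := Finset.card_insert_le s (insert a (insert a' (X.biUnion cand ∪ Y.biUnion cand')))
    have k2 := Finset.card_insert_le a (insert a' (X.biUnion cand ∪ Y.biUnion cand'))
    have k3 := Finset.card_insert_le a' (X.biUnion cand ∪ Y.biUnion cand')
    omega

theorem CutSystem.exists_representatives [Fintype V] (C : CutSystem G S D) {i j : ι} (hij : i ≠ j)
    {s : V} (hs : s ∈ S) {P Q : Finset (Finset V × Bool)} {cand cand' : Finset V × Bool → Finset V}
    (hP : Package G S (D i) s P cand) (hQ : Package G S (D j) s Q cand') :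
    ∃ φ φ' : Finset V × Bool → V, (∀ p ∈ P, φ p ∈ cand p) ∧ Set.InjOn φ P ∧
      (∀ q ∈ Q, φ' q ∈ cand' q) ∧ Set.InjOn φ' Q ∧ ∀ p ∈ P, ∀ q ∈ Q, φ p ≠ φ' q := by
  obtain ⟨f, hf, hft⟩ := (Finset.all_card_le_biUnion_card_iff_exists_injective
    (Sum.elim (fun p : P => cand p) (fun q : Q => cand' q))).1 (by
      intro Z
      have key := C.two_packages_card_le hij hs hP hQ (X := Z.toLeft.map (Function.Embedding.subtype _))
        (Y := Z.toRight.map (Function.Embedding.subtype _)) (by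
          intro p hp
          obtain ⟨p, -, rfl⟩ := Finset.mem_map.1 hp
          exact p.2) (by
          intro p hp
          obtain ⟨p, -, rfl⟩ := Finset.mem_map.1 hp
          exact p.2)
      rw [Finset.card_map, Finset.card_map, Finset.card_toLeft_add_card_toRight] at key
      refine key.trans (Finset.card_le_card ?_)
      intro v hv
      rw [Finset.mem_union, Finset.mem_biUnion, Finset.mem_biUnion] at hv
      rw [Finset.mem_biUnion]
      rcases hv with ⟨p, hp, hv⟩ | ⟨p, hp, hv⟩
      · obtain ⟨p, hpZ, rfl⟩ := Finset.mem_map.1 hp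
        exact ⟨Sum.inl p, Finset.mem_toLeft.1 hpZ, hv⟩
      · obtain ⟨p, hpZ, rfl⟩ := Finset.mem_map.1 hp
        exact ⟨Sum.inr p, Finset.mem_toRight.1 hpZ, hv⟩)
  refine ⟨fun p => if hp : p ∈ P then f (Sum.inl ⟨p, hp⟩) else s,
    fun q => if hq : q ∈ Q then f (Sum.inr ⟨q, hq⟩) else s, ?_, ?_, ?_, ?_, ?_⟩
  · intro p hp
    simp only [dif_pos hp]
    exact hft (Sum.inl ⟨p, hp⟩)
  · intro p hp q hq e
    have hp := Finset.mem_coe.1 hp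
    have hq := Finset.mem_coe.1 hq
    simp only [hp, hq, dif_pos] at e
    simpa using hf e
  · intro q hq
    simp only [dif_pos hq]
    exact hft (Sum.inr ⟨q, hq⟩)
  · intro p hp q hq e
    have hp := Finset.mem_coe.1 hp
    have hq := Finset.mem_coe.1 hq
    simp only [hp, hq, dif_pos] at e
    simpa using hf e
  · intro p hp q hq e
    simp only [hp, hq, dif_pos] at e
    simpa using hf e

end JointHall

section FragmentSystems
open scoped Classical

variable {V ι : Type*} {G : SimpleGraph V} {S : Finset V} {D : ι → Finset V}

/-- The multiset of vertices of a multiset of lists. -/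
def listVerts (N : Multiset (List V)) : Multiset V := N.bind fun L => (L : Multiset V)

@[simp] theorem listVerts_cons (L : List V) (N : Multiset (List V)) :
    listVerts (L ::ₘ N) = (L : Multiset V) + listVerts N := Multiset.cons_bind _ _ _

@[simp] theorem listVerts_add (M N : Multiset (List V)) :
    listVerts (M + N) = listVerts M + listVerts N := Multiset.add_bind _ _ _

/-- A walk between vertices of `S`, using no edge inside `S`. -/
structure IsTrack (G : SimpleGraph V) (S : Finset V) (L : List V) : Prop where
  chain : L.IsChain (OffAdj G S)
  head : ∃ s ∈ S, L.head? = some s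
  last : ∃ t ∈ S, L.getLast? = some t
  two_le : 2 ≤ L.length

/-- A system of disjoint tracks through all of `U` and through the vertices `T` of `S`. -/
structure TrackSystem (G : SimpleGraph V) (S U T : Finset V) (N : Multiset (List V)) : Prop where
  track : ∀ L ∈ N, IsTrack G S L
  verts : listVerts N = U.val + T.val
  subset : T ⊆ S
  disjoint : Disjoint U S

theorem TrackSystem.nodup {U T : Finset V} {N : Multiset (List V)} (h : TrackSystem G S U T N) :
    (listVerts N).Nodup := by
  rw [h.verts, Multiset.nodup_add]
  exact ⟨U.nodup, T.nodup, Finset.disjoint_val.2 (Finset.disjoint_of_subset_right h.subset h.disjoint)⟩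

theorem TrackSystem.isFragment {U T : Finset V} {N : Multiset (List V)}
    (h : TrackSystem G S U T N) {L : List V} (hL : L ∈ N) : IsFragment G S L := by
  have h1 := h.track L hL
  refine ⟨h1.chain, ?_, h1.head, h1.last, h1.two_le⟩
  exact Multiset.coe_nodup.1 ((Multiset.nodup_bind.1 h.nodup).1 L hL)

theorem TrackSystem.union {U U' T T' : Finset V} {N N' : Multiset (List V)}
    (h : TrackSystem G S U T N) (h' : TrackSystem G S U' T' N') (hU : Disjoint U U')
    (hT : Disjoint T T') : TrackSystem G S (U ∪ U') (T ∪ T') (N + N') where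
  track := fun L hL => (Multiset.mem_add.1 hL).elim (h.track L) (h'.track L)
  verts := by
    rw [listVerts_add, h.verts, h'.verts, Finset.val_eq_add_of_disjoint hU rfl,
      Finset.val_eq_add_of_disjoint hT rfl]
    abel
  subset := Finset.union_subset h.subset h'.subset
  disjoint := Finset.disjoint_union_left.2 ⟨h.disjoint, h'.disjoint⟩

theorem isChain_offAdj {L : List V} (h : L.IsChain G.Adj) (hS : ∀ x ∈ L, x ∉ S) :
    L.IsChain (OffAdj G S) := by
  induction L with
  | nil => simp
  | cons x L ih =>
    rw [List.isChain_cons] at h ⊢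
    exact ⟨fun y hy => ⟨h.1 y hy, Or.inl (hS x (by simp))⟩,
      ih h.2 fun y hy => hS y (List.mem_cons_of_mem _ hy)⟩

/-- The core of a ported path together with its ports. -/
def PortedPath.track (P : PortedPath V) : List V := P.left.toList ++ P.core ++ P.right.toList

theorem PortedPath.Good.isTrack {C : Finset V} {P : PortedPath V} (h : P.Good G (· ∈ C)) {s t : V}
    (hs : s ∈ S) (hl : P.left = some s) (ht : t ∈ S) (hr : P.right = some t)
    (hC : ∀ x ∈ P.core, x ∉ S) : IsTrack G S P.track := by
  have e : P.track = s :: (P.core ++ [t]) := by simp [PortedPath.track, hl, hr]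
  obtain ⟨y, L, hyL⟩ := List.exists_cons_of_ne_nil h.ne_nil
  rw [e]
  refine ⟨?_, ⟨s, hs, rfl⟩, ⟨t, ht, by rw [← List.cons_append]; exact List.getLast?_concat⟩, by simp⟩
  rw [List.isChain_cons, List.isChain_append]
  refine ⟨?_, isChain_offAdj h.chain hC, by simp, ?_⟩
  · intro x hx
    have hx : P.core.head? = some x := by simpa [hyL] using hx
    exact ⟨(h.head x hx).2 s hl, Or.inr (hC x (List.mem_of_mem_head? hx))⟩
  · intro x hx z hz
    obtain rfl : t = z := by simpa using hz
    exact ⟨((h.last x hx).2 t hr).symm, Or.inl (hC x (List.mem_of_mem_getLast? hx))⟩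

/-- The vertices occurring as ports. -/
def portVerts (m : Multiset (Option V)) : Multiset V := m.bind fun o => (o.toList : Multiset V)

theorem portVerts_map_some (m : Multiset V) : portVerts (m.map some) = m := by
  rw [portVerts, Multiset.bind_map]
  exact Multiset.bind_singleton m id |>.trans (Multiset.map_id m)

theorem listVerts_map_track (M : Multiset (PortedPath V)) :
    listVerts (M.map PortedPath.track) = systemVerts M + portVerts (systemPorts M) := by
  induction M using Multiset.induction_on with
  | empty => rfl
  | cons P M ih =>
    have h1 : (P.track : Multiset V) = (P.core : Multiset V) + portVerts P.ports := by
      simp only [PortedPath.track, PortedPath.ports, portVerts, Multiset.insert_eq_cons,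
        Multiset.cons_bind, Multiset.singleton_bind, ← Multiset.coe_add]
      abel
    rw [Multiset.map_cons, listVerts_cons, ih, systemVerts_cons, systemPorts_cons, h1]
    simp only [portVerts, Multiset.add_bind]
    abel

theorem exists_ports_eq {M : Multiset (PortedPath V)}
    (hS : ∀ o ∈ systemPorts M, ∃ t ∈ S, o = some t)
    (hc : ∀ v, (systemPorts M).count (some v) ≤ 1) :
    ∃ T : Finset V, T ⊆ S ∧ systemPorts M = T.val.map some ∧ T.card = 2 * M.card := by
  have h : ∃ m : Multiset V, m.map some = systemPorts M := by
    refine ⟨portVerts (systemPorts M), ?_⟩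
    have : ∀ m : Multiset (Option V), (∀ o ∈ m, ∃ t ∈ S, o = some t) →
        (portVerts m).map some = m := by
      intro m
      induction m using Multiset.induction_on with
      | empty => simp [portVerts]
      | cons o m ih =>
        intro h
        obtain ⟨t, -, rfl⟩ := h o (Multiset.mem_cons_self _ _)
        have := ih fun o ho => h o (Multiset.mem_cons_of_mem ho)
        simp only [portVerts] at this
        simp [portVerts, this]
    exact this _ hS
  obtain ⟨m, hm⟩ := h
  have hnd : m.Nodup := by
    rw [Multiset.nodup_iff_count_le_one]
    intro v
    have := hc v
    rwa [← hm, Multiset.count_map_eq_count' _ _ (Option.some_injective V)] at this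
  refine ⟨⟨m, hnd⟩, ?_, hm.symm, ?_⟩
  · intro v hv
    obtain ⟨t, ht, e⟩ := hS (some v) (by
      rw [← hm]
      exact Multiset.mem_map_of_mem _ hv)
    cases e
    exact ht
  · rw [← card_systemPorts, ← hm, Multiset.card_map]
    rfl

theorem isTrack_of_system {C : Finset V} (hCS : Disjoint C S) {M : Multiset (PortedPath V)}
    (hg : ∀ Q ∈ M, Q.Good G (· ∈ C)) (hv : systemVerts M = C.val)
    (hS : ∀ o ∈ systemPorts M, ∃ t ∈ S, o = some t) {Q : PortedPath V} (hQ : Q ∈ M) :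
    IsTrack G S Q.track := by
  obtain ⟨s, hs, hl⟩ := hS Q.left (mem_systemPorts.2 ⟨Q, hQ, PortedPath.mem_ports.2 (Or.inl rfl)⟩)
  obtain ⟨t, ht, hr⟩ := hS Q.right (mem_systemPorts.2 ⟨Q, hQ, PortedPath.mem_ports.2 (Or.inr rfl)⟩)
  refine (hg Q hQ).isTrack hs hl ht hr fun x hx => Finset.disjoint_left.1 hCS ?_
  rw [← Finset.mem_val, ← hv, systemVerts, Multiset.mem_bind]
  exact ⟨Q, hQ, hx⟩

theorem IsTrack.link {P Q : PortedPath V} {s : V} (hP : IsTrack G S P.track)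
    (hQ : IsTrack G S Q.track) (hPs : P.right = some s) (hQs : Q.left = some s) (hQne : Q.core ≠ []) :
    IsTrack G S (P.link s Q).track := by
  have eP : P.track = P.left.toList ++ P.core ++ [s] := by simp [PortedPath.track, hPs]
  have eQ : Q.track = s :: (Q.core ++ Q.right.toList) := by simp [PortedPath.track, hQs]
  have e : (P.link s Q).track = P.track ++ (Q.core ++ Q.right.toList) := by
    rw [eP]
    simp [PortedPath.track, PortedPath.link]
  have hne : Q.core ++ Q.right.toList ≠ [] := by simp [hQne]
  have hne' : P.track ≠ [] := by simp [eP]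
  have hQc := List.isChain_cons.1 (eQ ▸ hQ.chain)
  rw [e]
  refine ⟨?_, ?_, ?_, ?_⟩
  · rw [List.isChain_append]
    refine ⟨hP.chain, hQc.2, fun x hx y hy => ?_⟩
    obtain rfl : s = x := by simpa [eP] using hx
    exact hQc.1 y hy
  · obtain ⟨t, ht, h⟩ := hP.head
    refine ⟨t, ht, ?_⟩
    rw [List.head?_append_of_ne_nil _ hne', h]
  · obtain ⟨t, ht, h⟩ := hQ.last
    refine ⟨t, ht, ?_⟩
    rw [List.getLast?_append_of_ne_nil _ hne, ← h, eQ]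
    obtain ⟨y, L, hL⟩ := List.exists_cons_of_ne_nil hne
    rw [hL, List.getLast?_cons_cons]
  · have := hP.two_le
    rw [List.length_append]
    omega

end FragmentSystems

section CrossingSystem
open scoped Classical

variable {V ι : Type*} {G : SimpleGraph V} {S : Finset V} {D : ι → Finset V}

theorem CutSystem.disjoint_left (C : CutSystem G S D) (i : ι) : Disjoint (D i) S :=
  Finset.disjoint_left.2 fun _ hx => C.notMem hx

/-- The vertices of `W` witness that `C` can be spanned by `m` paths. -/
def Spanning (G : SimpleGraph V) (S C : Finset V) (m : ℕ) (W : Finset V)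
    (F : Finset (Finset V)) : Prop :=
  W ⊆ C ∧ ClosedFamily G C (S ∪ W) F ∧ F.Nonempty ∧ 8 * m + 2 * W.card ≤ 9 * F.card

theorem ports_mem_iff {M : Multiset (PortedPath V)} {T : Finset V}
    (h : systemPorts M = T.val.map some) {t : V} : some t ∈ systemPorts M ↔ t ∈ T := by
  rw [h, Multiset.mem_map_of_injective (Option.some_injective V), Finset.mem_val]

theorem exists_trackSystem_of_pair {A B : Finset V} (hA : Disjoint A S) (hB : Disjoint B S)
    (hAB : Disjoint A B) {M N : Multiset (PortedPath V)} {T U : Finset V} {s : V}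
    (hM : ∀ Q ∈ M, Q.Good G (· ∈ A)) (hMv : systemVerts M = A.val) (hTS : T ⊆ S)
    (hMT : systemPorts M = T.val.map some)
    (hN : ∀ Q ∈ N, Q.Good G (· ∈ B)) (hNv : systemVerts N = B.val) (hUS : U ⊆ S)
    (hNU : systemPorts N = U.val.map some) (hTU : T ∩ U = {s}) :
    ∃ R, TrackSystem G S (A ∪ B) (T ∪ U) R ∧ ∃ L ∈ R, (∃ x ∈ L, x ∈ A) ∧ ∃ y ∈ L, y ∈ B := by
  have hs : s ∈ T ∩ U := by simp [hTU]
  obtain ⟨hsT, hsU⟩ := Finset.mem_inter.1 hs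
  have hMS : ∀ o ∈ systemPorts M, ∃ t ∈ S, o = some t := by
    intro o ho
    rw [hMT] at ho
    obtain ⟨t, ht, rfl⟩ := Multiset.mem_map.1 ho
    exact ⟨t, hTS ht, rfl⟩
  have hNS : ∀ o ∈ systemPorts N, ∃ t ∈ S, o = some t := by
    intro o ho
    rw [hNU] at ho
    obtain ⟨t, ht, rfl⟩ := Multiset.mem_map.1 ho
    exact ⟨t, hUS ht, rfl⟩
  obtain ⟨P, hP, hsP⟩ := mem_systemPorts.1 ((ports_mem_iff hMT).2 hsT)
  obtain ⟨Q, hQ, hsQ⟩ := mem_systemPorts.1 ((ports_mem_iff hNU).2 hsU)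
  obtain ⟨M', rfl⟩ := Multiset.exists_cons_of_mem hP
  obtain ⟨N', rfl⟩ := Multiset.exists_cons_of_mem hQ
  obtain ⟨P', hP', hPc, hPp, hPr⟩ := (hM P hP).exists_right (some s)
  obtain ⟨Q', hQ', hQc, hQp, hQl⟩ := (hN Q hQ).exists_left (some s)
  replace hPr := hPr hsP
  replace hQl := hQl hsQ
  have hM1 : ∀ R ∈ P' ::ₘ M', R.Good G (· ∈ A) := by
    intro R hR
    rcases Multiset.mem_cons.1 hR with rfl | hR
    · exact hP'
    · exact hM R (Multiset.mem_cons_of_mem hR)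
  have hN1 : ∀ R ∈ Q' ::ₘ N', R.Good G (· ∈ B) := by
    intro R hR
    rcases Multiset.mem_cons.1 hR with rfl | hR
    · exact hQ'
    · exact hN R (Multiset.mem_cons_of_mem hR)
  have eMp : systemPorts (P' ::ₘ M') = systemPorts (P ::ₘ M') := by simp [hPp]
  have eMv : systemVerts (P' ::ₘ M') = systemVerts (P ::ₘ M') := by simp [hPc]
  have eNp : systemPorts (Q' ::ₘ N') = systemPorts (Q ::ₘ N') := by simp [hQp]
  have eNv : systemVerts (Q' ::ₘ N') = systemVerts (Q ::ₘ N') := by simp [hQc]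
  have tM : ∀ R ∈ P' ::ₘ M', IsTrack G S R.track := fun R hR =>
    isTrack_of_system hA hM1 (eMv.trans hMv) (eMp ▸ hMS) hR
  have tN : ∀ R ∈ Q' ::ₘ N', IsTrack G S R.track := fun R hR =>
    isTrack_of_system hB hN1 (eNv.trans hNv) (eNp ▸ hNS) hR
  have vM := listVerts_map_track (P' ::ₘ M')
  have vN := listVerts_map_track (Q' ::ₘ N')
  rw [eMp, eMv, hMv, hMT, portVerts_map_some] at vM
  rw [eNp, eNv, hNv, hNU, portVerts_map_some] at vN
  have hlink : (P'.track : Multiset V) + Q'.track = s ::ₘ ((P'.link s Q').track : Multiset V) := by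
    simp only [PortedPath.track, PortedPath.link, hPr, hQl, ← Multiset.coe_add, ← Multiset.cons_coe,
      Option.toList_some, Multiset.coe_nil]
    simp only [← Multiset.singleton_add]
    abel
  have hTUv : T.val + U.val = s ::ₘ (T ∪ U).val := by
    rw [← Multiset.union_add_inter, ← Finset.inter_val, hTU, ← Finset.union_val,
      Finset.singleton_val, ← Multiset.singleton_add, add_comm]
  refine ⟨(P'.link s Q').track ::ₘ (M'.map PortedPath.track + N'.map PortedPath.track),
    ⟨?_, ?_, Finset.union_subset hTS hUS, Finset.disjoint_union_left.2 ⟨hA, hB⟩⟩,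
    (P'.link s Q').track, Multiset.mem_cons_self _ _, ?_, ?_⟩
  · intro L hL
    rcases Multiset.mem_cons.1 hL with rfl | hL
    · exact (tM _ (Multiset.mem_cons_self _ _)).link (tN _ (Multiset.mem_cons_self _ _)) hPr hQl
        hQ'.ne_nil
    · rcases Multiset.mem_add.1 hL with hL | hL
      · obtain ⟨R, hR, rfl⟩ := Multiset.mem_map.1 hL
        exact tM R (Multiset.mem_cons_of_mem hR)
      · obtain ⟨R, hR, rfl⟩ := Multiset.mem_map.1 hL
        exact tN R (Multiset.mem_cons_of_mem hR)
  · rw [Multiset.map_cons, listVerts_cons] at vM vN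
    have h : s ::ₘ listVerts ((P'.link s Q').track ::ₘ
        (M'.map PortedPath.track + N'.map PortedPath.track)) =
        s ::ₘ ((A ∪ B).val + (T ∪ U).val) := by
      rw [listVerts_cons, listVerts_add, ← Multiset.cons_add, ← hlink, ← Multiset.add_cons, ← hTUv,
        Finset.val_eq_add_of_disjoint hAB rfl]
      calc _ = ((P'.track : Multiset V) + listVerts (M'.map PortedPath.track)) +
            ((Q'.track : Multiset V) + listVerts (N'.map PortedPath.track)) := by abel
        _ = _ := by rw [vM, vN]; abel
    exact (Multiset.cons_inj_right s).1 h
  · obtain ⟨x, L, hx⟩ := List.exists_cons_of_ne_nil hP'.ne_nil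
    refine ⟨x, by simp [PortedPath.track, PortedPath.link, hx], (hP'.head x (by simp [hx])).1⟩
  · obtain ⟨x, L, hx⟩ := List.exists_cons_of_ne_nil hQ'.ne_nil
    refine ⟨x, by simp [PortedPath.track, PortedPath.link, hx], (hQ'.head x (by simp [hx])).1⟩

theorem CutSystem.disjoint_of_ne (C : CutSystem G S D) {i j : ι} (h : i ≠ j) :
    Disjoint (D i) (D j) :=
  Finset.disjoint_left.2 fun _ hx hy => h (C.mem_unique hx hy)

theorem CutSystem.exists_crossing [Fintype V] (C : CutSystem G S D) {i j : ι} (hij : i ≠ j) {s : V}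
    (hs : s ∈ S) :
    ∃ (m n : ℕ) (W W' : Finset V) (F F' : Finset (Finset V)) (T : Finset V)
      (N : Multiset (List V)), Spanning G S (D i) m W F ∧ Spanning G S (D j) n W' F' ∧
      TrackSystem G S (D i ∪ D j) T N ∧ T.card ≤ 2 * (m + n) ∧ ∃ L ∈ N, IsCrossing D L := by
  obtain ⟨P, cand, hP⟩ := C.exists_package hs i
  obtain ⟨Q, cand', hQ⟩ := C.exists_package hs j
  obtain ⟨φ, φ', h1, h2, h3, h4, h5⟩ := C.exists_representatives hij hs hP hQ
  obtain ⟨M, hM, hMv, hMS, hMc, hMp, hMs, F, W, hF⟩ := hP.realize φ h1 h2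
  obtain ⟨N, hN, hNv, hNS, hNc, hNp, hNs, F', W', hF'⟩ := hQ.realize φ' h3 h4
  obtain ⟨T, hTS, hMT, hTc⟩ := exists_ports_eq hMS hMc
  obtain ⟨U, hUS, hNU, hUc⟩ := exists_ports_eq hNS hNc
  have hTU : T ∩ U = {s} := by
    ext t
    rw [Finset.mem_inter, Finset.mem_singleton, ← ports_mem_iff hMT, ← ports_mem_iff hNU]
    refine ⟨fun ⟨ht, hu⟩ => ?_, by rintro rfl; exact ⟨hMs, hNs⟩⟩
    by_contra hne
    obtain ⟨p, hp, e⟩ := (hMp _ ht).resolve_left (by simpa using hne)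
    obtain ⟨q, hq, e'⟩ := (hNp _ hu).resolve_left (by simpa using hne)
    cases e
    exact h5 p hp q hq (Option.some_injective V e')
  obtain ⟨R, hR, L, hL, ⟨x, hx, hxi⟩, y, hy, hyj⟩ := exists_trackSystem_of_pair
    (C.disjoint_left i) (C.disjoint_left j) (C.disjoint_of_ne hij) hM hMv hTS hMT hN hNv hUS hNU hTU
  refine ⟨M.card, N.card, W, W', F, F', T ∪ U, R, hF, hF', hR, ?_, L, hL, i, j, hij, ⟨x, hx, hxi⟩,
    y, hy, hyj⟩
  have := Finset.card_union_le T U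
  omega

end CrossingSystem

section Assembly
open scoped Classical

variable {V ι : Type*} {G : SimpleGraph V} {S : Finset V} {D : ι → Finset V}

/-- `C` is spanned by `m` disjoint paths. -/
def HasSystem (G : SimpleGraph V) (C : Finset V) (m : ℕ) : Prop :=
  ∃ M : Multiset (PortedPath V), M.card = m ∧ (∀ Q ∈ M, Q.Good G (· ∈ C)) ∧ systemVerts M = C.val

theorem CutSystem.closedFamily_layout (C : CutSystem G S D) {i : ι} {W : Finset V}
    {𝒦 : Finset (Finset V)} (h : Layout G (D i) W 𝒦) : ClosedFamily G (D i) (S ∪ W) 𝒦 := by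
  refine ⟨h.nonempty, fun K hK => h.piece_subset hK, fun K hK => ?_, fun K hK x hx y hxy => ?_,
    h.pairwiseDisjoint⟩
  · exact Finset.disjoint_union_right.2
      ⟨Finset.disjoint_of_subset_left (h.piece_subset hK) (C.disjoint_left i), h.disjoint_piece hK⟩
  · rw [Finset.mem_union]
    rcases C.mem_or_of_adj (h.piece_subset hK hx) hxy with hy | hy
    · rcases h.mem_iff.1 hy with hy | ⟨K', hK', hy⟩
      · exact Or.inr (Or.inr hy)
      · left
        by_contra hcon
        exact h.apart K hK K' hK' (by rintro rfl; exact hcon hy) x hx y hy hxy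
    · exact Or.inr (Or.inl hy)

theorem CutSystem.exists_spanning (C : CutSystem G S D) (i : ι) :
    ∃ m W F, Spanning G S (D i) m W F ∧ HasSystem G (D i) m := by
  obtain ⟨W, F, h⟩ := NoPathOn.exists_layout _ rfl (C.noPathOn i) (C.nonempty i)
  obtain ⟨M, h1, h2, h3⟩ := h.hasCover
  have := h.card
  exact ⟨M.card, W, F, ⟨h.subset, C.closedFamily_layout h, Finset.card_pos.1 (by omega), by omega⟩,
    M, rfl, h2, h3⟩

theorem CutSystem.sum_le [Fintype ι] (C : CutSystem G S D) {m : ι → ℕ} {W : ι → Finset V}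
    {F : ι → Finset (Finset V)} (h : ∀ i, Spanning G S (D i) (m i) (W i) (F i)) {i j : ι}
    (hij : i ≠ j) : 4 * ∑ k, m k ≤ S.card := by
  have h2 : 2 ≤ ∑ k, (F k).card := by
    have h1 : ∑ k ∈ {i, j}, (F k).card ≤ ∑ k, (F k).card :=
      Finset.sum_le_sum_of_subset (Finset.subset_univ _)
    rw [Finset.sum_pair hij] at h1
    have := (h i).2.2.1.card_pos
    have := (h j).2.2.1.card_pos
    omega
  have h3 := C.card_biUnion_le (I := Finset.univ) (fun k _ => (h k).2.1)
    (fun k _ => Finset.union_subset_union_right (h k).1) h2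
  have h4 : (Finset.univ.biUnion fun k => S ∪ W k).card ≤ S.card + ∑ k, (W k).card := by
    refine (Finset.card_le_card (t := S ∪ Finset.univ.biUnion W) ?_).trans
      ((Finset.card_union_le _ _).trans (Nat.add_le_add_left Finset.card_biUnion_le _))
    intro v hv
    simp only [Finset.mem_biUnion, Finset.mem_union, Finset.mem_univ, true_and] at hv ⊢
    obtain ⟨k, hv | hv⟩ := hv
    · exact Or.inl hv
    · exact Or.inr ⟨k, hv⟩
  have h5 : ∑ k, (8 * m k + 2 * (W k).card) ≤ ∑ k, 9 * (F k).card :=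
    Finset.sum_le_sum fun k _ => (h k).2.2.2
  rw [Finset.sum_add_distrib, ← Finset.mul_sum, ← Finset.mul_sum, ← Finset.mul_sum] at h5
  omega

theorem exists_tracks {C X : Finset V} (hC : Disjoint C S) (hX : X ⊆ S)
    (hadj : ∀ t ∈ X, ∀ x ∈ C, G.Adj t x) (M : Multiset (PortedPath V))
    (hM : ∀ Q ∈ M, Q.Good G (· ∈ C) ∧ ∀ x ∈ Q.core, x ∈ C) (hcard : 2 * M.card ≤ X.card) :
    ∃ T ⊆ X, T.card = 2 * M.card ∧ ∃ N : Multiset (List V), (∀ L ∈ N, IsTrack G S L) ∧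
      listVerts N = systemVerts M + T.val := by
  induction M using Multiset.induction_on with
  | empty => exact ⟨∅, Finset.empty_subset _, rfl, 0, by simp, rfl⟩
  | cons Q M ih =>
    rw [Multiset.card_cons] at hcard
    obtain ⟨T, hT, hTc, N, hN, hv⟩ := ih (fun P hP => hM P (Multiset.mem_cons_of_mem hP)) (by omega)
    have h1 := Finset.card_sdiff_add_card_eq_card hT
    obtain ⟨Y, hYX, hYc⟩ := Finset.exists_subset_card_eq (show 2 ≤ (X \ T).card by omega)
    obtain ⟨a, b, hab, rfl⟩ := Finset.card_eq_two.1 hYc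
    obtain ⟨ha, haT⟩ := Finset.mem_sdiff.1 (hYX (Finset.mem_insert_self a _))
    obtain ⟨hb, hbT⟩ := Finset.mem_sdiff.1 (hYX (Finset.mem_insert_of_mem (Finset.mem_singleton_self b)))
    obtain ⟨hQ, hQC⟩ := hM Q (Multiset.mem_cons_self _ _)
    have haT' : a ∉ insert b T := by simp [hab, haT]
    refine ⟨insert a (insert b T), ?_, ?_, (⟨some a, Q.core, some b⟩ : PortedPath V).track ::ₘ N,
      ?_, ?_⟩
    · simp [Finset.insert_subset_iff, ha, hb, hT]
    · rw [Finset.card_insert_of_notMem haT', Finset.card_insert_of_notMem hbT, Multiset.card_cons]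
      omega
    · intro L hL
      rcases Multiset.mem_cons.1 hL with rfl | hL
      · refine PortedPath.Good.isTrack (C := C) ⟨hQ.ne_nil, hQ.chain, fun x hx => ?_, fun x hx => ?_⟩
          (hX ha) rfl (hX hb) rfl fun x hx => Finset.disjoint_left.1 hC (hQC x hx)
        · refine ⟨(hQ.head x hx).1, fun t ht => ?_⟩
          cases ht
          exact hadj a ha x (hQ.head x hx).1
        · refine ⟨(hQ.last x hx).1, fun t ht => ?_⟩
          cases ht
          exact hadj b hb x (hQ.last x hx).1
      · exact hN L hL
    · rw [listVerts_cons, hv, Finset.insert_val_of_notMem haT', Finset.insert_val_of_notMem hbT,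
        systemVerts_cons]
      simp only [PortedPath.track, Option.toList_some, ← Multiset.coe_add, Multiset.coe_singleton,
        ← Multiset.singleton_add]
      abel

theorem HasSystem.exists_trackSystem {C X : Finset V} {m : ℕ} (h : HasSystem G C m)
    (hC : Disjoint C S) (hX : X ⊆ S) (hadj : ∀ t ∈ X, ∀ x ∈ C, G.Adj t x) (hm : 2 * m ≤ X.card) :
    ∃ T ⊆ X, T.card = 2 * m ∧ ∃ N, TrackSystem G S C T N := by
  obtain ⟨M, rfl, h1, h2⟩ := h
  obtain ⟨T, hT, hTc, N, hN, hv⟩ := exists_tracks hC hX hadj M (fun Q hQ => ⟨h1 Q hQ, fun x hx => by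
    rw [← Finset.mem_val, ← h2, systemVerts, Multiset.mem_bind]
    exact ⟨Q, hQ, hx⟩⟩) hm
  exact ⟨T, hT, hTc, N, hN, by rw [hv, h2], hT.trans hX, hC⟩

/-- The vertices of `S` not adjacent to all of `C`. -/
noncomputable def incomplete (G : SimpleGraph V) (S C : Finset V) : Finset V :=
  S.filter fun t => ∃ x ∈ C, ¬ G.Adj t x

theorem CutSystem.disjoint_incomplete (C : CutSystem G S D) {i j k : ι} (hij : i ≠ j) (hik : i ≠ k)
    (hjk : j ≠ k) : Disjoint (incomplete G S (D i)) (incomplete G S (D j)) := by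
  rw [Finset.disjoint_left]
  intro t ht ht'
  obtain ⟨hs, z, hz, htz⟩ := Finset.mem_filter.1 ht
  obtain ⟨-, y, hy, hty⟩ := Finset.mem_filter.1 ht'
  obtain ⟨c, hc, g, hg, htc, htg, hcg⟩ := C.exists_adj_not_adj hs hy hty
  obtain ⟨e, he, hte⟩ := C.nbr t hs k
  exact C.noPathPoint g c t e z hcg.symm htc.symm hte (fun h => htg h.symm)
    (C.not_adj hc he hjk) (C.not_adj hg he hjk) (C.not_adj hz hg hij) (C.not_adj hz hc hij)
    (fun h => htz h.symm) (C.not_adj hz he hik)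

theorem CutSystem.exists_trackSystem [Fintype V] [Fintype ι] [Nonempty ι] (C : CutSystem G S D) {s : V}
    (hs : s ∈ S) :
    ∃ T N, TrackSystem G S (Finset.univ.biUnion D) T N ∧ ∃ L ∈ N, IsCrossing D L := by
  obtain ⟨i, -, hi⟩ := Finset.exists_max_image Finset.univ
    (fun k => (incomplete G S (D k)).card) Finset.univ_nonempty
  obtain ⟨j, hji⟩ := C.two i
  obtain ⟨m₁, m₂, W₁, W₂, F₁, F₂, T₀, N₀, h1, h2, hN₀, hT₀, hL₀⟩ := C.exists_crossing hji.symm hs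
  have hex : ∀ k, ∃ m W F, Spanning G S (D k) m W F ∧ (k = i → m = m₁) ∧ (k = j → m = m₂) ∧
      (k ≠ i → k ≠ j → HasSystem G (D k) m) := by
    intro k
    by_cases hki : k = i
    · subst hki
      exact ⟨m₁, W₁, F₁, h1, fun _ => rfl, fun h => absurd h.symm hji, fun h => absurd rfl h⟩
    · by_cases hkj : k = j
      · subst hkj
        exact ⟨m₂, W₂, F₂, h2, fun h => absurd h hki, fun _ => rfl, fun _ h => absurd rfl h⟩
      · obtain ⟨m, W, F, h3, h4⟩ := C.exists_spanning k
        exact ⟨m, W, F, h3, fun h => absurd h hki, fun h => absurd h hkj, fun _ _ => h4⟩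
  choose m W F hsp hmi hmj hsys using hex
  have hsum := C.sum_le hsp hji
  have key : ∀ J : Finset ι, i ∉ J → j ∉ J →
      ∃ T N, TrackSystem G S ((D i ∪ D j) ∪ J.biUnion D) T N ∧
        T.card ≤ 2 * (m i + (m j + ∑ k ∈ J, m k)) ∧ ∃ L ∈ N, IsCrossing D L := by
    intro J
    induction J using Finset.induction_on with
    | empty =>
      intro _ _
      refine ⟨T₀, N₀, by simpa using hN₀, ?_, hL₀⟩
      rw [hmi i rfl, hmj j rfl]
      simpa using hT₀
    | insert k J hk ih =>
      intro hiJ hjJ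
      rw [Finset.mem_insert, not_or] at hiJ hjJ
      obtain ⟨T, N, hN, hT, L, hL, hLc⟩ := ih hiJ.2 hjJ.2
      have hle : m i + (m j + ∑ l ∈ insert k J, m l) ≤ ∑ l, m l := by
        rw [← Finset.sum_insert (by simpa using hjJ),
          ← Finset.sum_insert (by simpa [hji.symm] using hiJ)]
        exact Finset.sum_le_sum_of_subset (Finset.subset_univ _)
      rw [Finset.sum_insert hk] at hle ⊢
      have hdis := C.disjoint_incomplete hiJ.1 hji.symm (Ne.symm hjJ.1)
      have hmax := hi k (Finset.mem_univ k)
      have hinc : (incomplete G S (D i)).card + (incomplete G S (D k)).card ≤ S.card := by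
        rw [← Finset.card_union_of_disjoint hdis]
        exact Finset.card_le_card (Finset.union_subset (Finset.filter_subset _ _)
          (Finset.filter_subset _ _))
      have hX : S.card ≤ (S \ (incomplete G S (D k) ∪ T)).card +
          ((incomplete G S (D k)).card + T.card) := by
        have h3 := Finset.le_card_sdiff (incomplete G S (D k) ∪ T) S
        have h4 := Finset.card_union_le (incomplete G S (D k)) T
        omega
      obtain ⟨T', hT', hTc', N', hN'⟩ := (hsys k (Ne.symm hiJ.1) (Ne.symm hjJ.1)).exists_trackSystem
        (C.disjoint_left k) (X := S \ (incomplete G S (D k) ∪ T)) Finset.sdiff_subset (by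
          intro t ht x hx
          rw [Finset.mem_sdiff, Finset.mem_union, not_or] at ht
          by_contra hcon
          exact ht.2.1 (Finset.mem_filter.2 ⟨ht.1, x, hx, hcon⟩)) (by omega)
      have hU : Disjoint ((D i ∪ D j) ∪ J.biUnion D) (D k) := by
        simp only [Finset.disjoint_union_left, Finset.disjoint_biUnion_left]
        exact ⟨⟨C.disjoint_of_ne hiJ.1, C.disjoint_of_ne hjJ.1⟩, fun l hl =>
          C.disjoint_of_ne (by rintro rfl; exact hk hl)⟩
      have hTT : Disjoint T T' := by
        rw [Finset.disjoint_left]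
        intro t ht ht'
        exact (Finset.mem_sdiff.1 (hT' ht')).2 (Finset.mem_union_right _ ht)
      refine ⟨T ∪ T', N + N', ?_, ?_, L, Multiset.mem_add.2 (Or.inl hL), hLc⟩
      · have := hN.union hN' hU hTT
        rwa [Finset.union_assoc, Finset.union_comm _ (D k), ← Finset.biUnion_insert] at this
      · have := Finset.card_union_le T T'
        omega
  obtain ⟨T, N, hN, -, hL⟩ := key ((Finset.univ.erase i).erase j) (by simp) (by simp)
  refine ⟨T, N, ?_, hL⟩
  convert hN
  ext v
  simp only [Finset.mem_biUnion, Finset.mem_union, Finset.mem_univ, true_and, Finset.mem_erase,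
    and_true]
  constructor
  · rintro ⟨k, hk⟩
    by_cases hki : k = i
    · exact Or.inl (Or.inl (hki ▸ hk))
    · by_cases hkj : k = j
      · exact Or.inl (Or.inr (hkj ▸ hk))
      · exact Or.inr ⟨k, ⟨hkj, hki⟩, hk⟩
  · rintro ((h | h) | ⟨k, -, hk⟩)
    exacts [⟨i, h⟩, ⟨j, h⟩, ⟨k, hk⟩]

theorem CutSystem.separator_nonempty [Nonempty ι] (C : CutSystem G S D) : S.Nonempty := by
  obtain ⟨i⟩ := ‹Nonempty ι›
  obtain ⟨j, hji⟩ := C.two i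
  have h := C.card_biUnion_le (I := {i, j}) (T := fun _ => S) (F := fun k => {D k})
    (fun k _ => closedFamily_singleton (C.nonempty k) le_rfl (C.disjoint_left k)
      fun x hx y hxy => C.mem_or_of_adj hx hxy)
    (fun _ _ => Finset.subset_union_left) (by simp [hji.symm])
  rw [Finset.nonempty_iff_ne_empty]
  rintro rfl
  simp [Finset.sum_pair hji.symm] at h

theorem CutSystem.exists_walk [Fintype V] [Fintype ι] [Nonempty ι] (C : CutSystem G S D) :
    ∃ (u v : V) (p : G.Walk u v), u ∈ S ∧ v ∈ S ∧ u ≠ v ∧ p.IsPath ∧ ∀ x ∉ S, x ∈ p.support := by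
  obtain ⟨s, hs⟩ := C.separator_nonempty
  obtain ⟨T, N, hN, hL⟩ := C.exists_trackSystem hs
  induction N using Quotient.inductionOn with | _ F =>
  have hF : listVerts (F : Multiset (List V)) = (F.flatten : Multiset V) := by
    rw [listVerts, Multiset.coe_bind, List.flatMap_id']
  have hnd := hN.nodup
  have hv := hN.verts
  change (listVerts (F : Multiset (List V))).Nodup at hnd
  change listVerts (F : Multiset (List V)) = _ at hv
  rw [hF] at hnd hv
  refine C.exists_walk_of_family (F := F) (fun L hL => hN.isFragment hL)
    (List.nodup_iff_count_le_one.1 (Multiset.coe_nodup.1 hnd)) (fun v hvS => ?_) hL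
  obtain ⟨k, hk⟩ := C.cover hvS
  rw [← Multiset.mem_coe, hv]
  exact Multiset.mem_add.2 (Or.inl (Finset.mem_biUnion.2 ⟨k, Finset.mem_univ k, hk⟩))

end Assembly

theorem stmt11 {V : Type*} [Fintype V] (G : SimpleGraph V)
    (htough : Tough 4.5 G) (hfree : P4P1Free G)
    (S : Set V) (hcut : IsCutset G S) (hmin : ∀ T : Set V, T ⊂ S → ¬ IsCutset G T) :
    ∃ (u v : V) (p : G.Walk u v), u ∈ S ∧ v ∈ S ∧ u ≠ v ∧ p.IsPath ∧
      ∀ x ∉ S, x ∈ p.support := by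
  classical
  obtain ⟨D, hD⟩ := exists_cutSystem htough hfree hcut hmin
  have : Fintype (G.induce Sᶜ).ConnectedComponent := Fintype.ofFinite _
  have : Nonempty (G.induce Sᶜ).ConnectedComponent := by
    have h : 2 ≤ Nat.card (G.induce Sᶜ).ConnectedComponent := hcut
    exact (Nat.card_pos_iff.1 (by omega)).1
  obtain ⟨u, v, p, hu, hv, huv, hp, h⟩ := hD.exists_walk
  exact ⟨u, v, p, by simpa using hu, by simpa using hv, huv, hp, fun x hx => h x (by simpa using hx)⟩
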